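/- arXiv:2308.11586 — 2 statements merged into one kernel-verified Lean document; each statement's English description precedes it below -/
import Mathlib

section
/- Let X = (⊕_{n∈ℕ} ℓ₂ⁿ)_{ℓ₁} be the ℓ₁-direct sum of the finite-dimensional Euclidean spaces ℓ₂ⁿ. Then every homomorphism from the Banach algebra B(X) of bounded linear operators on X into a Banach algebra is continuous and has closed range. -/
open scoped ENNReal

section BlockOperators

open Filter Topology

variable {𝕜 : Type*} [RCLike 𝕜] {E : ℕ → Type*} [∀ n, NormedAddCommGroup (E n)]
  [∀ n, InnerProductSpace 𝕜 (E n)]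

theorem lp_one_hasSum_norm (x : lp E 1) : HasSum (fun n => ‖x n‖) ‖x‖ := by
  have h := lp.hasSum_norm (p := 1) (by simp) x
  simpa using h

theorem lp_one_hasSum_single (x : lp E 1) : HasSum (fun n => lp.single 1 n (x n)) x :=
  lp.hasSum_single (by simp) x

theorem lp_one_norm_single (n : ℕ) (x : E n) : ‖lp.single (E := E) 1 n x‖ = ‖x‖ :=
  lp.norm_single (by simp) n x

theorem opNorm_le_of_blocks {Y : Type*} [NormedAddCommGroup Y] [NormedSpace 𝕜 Y]
    (T : lp E 1 →L[𝕜] Y) {M : ℝ} (hM : 0 ≤ M)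
    (h : ∀ n (x : E n), ‖T (lp.single 1 n x)‖ ≤ M * ‖x‖) : ‖T‖ ≤ M := by
  refine T.opNorm_le_bound hM fun x => ?_
  have h1 : HasSum (fun n => T (lp.single 1 n (x n))) (T x) :=
    (lp_one_hasSum_single x).mapL T
  exact h1.norm_le_of_bounded ((lp_one_hasSum_norm x).mul_left M) fun n => h n (x n)

theorem ext_of_blocks {Y : Type*} [NormedAddCommGroup Y] [NormedSpace 𝕜 Y]
    {S T : lp E 1 →L[𝕜] Y}
    (h : ∀ n (x : E n), S (lp.single 1 n x) = T (lp.single 1 n x)) : S = T := by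
  refine lp.ext_continuousLinearMap (by simp) fun n => ?_
  ext x
  exact h n x

theorem exists_clm_of_blocks {Y : Type*} [NormedAddCommGroup Y] [NormedSpace 𝕜 Y]
    [CompleteSpace Y] (C : ∀ n, E n →L[𝕜] Y) {M : ℝ} (hM : 0 ≤ M)
    (hC : ∀ n x, ‖C n x‖ ≤ M * ‖x‖) :
    ∃ T : lp E 1 →L[𝕜] Y, ‖T‖ ≤ M ∧ (∀ n x, T (lp.single 1 n x) = C n x) ∧
      ∀ x, HasSum (fun n => C n (x n)) (T x) := by
  have hs : ∀ x : lp E 1, Summable fun n => C n (x n) := fun x =>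
    Summable.of_norm_bounded ((lp_one_hasSum_norm x).summable.mul_left M) fun n => hC n (x n)
  let T₀ : lp E 1 →ₗ[𝕜] Y :=
    { toFun := fun x => ∑' n, C n (x n)
      map_add' := fun x y => by
        rw [← (hs x).tsum_add (hs y)]
        exact tsum_congr fun n => by rw [lp.coeFn_add, Pi.add_apply, map_add]
      map_smul' := fun c x => by
        rw [RingHom.id_apply, ← (hs x).tsum_const_smul c]
        exact tsum_congr fun n => by rw [lp.coeFn_smul, Pi.smul_apply, map_smul] }
  have hT₀ : ∀ x, HasSum (fun n => C n (x n)) (T₀ x) := fun x => (hs x).hasSum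
  have hb : ∀ x, ‖T₀ x‖ ≤ M * ‖x‖ := fun x =>
    (hT₀ x).norm_le_of_bounded ((lp_one_hasSum_norm x).mul_left M) fun n => hC n (x n)
  refine ⟨T₀.mkContinuous M hb, T₀.mkContinuous_norm_le hM hb, fun n x => ?_, hT₀⟩
  refine (hT₀ (lp.single 1 n x)).unique ?_
  convert hasSum_single n (f := fun k => C k ((lp.single 1 n x : lp E 1) k)) ?_ using 1
  · simp
  · intro k hk
    rw [lp.single_apply_ne _ _ _ hk, map_zero]

theorem eval_apply_eq (n : ℕ) (x : lp E 1) : lp.evalCLM 𝕜 E 1 n x = x n := rfl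

theorem starProjection_ite_top_bot {F : Type*} [NormedAddCommGroup F] [InnerProductSpace 𝕜 F]
    (p : Prop) [Decidable p]
    [(if p then ⊤ else ⊥ : Submodule 𝕜 F).HasOrthogonalProjection] (x : F) :
    (if p then ⊤ else ⊥ : Submodule 𝕜 F).starProjection x = if p then x else 0 := by
  by_cases h : p
  · exact (Submodule.starProjection_eq_self_iff.2 (by rw [if_pos h]; trivial)).trans
      (if_pos h).symm
  · have h₀ : ∀ y ∈ (if p then ⊤ else ⊥ : Submodule 𝕜 F), y = 0 := by
      rw [if_neg h]; simp
    exact (h₀ _ (Submodule.starProjection_apply_mem _ x)).trans (if_neg h).symm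

theorem exists_sum_inner_smul_eq_starProjection {F : Type*} [NormedAddCommGroup F]
    [InnerProductSpace 𝕜 F] [FiniteDimensional 𝕜 F] (L : Submodule 𝕜 F) {r : ℕ}
    (hr : Module.finrank 𝕜 L ≤ r) :
    ∃ w : ℕ → F, (∀ i, ‖w i‖ ≤ 1) ∧
      ∀ x, L.starProjection x = ∑ i ∈ Finset.range r, inner 𝕜 (w i) x • w i := by
  set b := stdOrthonormalBasis 𝕜 L
  refine ⟨fun i => if hi : i < Module.finrank 𝕜 L then (b ⟨i, hi⟩ : F) else 0, fun i => ?_,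
    fun x => ?_⟩
  · dsimp only
    split_ifs with hi
    · exact (b.norm_eq_one ⟨i, hi⟩).le
    · simp
  · rw [b.starProjection_eq_sum_rankOne,
      ← Finset.sum_subset (Finset.range_subset_range.2 hr) fun i _ hi => by
        simp only [dif_neg (show ¬ i < _ by simpa using hi), smul_zero], Finset.sum_range]
    simp

theorem norm_sum_smul_sq_le {F : Type*} [NormedAddCommGroup F] [InnerProductSpace 𝕜 F]
    {ι : Type*} [Fintype ι] {w : ι → F} (hw : ∀ a, ‖w a‖ ≤ 1)
    (ho : Pairwise fun a b => inner 𝕜 (w a) (w b) = 0) (c : ι → 𝕜) :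
    ‖∑ a, c a • w a‖ ^ 2 ≤ ∑ a, ‖c a‖ ^ 2 := by
  classical
  have h : ‖∑ a, c a • w a‖ ^ 2 = ∑ a, ‖c a • w a‖ ^ 2 := by
    have h1 : inner 𝕜 (∑ a, c a • w a) (∑ a, c a • w a) =
        ∑ a, inner 𝕜 (c a • w a) (c a • w a) := by
      rw [sum_inner]
      refine Finset.sum_congr rfl fun a _ => ?_
      rw [inner_sum, Finset.sum_eq_single a]
      · intro b _ hb
        rw [inner_smul_left, inner_smul_right, ho hb.symm, mul_zero, mul_zero]
      · intro ha; exact absurd (Finset.mem_univ a) ha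
    simp only [inner_self_eq_norm_sq_to_K] at h1
    exact_mod_cast h1
  rw [h]
  refine Finset.sum_le_sum fun a _ => ?_
  rw [norm_smul, mul_pow]
  exact mul_le_of_le_one_right (sq_nonneg _) (pow_le_one₀ (norm_nonneg _) (hw a))

theorem sum_norm_inner_sq_le {F : Type*} [NormedAddCommGroup F] [InnerProductSpace 𝕜 F]
    {ι : Type*} [Fintype ι] {w : ι → F} (hw : ∀ a, ‖w a‖ ≤ 1)
    (ho : Pairwise fun a b => inner 𝕜 (w a) (w b) = 0) (z : F) :
    ∑ a, ‖inner 𝕜 (w a) z‖ ^ 2 ≤ ‖z‖ ^ 2 := by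
  set t := ∑ a, ‖inner 𝕜 (w a) z‖ ^ 2 with ht
  have ht0 : 0 ≤ t := Finset.sum_nonneg fun _ _ => sq_nonneg _
  set p := ∑ a, inner 𝕜 (w a) z • w a
  have hp : ‖p‖ ^ 2 ≤ t := norm_sum_smul_sq_le hw ho _
  have h1 : inner 𝕜 p z = (t : 𝕜) := by
    rw [sum_inner, ht]
    push_cast
    refine Finset.sum_congr rfl fun a _ => ?_
    rw [inner_smul_left, RCLike.conj_mul]
  have h2 : t ≤ ‖p‖ * ‖z‖ := by
    have := norm_inner_le_norm (𝕜 := 𝕜) p z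
    rwa [h1, RCLike.norm_ofReal, abs_of_nonneg ht0] at this
  nlinarith [sq_nonneg (‖p‖ - ‖z‖)]

/-- The first vector of a basis, or zero if there is none. -/
noncomputable def firstVector (b : ∀ n, OrthonormalBasis (Fin n) 𝕜 (E n)) (n : ℕ) : E n :=
  if hn : 0 < n then b n ⟨0, hn⟩ else 0

theorem norm_firstVector_succ (b : ∀ n, OrthonormalBasis (Fin n) 𝕜 (E n)) (n : ℕ) :
    ‖firstVector b (n + 1)‖ = 1 := by
  rw [firstVector, dif_pos n.succ_pos, OrthonormalBasis.norm_eq_one]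

theorem norm_firstVector_le (b : ∀ n, OrthonormalBasis (Fin n) 𝕜 (E n)) (n : ℕ) :
    ‖firstVector b n‖ ≤ 1 := by
  cases n with
  | zero => simp [firstVector]
  | succ n => exact (norm_firstVector_succ b n).le

theorem starProjection_firstVector (b : ∀ n, OrthonormalBasis (Fin n) 𝕜 (E n)) (n : ℕ)
    (y : E n) : (𝕜 ∙ firstVector b n).starProjection y =
      inner 𝕜 (firstVector b n) y • firstVector b n := by
  rw [Submodule.starProjection_singleton]
  cases n with
  | zero => simp [firstVector]
  | succ n => simp [norm_firstVector_succ]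

/-- The map which sends the basis vectors of `E n` to those of `E m` with the same index, as far
as they exist, and the other ones to zero. -/
noncomputable def basisTransfer (b : ∀ n, OrthonormalBasis (Fin n) 𝕜 (E n)) (n m : ℕ) :
    E n →L[𝕜] E m :=
  ∑ a : Fin n, (innerSL 𝕜 (b n a)).smulRight (if h : a < m then b m ⟨a, h⟩ else 0)

theorem basisTransfer_apply (b : ∀ n, OrthonormalBasis (Fin n) 𝕜 (E n)) (n m : ℕ) (y : E n) :
    basisTransfer b n m y =
      ∑ a : Fin n, inner 𝕜 (b n a) y • (if h : a < m then b m ⟨a, h⟩ else 0) := by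
  simp [basisTransfer, sum_apply]

theorem basisTransfer_basis (b : ∀ n, OrthonormalBasis (Fin n) 𝕜 (E n)) {n m : ℕ} (a : Fin n)
    (h : a < m) : basisTransfer b n m (b n a) = b m ⟨a, h⟩ := by
  rw [basisTransfer_apply, Finset.sum_eq_single a]
  · simp [h]
  · intro c _ hc
    rw [(b n).inner_eq_zero hc, zero_smul]
  · intro ha; exact absurd (Finset.mem_univ a) ha

theorem norm_basisTransfer_apply_le (b : ∀ n, OrthonormalBasis (Fin n) 𝕜 (E n)) (n m : ℕ)
    (y : E n) : ‖basisTransfer b n m y‖ ≤ ‖y‖ := by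
  rw [basisTransfer_apply]
  refine le_of_sq_le_sq ((norm_sum_smul_sq_le (fun a => ?_) (fun a c hac => ?_) _).trans_eq
    ((b n).sum_sq_norm_inner_right y)) (norm_nonneg _)
  · split_ifs
    · exact ((b m).norm_eq_one _).le
    · simp
  · dsimp only
    split_ifs
    · exact (b m).inner_eq_zero (by simpa [Fin.ext_iff] using hac)
    all_goals simp

theorem basisTransfer_basisTransfer (b : ∀ n, OrthonormalBasis (Fin n) 𝕜 (E n)) {n m : ℕ}
    (h : n ≤ m) (y : E n) : basisTransfer b m n (basisTransfer b n m y) = y := by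
  have : ((basisTransfer b m n).comp (basisTransfer b n m)).toLinearMap = LinearMap.id := by
    refine (b n).toBasis.ext fun a => ?_
    have h1 := basisTransfer_basis b a (a.2.trans_le h)
    have h2 := basisTransfer_basis b (m := n) ⟨a, a.2.trans_le h⟩ a.2
    simp [h1, h2]
  exact DFunLike.congr_fun this y

/-- If some rank one operator is not killed, the homomorphism is bounded below. -/
theorem exists_norm_le_of_rankOne_ne_zero {A : Type*} [NonUnitalNormedRing A] [NormedSpace 𝕜 A]
    {φ : (lp E 1 →L[𝕜] lp E 1) →ₙₐ[𝕜] A} {M : ℝ} (hM : 0 < M) (hφ : ∀ T, ‖φ T‖ ≤ M * ‖T‖)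
    {f : lp E 1 →L[𝕜] 𝕜} {x : lp E 1} (hfx : φ (f.smulRight x) ≠ 0) :
    ∃ C : ℝ, 0 < C ∧ ∀ T, ‖T‖ ≤ C * ‖φ T‖ := by
  have hN : 0 < ‖φ (f.smulRight x)‖ := norm_pos_iff.2 hfx
  have hfx0 : 0 < ‖f‖ * ‖x‖ := by
    have h := hφ (f.smulRight x)
    rw [ContinuousLinearMap.norm_smulRight_apply] at h
    exact pos_of_mul_pos_right (hN.trans_le h) hM.le
  set N := ‖φ (f.smulRight x)‖
  refine ⟨M ^ 2 * (‖f‖ * ‖x‖) / N, by positivity, fun T => ?_⟩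
  refine T.opNorm_le_bound (by positivity) fun z => ?_
  obtain ⟨g, hg, hgz⟩ := exists_dual_vector'' 𝕜 (T z)
  have h1 : g.smulRight x * T * f.smulRight z = (‖T z‖ : 𝕜) • f.smulRight x := by
    ext1 y
    change g (T (f y • z)) • x = (‖T z‖ : 𝕜) • f y • x
    rw [map_smul, map_smul, hgz, smul_smul, smul_eq_mul, mul_comm]
  have h2 : ‖T z‖ * N ≤ (M * ‖x‖) * ‖φ T‖ * (M * (‖f‖ * ‖z‖)) := by
    calc ‖T z‖ * N = ‖φ (g.smulRight x * T * f.smulRight z)‖ := by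
          rw [h1, map_smul, norm_smul, RCLike.norm_ofReal, abs_norm]
      _ ≤ ‖φ (g.smulRight x)‖ * ‖φ T‖ * ‖φ (f.smulRight z)‖ := by
          rw [map_mul, map_mul]
          exact (norm_mul_le _ _).trans
            (mul_le_mul_of_nonneg_right (norm_mul_le _ _) (norm_nonneg _))
      _ ≤ _ := by
          gcongr
          · refine (hφ _).trans (mul_le_mul_of_nonneg_left ?_ hM.le)
            rw [ContinuousLinearMap.norm_smulRight_apply]
            exact mul_le_of_le_one_left (norm_nonneg _) hg
          · refine (hφ _).trans_eq ?_
            rw [ContinuousLinearMap.norm_smulRight_apply]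
  rw [← le_div_iff₀ hN] at h2
  refine h2.trans_eq ?_
  ring

variable [∀ n, FiniteDimensional 𝕜 (E n)] [∀ n, CompleteSpace (E n)]

theorem exists_blockProj (L : ∀ n, Submodule 𝕜 (E n)) :
    ∃ T : lp E 1 →L[𝕜] lp E 1, ‖T‖ ≤ 1 ∧
      ∀ n x, T (lp.single 1 n x) = lp.single 1 n ((L n).starProjection x) := by
  obtain ⟨T, h1, h2, -⟩ := exists_clm_of_blocks
    (fun n => (lp.singleContinuousLinearMap 𝕜 E 1 n).comp (L n).starProjection) zero_le_one
    (fun n x => by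
      rw [ContinuousLinearMap.comp_apply, lp.singleContinuousLinearMap_apply,
        lp_one_norm_single]
      exact (L n).starProjection.le_of_opNorm_le (L n).starProjection_norm_le x)
  exact ⟨T, h1, h2⟩

/-- The diagonal operator whose `n`-th block is the orthogonal projection onto `L n`. -/
noncomputable def blockProj (L : ∀ n, Submodule 𝕜 (E n)) : lp E 1 →L[𝕜] lp E 1 :=
  (exists_blockProj L).choose

theorem norm_blockProj_le (L : ∀ n, Submodule 𝕜 (E n)) : ‖blockProj L‖ ≤ 1 :=
  (exists_blockProj L).choose_spec.1

theorem blockProj_single (L : ∀ n, Submodule 𝕜 (E n)) (n : ℕ) (x : E n) :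
    blockProj L (lp.single 1 n x) = lp.single 1 n ((L n).starProjection x) :=
  (exists_blockProj L).choose_spec.2 n x

theorem blockProj_apply (L : ∀ n, Submodule 𝕜 (E n)) (x : lp E 1) (n : ℕ) :
    blockProj L x n = (L n).starProjection (x n) := by
  have h : (lp.evalCLM 𝕜 E 1 n).comp (blockProj L) =
      (L n).starProjection.comp (lp.evalCLM 𝕜 E 1 n) := by
    refine ext_of_blocks fun k y => ?_
    simp only [ContinuousLinearMap.comp_apply, blockProj_single, eval_apply_eq]
    rcases eq_or_ne n k with rfl | hk
    · simp
    · rw [lp.single_apply_ne _ _ _ hk, lp.single_apply_ne _ _ _ hk, map_zero]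
  exact DFunLike.congr_fun h x

theorem norm_blockProj_apply_le (L : ∀ n, Submodule 𝕜 (E n)) (x : lp E 1) :
    ‖blockProj L x‖ ≤ ‖x‖ := by
  simpa using (blockProj L).le_of_opNorm_le (norm_blockProj_le L) x

variable (𝕜 E) in
/-- The projection onto the first `m` blocks. -/
noncomputable def trunc (m : ℕ) : lp E 1 →L[𝕜] lp E 1 :=
  blockProj fun n => if n < m then ⊤ else ⊥

theorem norm_trunc_apply_le (m : ℕ) (x : lp E 1) : ‖trunc 𝕜 E m x‖ ≤ ‖x‖ :=
  norm_blockProj_apply_le _ x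

theorem trunc_apply (m : ℕ) (x : lp E 1) (n : ℕ) :
    trunc 𝕜 E m x n = if n < m then x n else 0 := by
  rw [trunc, blockProj_apply]
  exact starProjection_ite_top_bot _ _

theorem trunc_single (m n : ℕ) (x : E n) :
    trunc 𝕜 E m (lp.single 1 n x) = if n < m then lp.single 1 n x else 0 := by
  rw [trunc, blockProj_single, starProjection_ite_top_bot]
  split_ifs
  · rfl
  · exact lp.single_zero _ _

theorem trunc_comp_trunc {k m : ℕ} (h : k ≤ m) (x : lp E 1) :
    trunc 𝕜 E k (trunc 𝕜 E m x) = trunc 𝕜 E k x := by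
  ext1; ext1 n
  simp only [trunc_apply]
  split_ifs <;> first | rfl | omega

theorem trunc_comp_trunc' {k m : ℕ} (h : k ≤ m) (x : lp E 1) :
    trunc 𝕜 E m (trunc 𝕜 E k x) = trunc 𝕜 E k x := by
  ext1; ext1 n
  simp only [trunc_apply]
  split_ifs <;> first | rfl | omega

theorem norm_sub_trunc_apply_le (m : ℕ) (x : lp E 1) : ‖x - trunc 𝕜 E m x‖ ≤ ‖x‖ := by
  have h : ‖ContinuousLinearMap.id 𝕜 (lp E 1) - trunc 𝕜 E m‖ ≤ 1 := by
    refine opNorm_le_of_blocks _ zero_le_one fun n y => ?_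
    rw [sub_apply, trunc_single, ContinuousLinearMap.id_apply]
    split_ifs
    · simp
    · simp
  simpa using ContinuousLinearMap.le_of_opNorm_le _ h x

theorem tendsto_trunc (x : lp E 1) : Tendsto (fun m => trunc 𝕜 E m x) atTop (𝓝 x) := by
  have h := (lp_one_hasSum_single x).tendsto_sum_nat
  refine h.congr fun m => ?_
  ext1; ext1 n
  rw [trunc_apply, lp.coeFn_sum, Finset.sum_apply]
  split_ifs with hn
  · rw [Finset.sum_eq_single n]
    · simp
    · intro k _ hk
      exact lp.single_apply_ne _ _ _ hk.symm
    · intro h; exact absurd (Finset.mem_range.2 hn) h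
  · refine Finset.sum_eq_zero fun k hk => lp.single_apply_ne _ _ _ ?_
    rintro rfl
    exact hn (Finset.mem_range.1 hk)

theorem exists_forall_norm_sub_trunc_le (x : lp E 1) {η : ℝ} (hη : 0 < η) :
    ∃ m₀, ∀ m ≥ m₀, ‖x - trunc 𝕜 E m x‖ ≤ η := by
  obtain ⟨m₀, h⟩ := Metric.tendsto_atTop.1 (tendsto_trunc (𝕜 := 𝕜) x) η hη
  refine ⟨m₀, fun m hm => ?_⟩
  rw [← dist_eq_norm, dist_comm]
  exact (h m hm).le

/-- On a finite-dimensional domain the tails of an operator tend to zero in norm. -/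
theorem exists_forall_norm_sub_trunc_comp_le {F : Type*} [NormedAddCommGroup F]
    [InnerProductSpace 𝕜 F] [FiniteDimensional 𝕜 F] (T : F →L[𝕜] lp E 1) {η : ℝ} (hη : 0 < η) :
    ∃ m₀, ∀ m ≥ m₀, ∀ y, ‖T y - trunc 𝕜 E m (T y)‖ ≤ η * ‖y‖ := by
  set b := stdOrthonormalBasis 𝕜 F
  set d := Module.finrank 𝕜 F
  have hd : 0 < η / (d + 1) := by positivity
  choose m₀ hm₀ using fun i => exists_forall_norm_sub_trunc_le (𝕜 := 𝕜) (T (b i)) hd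
  refine ⟨∑ i, m₀ i, fun m hm y => ?_⟩
  have hy : T y - trunc 𝕜 E m (T y) =
      ∑ i, inner 𝕜 (b i) y • (T (b i) - trunc 𝕜 E m (T (b i))) := by
    conv_lhs => rw [← b.sum_repr' y]
    simp only [map_sum, map_smul, smul_sub, Finset.sum_sub_distrib]
  rw [hy]
  calc _ ≤ ∑ i : Fin d, ‖y‖ * (η / (d + 1)) := by
        refine norm_sum_le_of_le _ fun i _ => ?_
        rw [norm_smul]
        refine mul_le_mul ?_ (hm₀ i m ?_) (norm_nonneg _) (norm_nonneg _)
        · simpa [b.norm_eq_one i] using norm_inner_le_norm (𝕜 := 𝕜) (b i) y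
        · exact (Finset.single_le_sum (fun _ _ => Nat.zero_le _) (Finset.mem_univ i)).trans hm
    _ = (d / (d + 1)) * (η * ‖y‖) := by
        rw [Finset.sum_const, Finset.card_univ, Fintype.card_fin, nsmul_eq_mul]; ring
    _ ≤ 1 * (η * ‖y‖) := by
        gcongr
        rw [div_le_one (by positivity)]; linarith
    _ = η * ‖y‖ := one_mul _

theorem exists_forall_norm_sub_trunc_comp_trunc_le (T : lp E 1 →L[𝕜] lp E 1) (s : ℕ) {η : ℝ}
    (hη : 0 < η) :
    ∃ m₀, ∀ m ≥ m₀, ∀ y, ‖T (trunc 𝕜 E s y) - trunc 𝕜 E m (T (trunc 𝕜 E s y))‖ ≤ η * ‖y‖ := by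
  choose m₀ hm₀ using fun n => exists_forall_norm_sub_trunc_comp_le (𝕜 := 𝕜)
    (T.comp (lp.singleContinuousLinearMap 𝕜 E 1 n)) hη
  refine ⟨∑ n ∈ Finset.range s, m₀ n, fun m hm y => ?_⟩
  have h : ‖(T - (trunc 𝕜 E m).comp T).comp (trunc 𝕜 E s)‖ ≤ η := by
    refine opNorm_le_of_blocks _ hη.le fun n x => ?_
    rw [ContinuousLinearMap.comp_apply, trunc_single]
    split_ifs with hn
    · exact hm₀ n m ((Finset.single_le_sum (fun _ _ => Nat.zero_le _)
        (Finset.mem_range.2 hn)).trans hm) x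
    · rw [map_zero, norm_zero]; positivity
  exact ContinuousLinearMap.le_of_opNorm_le _ h y

theorem exists_limit_of_blockwise_const {Y : Type*} [NormedAddCommGroup Y] [NormedSpace 𝕜 Y]
    [CompleteSpace Y] (A : ℕ → lp E 1 →L[𝕜] Y) {M : ℝ} (hM : 0 ≤ M) (hA : ∀ s, ‖A s‖ ≤ M)
    (hc : ∀ s n x, n < s → A s (lp.single 1 n x) = A (n + 1) (lp.single 1 n x)) :
    ∃ U : lp E 1 →L[𝕜] Y, ‖U‖ ≤ M ∧ ∀ x, Tendsto (fun s => A s x) atTop (𝓝 (U x)) := by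
  obtain ⟨U, hU, hUs, -⟩ := exists_clm_of_blocks
    (fun n => (A (n + 1)).comp (lp.singleContinuousLinearMap 𝕜 E 1 n)) hM
    (fun n x => by
      simpa [lp_one_norm_single] using (A (n + 1)).le_of_opNorm_le (hA _) (lp.single 1 n x))
  refine ⟨U, hU, fun x => ?_⟩
  have h1 : ∀ s, A s (trunc 𝕜 E s x) = U (trunc 𝕜 E s x) := by
    intro s
    have : (A s).comp (trunc 𝕜 E s) = U.comp (trunc 𝕜 E s) := by
      refine ext_of_blocks fun n y => ?_
      simp only [ContinuousLinearMap.comp_apply, trunc_single]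
      split_ifs with hn
      · rw [hUs, hc s n y hn]; rfl
      · simp
    exact DFunLike.congr_fun this x
  have h2 : ∀ s, ‖A s x - U x‖ ≤ (M + M) * ‖x - trunc 𝕜 E s x‖ := by
    intro s
    have : A s x - U x = A s (x - trunc 𝕜 E s x) - U (x - trunc 𝕜 E s x) := by
      rw [map_sub, map_sub, h1 s]; abel
    rw [this, add_mul]
    exact (norm_sub_le _ _).trans
      (add_le_add ((A s).le_of_opNorm_le (hA s) _) (U.le_of_opNorm_le hU _))
  rw [tendsto_iff_norm_sub_tendsto_zero]
  refine squeeze_zero (fun _ => norm_nonneg _) h2 ?_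
  have h3 : Tendsto (fun s => ‖x - trunc 𝕜 E s x‖) atTop (𝓝 0) := by
    simpa [norm_sub_rev] using tendsto_iff_norm_sub_tendsto_zero.1 (tendsto_trunc (𝕜 := 𝕜) x)
  simpa using h3.const_mul (M + M)

theorem norm_trunc_apply_eq (s : ℕ) (y : lp E 1) :
    ‖trunc 𝕜 E s y‖ = ∑ n ∈ Finset.range s, ‖y n‖ := by
  have h : HasSum (fun n => ‖trunc 𝕜 E s y n‖) (∑ n ∈ Finset.range s, ‖trunc 𝕜 E s y n‖) :=
    hasSum_sum_of_ne_finset_zero fun n hn => by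
      rw [trunc_apply, if_neg (by simpa using hn), norm_zero]
  refine ((lp_one_hasSum_norm _).unique h).trans (Finset.sum_congr rfl fun n hn => ?_)
  rw [trunc_apply, if_pos (Finset.mem_range.1 hn)]

/-- Among infinitely many vectors of the unit ball, two have images which almost agree on the first
blocks. -/
theorem exists_lt_norm_trunc_sub_le (S : lp E 1 →L[𝕜] lp E 1) (z : ℕ → lp E 1)
    (hz : ∀ l, ‖z l‖ ≤ 1) (s : ℕ) {η : ℝ} (hη : 0 < η) :
    ∃ l l', l < l' ∧ ‖trunc 𝕜 E s (S (z l' - z l))‖ ≤ η := by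
  let a : ℕ → ∀ k : Fin s, E k := fun l k => S (z l) k
  have ha : ∀ l, a l ∈ Metric.closedBall (0 : ∀ k : Fin s, E k) ‖S‖ := fun l => by
    rw [mem_closedBall_zero_iff, pi_norm_le_iff_of_nonneg (norm_nonneg _)]
    exact fun k => (lp.norm_apply_le_norm one_ne_zero _ _).trans
      ((S.le_opNorm _).trans (mul_le_of_le_one_right (norm_nonneg _) (hz l)))
  have : ProperSpace (∀ k : Fin s, E k) := FiniteDimensional.proper 𝕜 _
  obtain ⟨y, -, ψ, hψ, hy⟩ := tendsto_subseq_of_bounded Metric.isBounded_closedBall ha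
  obtain ⟨l, hl⟩ := Metric.cauchySeq_iff'.1 hy.cauchySeq (η / (s + 1)) (by positivity)
  refine ⟨ψ l, ψ (l + 1), hψ l.lt_succ_self, ?_⟩
  have h1 := (hl (l + 1) l.le_succ).le
  rw [norm_trunc_apply_eq, Finset.sum_range]
  have h2 : ∀ k : Fin s, ‖S (z (ψ (l + 1)) - z (ψ l)) k‖ ≤ η / (s + 1) := fun k => by
    rw [map_sub]
    refine le_trans ?_ ((dist_le_pi_dist _ _ k).trans h1)
    rw [dist_eq_norm]
    rfl
  refine (Finset.sum_le_sum fun k _ => h2 k).trans ?_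
  rw [Finset.sum_const, Finset.card_univ, Fintype.card_fin, nsmul_eq_mul, mul_div_assoc',
    div_le_iff₀ (by positivity)]
  nlinarith

/-- Given a projection `L s` on each block, this says that all of them factor approximately
through `T` with constant `C`, with the left factor avoiding any given finite set of blocks and
the right factor nearly killed by any given operator into finitely many blocks. -/
def UniformlyFactors (L : ∀ n, Submodule 𝕜 (E n)) (T : lp E 1 →L[𝕜] lp E 1) (C : ℝ) : Prop :=
  ∀ (s m : ℕ) (η : ℝ) (S : lp E 1 →L[𝕜] lp E 1), 0 < η →
    ∃ (V : E s →L[𝕜] lp E 1) (U : lp E 1 →L[𝕜] E s), ‖V‖ ≤ 1 ∧ ‖U‖ ≤ C ∧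
      (∀ x, U (trunc 𝕜 E m x) = 0) ∧
      (∀ y, ‖U (T (V y)) - (L s).starProjection y‖ ≤ η * ‖y‖) ∧
      ∀ y, ‖trunc 𝕜 E s (S (V y))‖ ≤ η * ‖y‖

/-- The partial factorizations built in the gliding hump argument: `A` lives on the first `m`
blocks, `A` has range in and `B` has domain the first `s` blocks. -/
structure PartialFactorization (L : ∀ n, Submodule 𝕜 (E n)) (T : lp E 1 →L[𝕜] lp E 1)
    (C τ : ℝ) (s : ℕ) (A B : lp E 1 →L[𝕜] lp E 1) (m : ℕ) : Prop where
  le : s ≤ m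
  left_trunc : ∀ x, A (trunc 𝕜 E m x) = A x
  trunc_left : ∀ x, trunc 𝕜 E s (A x) = A x
  right_trunc : ∀ x, B (trunc 𝕜 E s x) = B x
  norm_left : ‖A‖ ≤ C
  norm_right : ‖B‖ ≤ 1
  close : ∃ δ < τ, 0 ≤ δ ∧ ∀ x, ‖A (T (B x)) - blockProj L (trunc 𝕜 E s x)‖ ≤ δ * ‖x‖

theorem PartialFactorization.exists_succ {L : ∀ n, Submodule 𝕜 (E n)}
    {T : lp E 1 →L[𝕜] lp E 1} {C τ : ℝ} (hC : 0 ≤ C) (hT : UniformlyFactors L T C) {s : ℕ}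
    {A B : lp E 1 →L[𝕜] lp E 1} {m : ℕ} (h : PartialFactorization L T C τ s A B m) :
    ∃ A' B' m', PartialFactorization L T C τ (s + 1) A' B' m' ∧ m ≤ m' ∧
      (∀ x, A' (trunc 𝕜 E m x) = A x) ∧ ∀ x, B' (trunc 𝕜 E s x) = B x := by
  obtain ⟨δ, hδτ, hδ, hδx⟩ := h.close
  set η : ℝ := (τ - δ) / (2 * (C + 3)) with hη_def
  have hη : 0 < η := div_pos (by linarith) (by linarith)
  obtain ⟨m₁, hm₁⟩ := exists_forall_norm_sub_trunc_comp_trunc_le (T.comp B) s hη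
  set m₂ := max m m₁
  obtain ⟨V, U, hV, hU, hUm, hUTV, hSV⟩ := hT s m₂ η (A.comp T) hη
  have hC1 : 0 < η / (C + 1) := by positivity
  obtain ⟨m₃, hm₃⟩ := exists_forall_norm_sub_trunc_comp_le (𝕜 := 𝕜) (T.comp V) hC1
  set m' := max (max m₂ m₃) (s + 1)
  have hmm₂ : m ≤ m₂ := le_max_left _ _
  have hm₂m' : m₂ ≤ m' := (le_max_left _ _).trans (le_max_left _ _)
  have hm₃m' : m₃ ≤ m' := (le_max_right _ _).trans (le_max_left _ _)
  have hA0 : ∀ n (x : E n), m ≤ n → A (lp.single 1 n x) = 0 := by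
    intro n x hn
    rw [← h.left_trunc, trunc_single, if_neg (not_lt.2 hn), map_zero]
  have hB0 : ∀ n (x : E n), s ≤ n → B (lp.single 1 n x) = 0 := by
    intro n x hn
    rw [← h.right_trunc, trunc_single, if_neg (not_lt.2 hn), map_zero]
  have hU0 : ∀ n (x : E n), n < m₂ → U (lp.single 1 n x) = 0 := by
    intro n x hn
    rw [← hUm (lp.single 1 n x), trunc_single, if_pos hn]
  have hUle : ∀ x, ‖U x‖ ≤ C * ‖x‖ := fun x => U.le_of_opNorm_le hU x
  let ι : E s →L[𝕜] lp E 1 := lp.singleContinuousLinearMap 𝕜 E 1 s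
  let π : lp E 1 →L[𝕜] E s := lp.evalCLM 𝕜 E 1 s
  have hι : ∀ x, ι x = lp.single 1 s x := fun x => rfl
  have hπs : ∀ x, π (lp.single 1 s x) = x := fun x =>
    lp.single_apply_self (E := E) 1 s x
  have hπn : ∀ n (x : E n), n ≠ s → π (lp.single 1 n x) = 0 := fun n x hn =>
    lp.single_apply_ne (E := E) 1 n x hn.symm
  have hUB : ∀ x, ‖U (trunc 𝕜 E m' (T (B x)))‖ ≤ C * (η * ‖x‖) := by
    intro x
    have h1 : U (trunc 𝕜 E m' (T (B x))) =
        U (trunc 𝕜 E m' (T (B x) - trunc 𝕜 E m₂ (T (B x)))) := by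
      rw [map_sub, map_sub, trunc_comp_trunc' hm₂m', hUm, sub_zero]
    have h2 := hm₁ m₂ (le_max_right _ _) x
    simp only [ContinuousLinearMap.comp_apply, h.right_trunc] at h2
    rw [h1]
    exact (hUle _).trans (mul_le_mul_of_nonneg_left ((norm_trunc_apply_le _ _).trans h2) hC)
  have hAV : ∀ y, ‖A (T (V y))‖ ≤ η * ‖y‖ := by
    intro y
    have := hSV y
    rwa [ContinuousLinearMap.comp_apply, h.trunc_left] at this
  have hUV : ∀ y, ‖U (trunc 𝕜 E m' (T (V y))) - (L s).starProjection y‖ ≤ 2 * η * ‖y‖ := by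
    intro y
    have h1 : U (trunc 𝕜 E m' (T (V y))) - (L s).starProjection y =
        (U (T (V y)) - (L s).starProjection y) - U (T (V y) - trunc 𝕜 E m' (T (V y))) := by
      rw [map_sub]; abel
    have h2 : ‖U (T (V y) - trunc 𝕜 E m' (T (V y)))‖ ≤ η * ‖y‖ := by
      refine (hUle _).trans ?_
      calc C * ‖T (V y) - trunc 𝕜 E m' (T (V y))‖ ≤ (C + 1) * (η / (C + 1) * ‖y‖) :=
            mul_le_mul (by linarith) (hm₃ m' hm₃m' y) (norm_nonneg _) (by linarith)
        _ = η * ‖y‖ := by field_simp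
    rw [h1]
    refine (norm_sub_le _ _).trans ?_
    linarith [hUTV y]
  refine ⟨A + ι.comp (U.comp (trunc 𝕜 E m')), B + V.comp π, m',
    ⟨le_max_right _ _, ?_, ?_, ?_, ?_, ?_, ?_⟩, hmm₂.trans hm₂m', ?_, ?_⟩
  · intro x
    simp only [add_apply, ContinuousLinearMap.comp_apply, trunc_comp_trunc le_rfl]
    rw [← h.left_trunc, trunc_comp_trunc (hmm₂.trans hm₂m'), h.left_trunc]
  · intro x
    simp only [add_apply, ContinuousLinearMap.comp_apply, map_add, hι, trunc_single,
      if_pos (Nat.lt_succ_self s)]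
    rw [← h.trunc_left, trunc_comp_trunc' (Nat.le_succ s)]
  · intro x
    simp only [add_apply, ContinuousLinearMap.comp_apply]
    rw [← h.right_trunc, trunc_comp_trunc (Nat.le_succ s), h.right_trunc]
    congr 2
    exact (trunc_apply _ _ _).trans (if_pos (Nat.lt_succ_self s))
  · refine opNorm_le_of_blocks _ hC fun n x => ?_
    simp only [add_apply, ContinuousLinearMap.comp_apply, hι]
    rcases lt_or_ge n m₂ with hn | hn
    · rw [trunc_single, if_pos (hn.trans_le hm₂m'), hU0 n x hn, lp.single_zero, add_zero]
      simpa [lp_one_norm_single] using A.le_of_opNorm_le h.norm_left (lp.single 1 n x)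
    · rw [hA0 n x (hmm₂.trans hn), zero_add, lp_one_norm_single]
      refine (hUle _).trans (mul_le_mul_of_nonneg_left ?_ hC)
      exact (norm_trunc_apply_le _ _).trans_eq (lp_one_norm_single n x)
  · refine opNorm_le_of_blocks _ zero_le_one fun n x => ?_
    simp only [add_apply, ContinuousLinearMap.comp_apply]
    rcases eq_or_ne n s with rfl | hn
    · rw [hB0 n x le_rfl, zero_add, hπs]
      exact V.le_of_opNorm_le hV x
    · rw [hπn n x hn, map_zero, add_zero]
      simpa [lp_one_norm_single] using B.le_of_opNorm_le h.norm_right (lp.single 1 n x)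
  · refine ⟨δ + (C + 3) * η, ?_, by positivity, fun x => ?_⟩
    · have : (C + 3) * η = (τ - δ) / 2 := by rw [hη_def]; field_simp
      linarith
    have hx : trunc 𝕜 E (s + 1) x = trunc 𝕜 E s x + ι (π x) := by
      ext1; ext1 n
      simp only [lp.coeFn_add, Pi.add_apply, trunc_apply, hι]
      rcases lt_trichotomy n s with hn | rfl | hn
      · rw [if_pos (by omega), if_pos hn, lp.single_apply_ne _ _ _ hn.ne, add_zero]
      · rw [if_pos (by omega), if_neg (lt_irrefl _), lp.single_apply_self, zero_add]
        rfl
      · rw [if_neg (by omega), if_neg (by omega), lp.single_apply_ne _ _ _ hn.ne', add_zero]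
    have hπx : ‖π x‖ ≤ ‖x‖ := lp.norm_apply_le_norm (by simp) x s
    have hπx' : η * ‖π x‖ ≤ η * ‖x‖ := mul_le_mul_of_nonneg_left hπx hη.le
    have key : (A + ι.comp (U.comp (trunc 𝕜 E m'))) (T ((B + V.comp π) x)) -
        blockProj L (trunc 𝕜 E (s + 1) x) =
        (A (T (B x)) - blockProj L (trunc 𝕜 E s x)) + ι (U (trunc 𝕜 E m' (T (B x)))) +
        A (T (V (π x))) +
        ι (U (trunc 𝕜 E m' (T (V (π x)))) - (L s).starProjection (π x)) := by
      rw [hx]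
      simp only [add_apply, ContinuousLinearMap.comp_apply, map_add, map_sub]
      have : blockProj L (ι (π x)) = ι ((L s).starProjection (π x)) := blockProj_single L s _
      rw [this]; abel
    rw [key]
    have e1 := hδx x
    have e2 : ‖ι (U (trunc 𝕜 E m' (T (B x))))‖ ≤ C * (η * ‖x‖) :=
      (lp_one_norm_single s _).trans_le (hUB x)
    have e3 := hAV (π x)
    have e4 : ‖ι (U (trunc 𝕜 E m' (T (V (π x)))) - (L s).starProjection (π x))‖ ≤
        2 * η * ‖π x‖ := (lp_one_norm_single s _).trans_le (hUV (π x))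
    refine (norm_add_le _ _).trans ((add_le_add_left (norm_add₃_le) _).trans ?_)
    nlinarith
  · intro x
    simp only [add_apply, ContinuousLinearMap.comp_apply]
    rw [h.left_trunc, trunc_comp_trunc' (hmm₂.trans hm₂m'), ← trunc_comp_trunc' hmm₂, hUm,
      map_zero, add_zero]
  · intro x
    simp only [add_apply, ContinuousLinearMap.comp_apply]
    have : π (trunc 𝕜 E s x) = 0 := (trunc_apply _ _ _).trans (if_neg (lt_irrefl _))
    rw [h.right_trunc, this, map_zero, add_zero]

theorem UniformlyFactors.exists_factorization {L : ∀ n, Submodule 𝕜 (E n)}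
    {T : lp E 1 →L[𝕜] lp E 1} {C : ℝ} (hC : 0 ≤ C) (hT : UniformlyFactors L T C) {τ : ℝ}
    (hτ : 0 < τ) :
    ∃ U V : lp E 1 →L[𝕜] lp E 1, ‖U‖ ≤ C ∧ ‖V‖ ≤ 1 ∧ ‖U * T * V - blockProj L‖ ≤ τ := by
  have h0 : PartialFactorization L T C τ 0 0 0 0 := by
    have ht : ∀ x, trunc 𝕜 E 0 x = 0 := fun x => by
      ext1; ext1 n
      exact (trunc_apply _ _ _).trans (if_neg (Nat.not_lt_zero n))
    exact ⟨le_rfl, by simp, by simp, by simp, by simpa using hC, by simp,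
      0, hτ, le_rfl, by simp [ht]⟩
  let Stage (s : ℕ) := {p : (lp E 1 →L[𝕜] lp E 1) × (lp E 1 →L[𝕜] lp E 1) × ℕ //
    PartialFactorization L T C τ s p.1 p.2.1 p.2.2}
  have hstep : ∀ s (p : Stage s), ∃ q : Stage (s + 1), p.1.2.2 ≤ q.1.2.2 ∧
      (∀ x, q.1.1 (trunc 𝕜 E p.1.2.2 x) = p.1.1 x) ∧
      ∀ x, q.1.2.1 (trunc 𝕜 E s x) = p.1.2.1 x := by
    rintro s ⟨⟨A, B, m⟩, h⟩
    obtain ⟨A', B', m', h', h1, h2, h3⟩ := h.exists_succ hC hT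
    exact ⟨⟨⟨A', B', m'⟩, h'⟩, h1, h2, h3⟩
  choose next hm hA hB using hstep
  let p : ∀ s, Stage s := fun s => Nat.rec ⟨⟨0, 0, 0⟩, h0⟩ next s
  let A := fun s => (p s).1.1
  let B := fun s => (p s).1.2.1
  let m := fun s => (p s).1.2.2
  have hp : ∀ s, PartialFactorization L T C τ s (A s) (B s) (m s) := fun s => (p s).2
  have hA' : ∀ s x, A (s + 1) (trunc 𝕜 E (m s) x) = A s x := fun s => hA s (p s)
  have hB' : ∀ s x, B (s + 1) (trunc 𝕜 E s x) = B s x := fun s => hB s (p s)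
  obtain ⟨U, hU, hUx⟩ := exists_limit_of_blockwise_const A hC (fun s => (hp s).norm_left) (by
    intro s n x hn
    induction s, Nat.succ_le_of_lt hn using Nat.le_induction with
    | base => rfl
    | succ s hs ih =>
      rw [← ih hs, ← hA' s, trunc_single, if_pos (lt_of_lt_of_le hs (hp s).le)])
  obtain ⟨V, hV, hVx⟩ := exists_limit_of_blockwise_const B zero_le_one
    (fun s => (hp s).norm_right) (by
    intro s n x hn
    induction s, Nat.succ_le_of_lt hn using Nat.le_induction with
    | base => rfl
    | succ s hs ih =>
      rw [← ih hs, ← hB' s, trunc_single, if_pos (show n < s from hs)])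
  refine ⟨U, V, hU, hV, ContinuousLinearMap.opNorm_le_bound _ hτ.le fun x => ?_⟩
  have h1 : Tendsto (fun s => A s (T (B s x))) atTop (𝓝 (U (T (V x)))) := by
    have h2 : Tendsto (fun s => A s (T (B s x) - T (V x))) atTop (𝓝 0) := by
      have h3 : Tendsto (fun s => C * ‖T (B s x) - T (V x)‖) atTop (𝓝 0) := by
        have := tendsto_iff_norm_sub_tendsto_zero.1 ((T.continuous.tendsto _).comp (hVx x))
        simpa using this.const_mul C
      exact squeeze_zero_norm (fun s => (A s).le_of_opNorm_le (hp s).norm_left _) h3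
    simpa using h2.add (hUx (T (V x)))
  have h2 : Tendsto (fun s => blockProj L (trunc 𝕜 E s x)) atTop (𝓝 (blockProj L x)) :=
    ((blockProj L).continuous.tendsto _).comp (tendsto_trunc x)
  refine le_of_tendsto (h1.sub h2).norm (Eventually.of_forall fun s => ?_)
  obtain ⟨δ, hδτ, hδ, hδx⟩ := (hp s).close
  exact (hδx x).trans (mul_le_mul_of_nonneg_right hδτ.le (norm_nonneg _))

/-- The projection of the sum onto the copy of `ℓ₁` spanned by the first vectors. -/
noncomputable def firstProj (b : ∀ n, OrthonormalBasis (Fin n) 𝕜 (E n)) :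
    lp E 1 →L[𝕜] lp E 1 :=
  blockProj fun n => 𝕜 ∙ firstVector b n

section Kernel

variable {A : Type*} [NonUnitalNormedRing A] [NormedSpace 𝕜 A]
  (φ : (lp E 1 →L[𝕜] lp E 1) →ₙₐ[𝕜] A)

/-- An operator whose matrix entries have uniformly bounded rank factors through `ℓ₁`, so it is
killed by every homomorphism which kills the projection onto `ℓ₁`. -/
theorem map_eq_zero_of_finrank_le (b : ∀ n, OrthonormalBasis (Fin n) 𝕜 (E n))
    (hφ : φ (firstProj b) = 0) (S R : lp E 1 →L[𝕜] lp E 1) (L : ℕ → ∀ j, Submodule 𝕜 (E j))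
    {r : ℕ} (hr : ∀ n j, Module.finrank 𝕜 (L n j) ≤ r)
    (hR : ∀ n x, R (lp.single 1 n x) = blockProj (L n) (S (lp.single 1 n x))) : φ R = 0 := by
  choose w hw hwL using fun n j => exists_sum_inner_smul_eq_starProjection (L n j) (hr n j)
  have hD : ∀ i n, ∃ D : lp E 1 →L[𝕜] lp E 1, ‖D‖ ≤ 1 ∧ ∀ j z, D (lp.single 1 j z) =
      inner 𝕜 (w n j i) z • lp.single 1 (Nat.pair n j + 1) (firstVector b (Nat.pair n j + 1)) := by
    intro i n
    obtain ⟨D, h1, h2, -⟩ := exists_clm_of_blocks (fun j => (innerSL 𝕜 (w n j i)).smulRight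
      (lp.single (E := E) 1 (Nat.pair n j + 1) (firstVector b (Nat.pair n j + 1)))) zero_le_one
      (fun j z => by
        rw [ContinuousLinearMap.smulRight_apply, norm_smul, lp_one_norm_single,
          norm_firstVector_succ, mul_one, innerSL_apply_apply]
        exact (norm_inner_le_norm _ _).trans
          (mul_le_mul_of_nonneg_right (hw n j i) (norm_nonneg _)))
    exact ⟨D, h1, fun j z => by rw [h2]; rfl⟩
  choose D hD1 hD using hD
  have hP : ∀ i n z, firstProj b (D i n z) = D i n z := by
    intro i n z
    have : (firstProj b).comp (D i n) = D i n := by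
      refine ext_of_blocks fun j y => ?_
      rw [ContinuousLinearMap.comp_apply, hD, map_smul, firstProj, blockProj_single,
        starProjection_firstVector, inner_self_eq_norm_sq_to_K, norm_firstVector_succ]
      simp
    exact DFunLike.congr_fun this z
  have hA : ∀ i, ∃ C : lp E 1 →L[𝕜] lp E 1, ∀ n x,
      C (lp.single 1 n x) = D i n (S (lp.single 1 n x)) := by
    intro i
    obtain ⟨C, -, h2, -⟩ := exists_clm_of_blocks
      (fun n => ((D i n).comp S).comp (lp.singleContinuousLinearMap 𝕜 E 1 n)) (norm_nonneg S)
      (fun n x => by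
        have h3 := (D i n).le_of_opNorm_le (hD1 i n) (S (lp.single 1 n x))
        have h4 := S.le_opNorm (lp.single 1 n x)
        rw [lp_one_norm_single] at h4
        exact h3.trans (by simpa using h4))
    exact ⟨C, h2⟩
  choose C hC using hA
  have hB : ∀ i, ∃ G : lp E 1 →L[𝕜] lp E 1, ∀ n j,
      G (lp.single 1 (Nat.pair n j + 1) (firstVector b (Nat.pair n j + 1))) =
        lp.single 1 j (w n j i) := by
    intro i
    obtain ⟨G, -, h2, -⟩ := exists_clm_of_blocks (fun k => (innerSL 𝕜 (firstVector b k)).smulRight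
      (lp.single (E := E) 1 (Nat.unpair (k - 1)).2
        (w (Nat.unpair (k - 1)).1 (Nat.unpair (k - 1)).2 i))) zero_le_one
      (fun k z => by
        rw [ContinuousLinearMap.smulRight_apply, norm_smul, lp_one_norm_single,
          innerSL_apply_apply, one_mul]
        refine (mul_le_of_le_one_right (norm_nonneg _) (hw _ _ _)).trans ?_
        exact (norm_inner_le_norm _ _).trans
          (mul_le_of_le_one_left (norm_nonneg _) (norm_firstVector_le b k)))
    refine ⟨G, fun n j => ?_⟩
    rw [h2, ContinuousLinearMap.smulRight_apply, innerSL_apply_apply,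
      inner_self_eq_norm_sq_to_K, norm_firstVector_succ, Nat.add_sub_cancel, Nat.unpair_pair]
    simp
  choose G hG using hB
  have hGD : ∀ n, ∑ i ∈ Finset.range r, (G i).comp (D i n) = blockProj (L n) := by
    intro n
    refine ext_of_blocks fun j z => ?_
    rw [sum_apply, blockProj_single, hwL]
    simp only [ContinuousLinearMap.comp_apply, hD, map_smul, hG]
    have h := map_sum (lp.singleContinuousLinearMap 𝕜 E 1 j)
      (fun i => inner 𝕜 (w n j i) z • w n j i) (Finset.range r)
    simp only [map_smul, lp.singleContinuousLinearMap_apply] at h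
    exact h.symm
  have hRsum : R = ∑ i ∈ Finset.range r, G i * firstProj b * C i := by
    refine ext_of_blocks fun n x => ?_
    rw [hR, ← hGD, sum_apply, sum_apply]
    refine Finset.sum_congr rfl fun i _ => ?_
    change G i (D i n _) = G i (firstProj b (C i _))
    rw [hC, hP]
  rw [hRsum, map_sum]
  exact Finset.sum_eq_zero fun i _ => by rw [map_mul, map_mul, hφ, mul_zero, zero_mul]

theorem map_blockProj_eq_zero (b : ∀ n, OrthonormalBasis (Fin n) 𝕜 (E n))
    (hφ : φ (firstProj b) = 0) (L : ∀ n, Submodule 𝕜 (E n)) {r : ℕ}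
    (hr : ∀ n, Module.finrank 𝕜 (L n) ≤ r) : φ (blockProj L) = 0 :=
  map_eq_zero_of_finrank_le φ b hφ 1 _ (fun _ => L) (fun _ => hr) fun _ _ => rfl

theorem map_trunc_eq_zero (b : ∀ n, OrthonormalBasis (Fin n) 𝕜 (E n))
    (hφ : φ (firstProj b) = 0) (m : ℕ) : φ (trunc 𝕜 E m) = 0 := by
  refine map_blockProj_eq_zero φ b hφ _ (r := m) fun n => ?_
  by_cases hn : n < m
  · rw [if_pos hn, finrank_top, Module.finrank_eq_card_basis (b n).toBasis, Fintype.card_fin]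
    exact hn.le
  · rw [if_neg hn, finrank_bot]; exact m.zero_le

theorem map_trunc_eq_zero_of_rankOne (b : ∀ n, OrthonormalBasis (Fin n) 𝕜 (E n))
    (hφ : ∀ (f : lp E 1 →L[𝕜] 𝕜) (x : lp E 1), φ (f.smulRight x) = 0) (m : ℕ) :
    φ (trunc 𝕜 E m) = 0 := by
  have h : trunc 𝕜 E m = ∑ n ∈ Finset.range m, ∑ i : Fin n,
      ((innerSL 𝕜 (b n i)).comp (lp.evalCLM 𝕜 E 1 n)).smulRight (lp.single 1 n (b n i)) := by
    refine ext_of_blocks fun k y => ?_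
    rw [trunc_single, sum_apply]
    simp only [sum_apply, ContinuousLinearMap.smulRight_apply,
      ContinuousLinearMap.comp_apply, eval_apply_eq, innerSL_apply_apply]
    have hne : ∀ n, n ≠ k → ∑ i : Fin n, inner 𝕜 (b n i) ((lp.single 1 k y : lp E 1) n) •
        lp.single (E := E) 1 n (b n i) = 0 := fun n hn => by
      rw [lp.single_apply_ne _ _ _ hn]; simp
    split_ifs with hk
    · rw [Finset.sum_eq_single k (fun n _ hn => hne n hn)
        (fun h => absurd (Finset.mem_range.2 hk) h), lp.single_apply_self]
      have h := map_sum (lp.singleContinuousLinearMap 𝕜 E 1 k)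
        (fun i => inner 𝕜 (b k i) y • b k i) Finset.univ
      rw [(b k).sum_repr' y] at h
      simp only [map_smul, lp.singleContinuousLinearMap_apply] at h
      exact h
    · refine (Finset.sum_eq_zero fun n hn => hne n ?_).symm
      rintro rfl
      exact hk (Finset.mem_range.1 hn)
  rw [h, map_sum]
  refine Finset.sum_eq_zero fun n _ => ?_
  rw [map_sum]
  exact Finset.sum_eq_zero fun i _ => hφ _ _

end Kernel

/-- The greedy construction: if the matrix entries of `T` cannot be approximated by entries of
bounded rank, then the identity of `ℓ₂ˢ` factors through `T`. -/
theorem exists_orthogonal_system {F W : Type*} [NormedAddCommGroup F] [InnerProductSpace 𝕜 F]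
    [FiniteDimensional 𝕜 F] [AddCommGroup W] [Module 𝕜 W] [FiniteDimensional 𝕜 W]
    (T : F →L[𝕜] lp E 1) (G : F →ₗ[𝕜] W) {ε : ℝ} (hε : 0 < ε) {r : ℕ}
    (hT : ∀ (N : Submodule 𝕜 F) (L : ∀ j, Submodule 𝕜 (E j)), Module.finrank 𝕜 Nᗮ ≤ r →
      (∀ j, Module.finrank 𝕜 (L j) ≤ r) → ∃ y ∈ N, ε * ‖y‖ < ‖T y - blockProj L (T y)‖)
    (s : ℕ) (hs : Module.finrank 𝕜 W + 2 * s ≤ r) :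
    ∃ (x : Fin s → F) (u : Fin s → ∀ j, E j) (f : Fin s → lp E 1 →L[𝕜] 𝕜),
      (∀ a, ‖x a‖ ≤ 1) ∧ (∀ a b, a ≠ b → inner 𝕜 (x a) (x b) = 0) ∧ (∀ a, G (x a) = 0) ∧
      (∀ a j, ‖u a j‖ ≤ 1) ∧ (∀ a b, a ≠ b → ∀ j, inner 𝕜 (u a j) (u b j) = 0) ∧
      (∀ a j z, f a (lp.single 1 j z) = inner 𝕜 (u a j) z) ∧
      ∀ a b, f b (T (x a)) = if a = b then (ε : 𝕜) else 0 := by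
  induction s with
  | zero =>
    exact ⟨Fin.elim0, Fin.elim0, Fin.elim0, fun a => a.elim0, fun a => a.elim0,
      fun a => a.elim0, fun a => a.elim0, fun a => a.elim0, fun a => a.elim0, fun a => a.elim0⟩
  | succ s ih =>
    obtain ⟨x, u, f, hx, hxo, hxG, hu, huo, hf, hfT⟩ := ih (by omega)
    let Φ : F →ₗ[𝕜] W × (Fin s → 𝕜) × (Fin s → 𝕜) :=
      G.prod ((LinearMap.pi fun a => (innerSL 𝕜 (x a)).toLinearMap).prod
        (LinearMap.pi fun a => ((f a).comp T).toLinearMap))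
    let L : ∀ j, Submodule 𝕜 (E j) := fun j =>
      Submodule.span 𝕜 (Set.range (Sum.elim (fun a => u a j) fun a => T (x a) j))
    have hN : Module.finrank 𝕜 (LinearMap.ker Φ)ᗮ ≤ r := by
      have h1 := Submodule.finrank_add_finrank_orthogonal (LinearMap.ker Φ)
      have h2 := Φ.finrank_range_add_finrank_ker
      have h3 := Submodule.finrank_le (LinearMap.range Φ)
      simp only [Module.finrank_prod, Module.finrank_fin_fun] at h3
      omega
    have hL : ∀ j, Module.finrank 𝕜 (L j) ≤ r := fun j => by
      have := finrank_range_le_card (R := 𝕜) (Sum.elim (fun a => u a j) fun a => T (x a) j)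
      rw [Set.finrank, Fintype.card_sum, Fintype.card_fin] at this
      exact this.trans (by omega)
    obtain ⟨y, hy, hyT⟩ := hT _ L hN hL
    have hyΦ : Φ y = 0 := hy
    have hyG : G y = 0 := congrArg Prod.fst hyΦ
    have hyx : ∀ a, inner 𝕜 (x a) y = 0 := fun a =>
      congrFun (congrArg (fun p => p.2.1) hyΦ) a
    have hyf : ∀ a, f a (T y) = 0 := fun a => congrFun (congrArg (fun p => p.2.2) hyΦ) a
    set v := T y - blockProj L (T y)
    have hv : ∀ j, v j ∈ (L j)ᗮ := fun j => by
      have : v j = T y j - (L j).starProjection (T y j) := by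
        rw [← blockProj_apply]; rfl
      rw [this]
      exact Submodule.sub_starProjection_mem_orthogonal _
    have hvu : ∀ j a, inner 𝕜 (v j) (u a j) = 0 := fun j a =>
      Submodule.inner_left_of_mem_orthogonal (Submodule.subset_span
        (Set.mem_range_self (f := Sum.elim (fun a => u a j) fun a => T (x a) j) (Sum.inl a))) (hv j)
    have hvT : ∀ j a, inner 𝕜 (v j) (T (x a) j) = 0 := fun j a =>
      Submodule.inner_left_of_mem_orthogonal (Submodule.subset_span
        (Set.mem_range_self (f := Sum.elim (fun a => u a j) fun a => T (x a) j) (Sum.inr a))) (hv j)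
    have hvy : ∀ j, inner 𝕜 (v j) (T y j) = (‖v j‖ : 𝕜) ^ 2 := fun j => by
      have h1 : T y j = v j + (L j).starProjection (T y j) := by
        rw [← blockProj_apply]
        exact (sub_add_cancel (T y j) (blockProj L (T y) j)).symm
      rw [h1, inner_add_right, inner_self_eq_norm_sq_to_K,
        Submodule.inner_left_of_mem_orthogonal (Submodule.starProjection_apply_mem _ _) (hv j),
        add_zero]
    have hd : 0 < ‖v‖ := lt_of_le_of_lt (by positivity) hyT
    let u' : ∀ j, E j := fun j => ((‖v j‖ : 𝕜)⁻¹) • v j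
    have hu' : ∀ j, ‖u' j‖ ≤ 1 := fun j => by
      rw [norm_smul, norm_inv, RCLike.norm_ofReal, abs_norm]
      exact inv_mul_le_one
    have hu'inner : ∀ j z, inner 𝕜 (u' j) z = (‖v j‖ : 𝕜)⁻¹ * inner 𝕜 (v j) z := fun j z => by
      rw [inner_smul_left, map_inv₀, RCLike.conj_ofReal]
    obtain ⟨f', -, hf's, hf'⟩ := exists_clm_of_blocks (fun j => innerSL 𝕜 (u' j)) zero_le_one
      fun j z => by
        rw [innerSL_apply_apply]
        exact (norm_inner_le_norm _ _).trans
          (mul_le_mul_of_nonneg_right (hu' j) (norm_nonneg _))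
    have hf'x : ∀ a, f' (T (x a)) = 0 := fun a => by
      refine (hf' (T (x a))).unique ?_
      simp only [innerSL_apply_apply, hu'inner, hvT, mul_zero]
      exact hasSum_zero
    have hf'y : f' (T y) = (‖v‖ : 𝕜) := by
      refine (hf' (T y)).unique ?_
      have h1 : HasSum (fun j => (‖v j‖ : 𝕜)) (‖v‖ : 𝕜) :=
        (lp_one_hasSum_norm v).mapL RCLike.ofRealCLM
      refine (congrArg (HasSum · _) (funext fun j => ?_)).mpr h1
      rw [innerSL_apply_apply, hu'inner, hvy]
      rcases eq_or_ne ((‖v j‖ : 𝕜)) 0 with h0 | h0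
      · rw [h0]; simp
      · field_simp
    have hd' : (‖v‖ : 𝕜) ≠ 0 := by exact_mod_cast hd.ne'
    let x' : F := ((ε / ‖v‖ : ℝ) : 𝕜) • y
    have hx' : ‖x'‖ ≤ 1 := by
      rw [norm_smul, RCLike.norm_ofReal, abs_of_pos (div_pos hε hd), div_mul_eq_mul_div,
        div_le_one hd]
      exact hyT.le
    refine ⟨Fin.snoc (α := fun _ => F) x x', Fin.snoc (α := fun _ => ∀ j, E j) u u',
      Fin.snoc (α := fun _ => lp E 1 →L[𝕜] 𝕜) f f', ?_⟩
    simp only [Fin.forall_fin_succ', Fin.snoc_castSucc, Fin.snoc_last, ne_eq,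
      Fin.castSucc_inj, Fin.castSucc_ne_last, (Fin.castSucc_ne_last _).symm, not_true_eq_false,
      not_false_eq_true, if_true, if_false, false_imp_iff, true_imp_iff, and_true]
    refine ⟨⟨hx, hx'⟩, ⟨fun a => ⟨hxo a, ?_⟩, fun a => ?_⟩, ⟨hxG, ?_⟩, ⟨hu, hu'⟩,
      ⟨fun a => ⟨huo a, fun j => ?_⟩, fun a j => ?_⟩, ⟨hf, hf's⟩, ⟨fun a => ⟨hfT a, hf'x a⟩,
      fun a => ?_, ?_⟩⟩
    · rw [inner_smul_right, hyx, mul_zero]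
    · rw [inner_smul_left, inner_eq_zero_symm.1 (hyx a), mul_zero]
    · rw [map_smul, hyG, smul_zero]
    · rw [inner_eq_zero_symm, hu'inner, hvu, mul_zero]
    · rw [hu'inner, hvu, mul_zero]
    · rw [map_smul, map_smul, hyf, smul_zero]
    · rw [map_smul, map_smul, hf'y, smul_eq_mul]
      push_cast
      field_simp

/-- Homomorphisms from the operators on the sum are bounded: the sum contains infinitely many
copies of itself, on which infinitely many operators can be realised simultaneously. -/
theorem exists_bound_of_algHom {A : Type*} [NonUnitalNormedRing A] [NormedSpace 𝕜 A]
    (b : ∀ n, OrthonormalBasis (Fin n) 𝕜 (E n)) (φ : (lp E 1 →L[𝕜] lp E 1) →ₙₐ[𝕜] A) :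
    ∃ M : ℝ, 0 < M ∧ ∀ T, ‖φ T‖ ≤ M * ‖T‖ := by
  have hJ : ∀ i, ∃ J : lp E 1 →L[𝕜] lp E 1, ‖J‖ ≤ 1 ∧ ∀ n x, J (lp.single 1 n x) =
      lp.single 1 (Nat.pair i n) (basisTransfer b n (Nat.pair i n) x) := by
    intro i
    obtain ⟨J, h1, h2, -⟩ := exists_clm_of_blocks (fun n =>
      (lp.singleContinuousLinearMap 𝕜 E 1 (Nat.pair i n)).comp
        (basisTransfer b n (Nat.pair i n))) zero_le_one fun n x => by
          rw [one_mul]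
          exact (lp_one_norm_single _ _).trans_le (norm_basisTransfer_apply_le b _ _ x)
    exact ⟨J, h1, h2⟩
  choose J hJ1 hJ using hJ
  have hR : ∀ i, ∃ R : lp E 1 →L[𝕜] lp E 1, ∀ k x, R (lp.single 1 k x) =
      if (Nat.unpair k).1 = i then
        lp.single 1 (Nat.unpair k).2 (basisTransfer b k (Nat.unpair k).2 x) else 0 := by
    intro i
    obtain ⟨R, -, h2, -⟩ := exists_clm_of_blocks (fun k => if (Nat.unpair k).1 = i then
      (lp.singleContinuousLinearMap 𝕜 E 1 (Nat.unpair k).2).comp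
        (basisTransfer b k (Nat.unpair k).2) else 0) zero_le_one fun k x => by
          rw [one_mul]
          split_ifs
          · exact (lp_one_norm_single _ _).trans_le (norm_basisTransfer_apply_le b _ _ x)
          · simp
    refine ⟨R, fun k x => ?_⟩
    rw [h2]
    split_ifs <;> rfl
  choose R hR using hR
  have hRJ : ∀ i x, R i (J i x) = x := by
    intro i x
    have : (R i).comp (J i) = ContinuousLinearMap.id 𝕜 _ := by
      refine ext_of_blocks fun n y => ?_
      rw [ContinuousLinearMap.comp_apply, hJ, hR, if_pos (by rw [Nat.unpair_pair]), Nat.unpair_pair,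
        basisTransfer_basisTransfer b (Nat.right_le_pair i n), ContinuousLinearMap.id_apply]
    exact DFunLike.congr_fun this x
  have hRJ' : ∀ i i', i' ≠ i → ∀ x, R i (J i' x) = 0 := by
    intro i i' h x
    have : (R i).comp (J i') = 0 := by
      refine ext_of_blocks fun n y => ?_
      rw [ContinuousLinearMap.comp_apply, hJ, hR, if_neg (by rwa [Nat.unpair_pair]), zero_apply]
    exact DFunLike.congr_fun this x
  by_contra! hcon
  have hT : ∀ i : ℕ, ∃ T : lp E 1 →L[𝕜] lp E 1, ‖T‖ ≤ 1 ∧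
      i * (‖φ (R i)‖ * ‖φ (J i)‖) < ‖φ T‖ := by
    intro i
    obtain ⟨T, hT⟩ := hcon (i * (‖φ (R i)‖ * ‖φ (J i)‖) + 1) (by positivity)
    have hT0 : 0 < ‖T‖ := by
      rcases (norm_nonneg T).lt_or_eq with h | h
      · exact h
      · have : T = 0 := norm_eq_zero.1 h.symm
        simp [this] at hT
    refine ⟨((‖T‖⁻¹ : ℝ) : 𝕜) • T, ?_, ?_⟩
    · rw [norm_smul, RCLike.norm_ofReal, abs_of_pos (inv_pos.2 hT0), inv_mul_cancel₀ hT0.ne']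
    · rw [map_smul, norm_smul, RCLike.norm_ofReal, abs_of_pos (inv_pos.2 hT0),
        ← div_eq_inv_mul, lt_div_iff₀ hT0]
      nlinarith
  choose T hT1 hT using hT
  obtain ⟨S, -, hS, -⟩ := exists_clm_of_blocks (fun k => ((J (Nat.unpair k).1).comp
    (T (Nat.unpair k).1)).comp ((lp.singleContinuousLinearMap 𝕜 E 1 (Nat.unpair k).2).comp
      (basisTransfer b k (Nat.unpair k).2))) zero_le_one fun k x => by
        refine ((J _).le_of_opNorm_le (hJ1 _) _).trans (mul_le_mul_of_nonneg_left ?_ zero_le_one)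
        refine ((T _).le_of_opNorm_le (hT1 _) _).trans ?_
        rw [one_mul]
        exact (lp_one_norm_single _ _).trans_le (norm_basisTransfer_apply_le b _ _ x)
  have hfac : ∀ i, T i = R i * S * J i := by
    intro i
    refine ext_of_blocks fun n x => ?_
    change _ = R i (S (J i _))
    have key : ∀ k (z : E k), R i (S (lp.single 1 k z)) = if (Nat.unpair k).1 = i then
        T i (lp.single 1 (Nat.unpair k).2 (basisTransfer b k (Nat.unpair k).2 z)) else 0 := by
      intro k z
      rw [hS]
      split_ifs with h
      · rw [h]; exact hRJ _ _
      · exact hRJ' _ _ h _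
    rw [hJ, key, if_pos (by rw [Nat.unpair_pair]), Nat.unpair_pair,
      basisTransfer_basisTransfer b (Nat.right_le_pair i n)]
  obtain ⟨i, hi⟩ := exists_nat_gt ‖φ S‖
  have h1 : ‖φ (T i)‖ ≤ ‖φ (R i)‖ * ‖φ S‖ * ‖φ (J i)‖ := by
    rw [hfac, map_mul, map_mul]
    exact (norm_mul_le _ _).trans (mul_le_mul_of_nonneg_right (norm_mul_le _ _) (norm_nonneg _))
  have h2 := mul_le_mul_of_nonneg_right hi.le
    (mul_nonneg (norm_nonneg (φ (R i))) (norm_nonneg (φ (J i))))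
  linarith [hT i]

section Lifting

variable {A : Type*} [NonUnitalNormedRing A] [NormedSpace 𝕜 A]
  {φ : (lp E 1 →L[𝕜] lp E 1) →ₙₐ[𝕜] A} {M : ℝ}

theorem exists_lift_of_factorization (hM : 0 < M) (hφ : ∀ T, ‖φ T‖ ≤ M * ‖T‖)
    {L : ∀ n, Submodule 𝕜 (E n)} (hL : φ (blockProj L) ≠ 0) {κ : ℝ} (hκ : 0 < κ)
    (h : ∀ (T : lp E 1 →L[𝕜] lp E 1) (ε : ℝ), 0 < ε →
      (∃ D, φ D = 0 ∧ ‖T - D‖ ≤ ε) ∨ UniformlyFactors L T (κ / ε)) :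
    ∃ C : ℝ, 0 < C ∧ ∀ T, ∃ S, φ S = φ T ∧ ‖S‖ ≤ C * ‖φ T‖ := by
  have hN : 0 < ‖φ (blockProj L)‖ := norm_pos_iff.2 hL
  set N := ‖φ (blockProj L)‖
  refine ⟨4 * M ^ 2 * κ / N, by positivity, fun T => ?_⟩
  rcases eq_or_ne (φ T) 0 with h0 | h0
  · exact ⟨0, by rw [h0, map_zero], by simp [h0]⟩
  have hT : 0 < ‖φ T‖ := norm_pos_iff.2 h0
  rcases h T (4 * M ^ 2 * κ / N * ‖φ T‖) (by positivity) with ⟨D, hD, hTD⟩ | hU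
  · exact ⟨T - D, by rw [map_sub, hD, sub_zero], hTD⟩
  · exfalso
    obtain ⟨U, V, hU, hV, hUV⟩ := hU.exists_factorization (by positivity)
      (show 0 < N / (2 * M) by positivity)
    have h1 : N ≤ ‖φ (U * T * V)‖ + ‖φ (U * T * V - blockProj L)‖ := by
      rw [map_sub]
      have := norm_sub_le (φ (U * T * V)) (φ (U * T * V) - φ (blockProj L))
      rwa [sub_sub_cancel] at this
    have h2 : ‖φ (U * T * V - blockProj L)‖ ≤ N / 2 := by
      refine (hφ _).trans ((mul_le_mul_of_nonneg_left hUV hM.le).trans_eq ?_)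
      field_simp
    have h3 : ‖φ (U * T * V)‖ ≤ N / 4 := by
      rw [map_mul, map_mul]
      calc ‖φ U * φ T * φ V‖ ≤ ‖φ U‖ * ‖φ T‖ * ‖φ V‖ :=
            (norm_mul_le _ _).trans
              (mul_le_mul_of_nonneg_right (norm_mul_le _ _) (norm_nonneg _))
        _ ≤ M * (κ / (4 * M ^ 2 * κ / N * ‖φ T‖)) * ‖φ T‖ * (M * 1) := by
            gcongr
            · exact (hφ U).trans (mul_le_mul_of_nonneg_left hU hM.le)
            · exact (hφ V).trans (mul_le_mul_of_nonneg_left hV hM.le)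
        _ = N / 4 := by field_simp
    linarith

theorem approx_or_uniformlyFactors_firstVector (b : ∀ n, OrthonormalBasis (Fin n) 𝕜 (E n))
    (hφ : ∀ (f : lp E 1 →L[𝕜] 𝕜) (x : lp E 1), φ (f.smulRight x) = 0)
    (T : lp E 1 →L[𝕜] lp E 1) {ε : ℝ} (hε : 0 < ε) :
    (∃ D, φ D = 0 ∧ ‖T - D‖ ≤ ε) ∨
      UniformlyFactors (fun n => 𝕜 ∙ firstVector b n) T (3 / ε) := by
  by_cases h : ∃ m, ‖(1 - trunc 𝕜 E m) * T * (1 - trunc 𝕜 E m)‖ ≤ ε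
  · left
    obtain ⟨m, hm⟩ := h
    have hQ := map_trunc_eq_zero_of_rankOne φ b hφ m
    refine ⟨trunc 𝕜 E m * T + T * trunc 𝕜 E m - trunc 𝕜 E m * T * trunc 𝕜 E m, ?_, ?_⟩
    · simp [map_sub, map_add, map_mul, hQ]
    · convert hm using 2
      noncomm_ring
  right
  push Not at h
  have hw : ∀ m, ∃ w : lp E 1, ‖w‖ ≤ 1 ∧ ε < ‖T w - trunc 𝕜 E m (T w)‖ := fun m => by
    obtain ⟨x, hx, hxT⟩ := ContinuousLinearMap.exists_lt_apply_of_lt_opNorm _ (h m)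
    exact ⟨x - trunc 𝕜 E m x, (norm_sub_trunc_apply_le m x).trans hx.le, hxT⟩
  choose w hw1 hw using hw
  choose p hp using fun m => exists_forall_norm_sub_trunc_le (𝕜 := 𝕜) (T (w m))
    (show 0 < ε / 3 by positivity)
  intro s m η S hη
  let μ : ℕ → ℕ := fun l => Nat.rec m (fun _ k => max k (p k)) l
  have hμs : ∀ l, μ (l + 1) = max (μ l) (p (μ l)) := fun l => rfl
  have hμ : Monotone μ := monotone_nat_of_le_succ fun l => by rw [hμs]; exact le_max_left _ _
  obtain ⟨l, l', hll, hS⟩ := exists_lt_norm_trunc_sub_le S (fun l => w (μ l))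
    (fun l => hw1 _) s hη
  have hm : m ≤ μ l' := hμ l'.zero_le
  set x := ((2⁻¹ : ℝ) : 𝕜) • (w (μ l') - w (μ l)) with hxdef
  have hn2 : ∀ y : lp E 1, ‖((2⁻¹ : ℝ) : 𝕜) • y‖ = 2⁻¹ * ‖y‖ := fun y => by
    rw [norm_smul, RCLike.norm_ofReal, abs_of_pos (by norm_num)]
  have hx1 : ‖x‖ ≤ 1 := by
    rw [hxdef, hn2]
    linarith [norm_sub_le (w (μ l')) (w (μ l)), hw1 (μ l'), hw1 (μ l)]
  have hxS : ‖trunc 𝕜 E s (S x)‖ ≤ η := by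
    rw [hxdef, map_smul, map_smul, hn2]
    linarith [norm_nonneg (trunc 𝕜 E s (S (w (μ l') - w (μ l))))]
  set v := T x - trunc 𝕜 E (μ l') (T x) with hv
  have hvn : ε / 3 ≤ ‖v‖ := by
    have h1 := hw (μ l')
    have h2 := hp (μ l) (μ l') ((le_max_right _ _).trans ((hμs l).ge.trans (hμ hll)))
    have h3 : v = ((2⁻¹ : ℝ) : 𝕜) • ((T (w (μ l')) - trunc 𝕜 E (μ l') (T (w (μ l')))) -
        (T (w (μ l)) - trunc 𝕜 E (μ l') (T (w (μ l))))) := by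
      rw [hv, hxdef]
      simp only [map_smul, map_sub]
      module
    rw [h3, hn2]
    linarith [norm_sub_norm_le (T (w (μ l')) - trunc 𝕜 E (μ l') (T (w (μ l'))))
      (T (w (μ l)) - trunc 𝕜 E (μ l') (T (w (μ l))))]
  clear_value x
  have hv0 : 0 < ‖v‖ := lt_of_lt_of_le (by positivity) hvn
  obtain ⟨g, hg, hgv⟩ := exists_dual_vector'' 𝕜 v
  refine ⟨(innerSL 𝕜 (firstVector b s)).smulRight x,
    (((‖v‖⁻¹ : ℝ) : 𝕜) • g.comp (1 - trunc 𝕜 E (μ l'))).smulRight (firstVector b s),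
    ?_, ?_, fun z => ?_, fun y => ?_, fun y => ?_⟩
  · rw [ContinuousLinearMap.norm_smulRight_apply, innerSL_apply_norm]
    exact mul_le_one₀ (norm_firstVector_le b s) (norm_nonneg _) hx1
  · refine ContinuousLinearMap.opNorm_le_bound _ (by positivity) fun z => ?_
    change ‖(((‖v‖⁻¹ : ℝ) : 𝕜) * g (z - trunc 𝕜 E (μ l') z)) • firstVector b s‖ ≤ _
    rw [norm_smul, norm_mul, RCLike.norm_ofReal, abs_of_pos (inv_pos.2 hv0)]
    have h1 : ‖g (z - trunc 𝕜 E (μ l') z)‖ ≤ ‖z‖ :=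
      (g.le_of_opNorm_le hg _).trans (by rw [one_mul]; exact norm_sub_trunc_apply_le _ z)
    have h2 : ‖v‖⁻¹ ≤ 3 / ε := by
      rw [← inv_div]; exact inv_anti₀ (by positivity) hvn
    refine (mul_le_of_le_one_right (by positivity) (norm_firstVector_le b s)).trans ?_
    exact mul_le_mul h2 h1 (norm_nonneg _) (by positivity)
  · change (((‖v‖⁻¹ : ℝ) : 𝕜) * g (trunc 𝕜 E m z - trunc 𝕜 E (μ l') (trunc 𝕜 E m z))) •
      firstVector b s = 0
    rw [trunc_comp_trunc' hm, sub_self, map_zero, mul_zero, zero_smul]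
  · refine le_of_eq_of_le ?_ (by positivity : 0 ≤ η * ‖y‖)
    rw [starProjection_firstVector, norm_eq_zero, sub_eq_zero]
    change (((‖v‖⁻¹ : ℝ) : 𝕜) * g (T (inner 𝕜 (firstVector b s) y • x) -
      trunc 𝕜 E (μ l') (T (inner 𝕜 (firstVector b s) y • x)))) • firstVector b s = _
    rw [map_smul, map_smul, ← smul_sub, map_smul, ← hv, hgv, smul_eq_mul, mul_left_comm,
      ← RCLike.ofReal_mul, inv_mul_cancel₀ hv0.ne', RCLike.ofReal_one, mul_one]
  · rw [ContinuousLinearMap.smulRight_apply, map_smul, map_smul, norm_smul, innerSL_apply_apply,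
      mul_comm η]
    refine mul_le_mul ?_ hxS (norm_nonneg _) (norm_nonneg _)
    exact (norm_inner_le_norm _ _).trans
      (mul_le_of_le_one_left (norm_nonneg _) (norm_firstVector_le b s))

theorem approx_or_uniformlyFactors_top (b : ∀ n, OrthonormalBasis (Fin n) 𝕜 (E n))
    (hφ : φ (firstProj b) = 0) (T : lp E 1 →L[𝕜] lp E 1) {ε : ℝ} (hε : 0 < ε) :
    (∃ D, φ D = 0 ∧ ‖T - D‖ ≤ ε) ∨ UniformlyFactors (fun _ => ⊤) T (1 / ε) := by
  by_cases h : ∀ r m : ℕ, ∃ n, ∀ (N : Submodule 𝕜 (E n)) (L : ∀ j, Submodule 𝕜 (E j)),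
      Module.finrank 𝕜 Nᗮ ≤ r → (∀ j, Module.finrank 𝕜 (L j) ≤ r) → ∃ y ∈ N, ε * ‖y‖ <
        ‖((1 - trunc 𝕜 E m) * T) (lp.single 1 n y) -
          blockProj L (((1 - trunc 𝕜 E m) * T) (lp.single 1 n y))‖
  · right
    intro s m η S hη
    obtain ⟨n, hn⟩ := h (Module.finrank 𝕜 (∀ k : Fin s, E k) + 2 * s) m
    let ι := lp.singleContinuousLinearMap 𝕜 E 1 n
    let G : E n →ₗ[𝕜] ∀ k : Fin s, E k :=
      LinearMap.pi fun k => ((lp.evalCLM 𝕜 E 1 (k : ℕ)).comp (S.comp ι)).toLinearMap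
    obtain ⟨x, u, f, hx, hxo, hxG, hu, huo, hf, hfT⟩ :=
      exists_orthogonal_system (((1 - trunc 𝕜 E m) * T).comp ι) G hε hn s le_rfl
    let X : E s →L[𝕜] E n := ∑ a, (innerSL 𝕜 (b s a)).smulRight (x a)
    have hX : ∀ y, X y = ∑ a, inner 𝕜 (b s a) y • x a := fun y => by simp [X, sum_apply]
    let U₀ : lp E 1 →L[𝕜] E s := ∑ a, (f a).smulRight (b s a)
    have hU₀ : ∀ z, U₀ z = ∑ a, f a z • b s a := fun z => by simp [U₀, sum_apply]
    have hU₀n : ‖U₀‖ ≤ 1 := by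
      refine opNorm_le_of_blocks _ zero_le_one fun j z => ?_
      rw [hU₀, one_mul]
      simp only [hf]
      refine le_of_sq_le_sq ((norm_sum_smul_sq_le (fun a => ((b s).norm_eq_one a).le)
        (fun a c hac => (b s).inner_eq_zero hac) _).trans ?_) (norm_nonneg _)
      exact sum_norm_inner_sq_le (fun a => hu a j) (fun a c hac => huo a c hac j) z
    have hU₀X : ∀ y, U₀ (((1 - trunc 𝕜 E m) * T) (ι (X y))) = (ε : 𝕜) • y := fun y => by
      have h1 : ∀ c, f c (((1 - trunc 𝕜 E m) * T) (ι (X y))) = ε * inner 𝕜 (b s c) y := fun c => by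
        rw [hX, map_sum, map_sum, map_sum, Finset.sum_eq_single c]
        · have h2 := hfT c c
          rw [if_pos rfl, ContinuousLinearMap.comp_apply] at h2
          rw [map_smul, map_smul, map_smul, h2, smul_eq_mul, mul_comm]
        · intro a _ hac
          have h2 := hfT a c
          rw [if_neg hac, ContinuousLinearMap.comp_apply] at h2
          rw [map_smul, map_smul, map_smul, h2, smul_zero]
        · intro hc; exact absurd (Finset.mem_univ c) hc
      rw [hU₀]
      simp only [h1, mul_smul]
      rw [← Finset.smul_sum, (b s).sum_repr' y]
    refine ⟨ι.comp X, ((ε⁻¹ : ℝ) : 𝕜) • U₀.comp (1 - trunc 𝕜 E m), ?_, ?_, fun z => ?_,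
      fun y => ?_, fun y => ?_⟩
    · refine ContinuousLinearMap.opNorm_le_bound _ zero_le_one fun y => ?_
      rw [one_mul]
      refine (lp_one_norm_single n (X y)).trans_le ?_
      rw [hX]
      exact le_of_sq_le_sq ((norm_sum_smul_sq_le hx hxo _).trans_eq
        ((b s).sum_sq_norm_inner_right y)) (norm_nonneg _)
    · refine ContinuousLinearMap.opNorm_le_bound _ (by positivity) fun z => ?_
      change ‖((ε⁻¹ : ℝ) : 𝕜) • U₀ (z - trunc 𝕜 E m z)‖ ≤ _
      rw [norm_smul, RCLike.norm_ofReal, abs_of_pos (inv_pos.2 hε), one_div]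
      refine mul_le_mul_of_nonneg_left ?_ (inv_pos.2 hε).le
      refine (U₀.le_of_opNorm_le hU₀n _).trans ?_
      rw [one_mul]
      exact norm_sub_trunc_apply_le _ z
    · change ((ε⁻¹ : ℝ) : 𝕜) • U₀ (trunc 𝕜 E m z - trunc 𝕜 E m (trunc 𝕜 E m z)) = 0
      rw [trunc_comp_trunc le_rfl, sub_self, map_zero, smul_zero]
    · refine le_of_eq_of_le ?_ (by positivity : 0 ≤ η * ‖y‖)
      rw [Submodule.starProjection_top, norm_eq_zero, sub_eq_zero]
      change ((ε⁻¹ : ℝ) : 𝕜) • U₀ (((1 - trunc 𝕜 E m) * T) (ι (X y))) = y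
      rw [hU₀X, smul_smul, ← RCLike.ofReal_mul, inv_mul_cancel₀ hε.ne', RCLike.ofReal_one, one_smul]
    · refine le_of_eq_of_le ?_ (by positivity : 0 ≤ η * ‖y‖)
      have h1 : G (X y) = 0 := by
        rw [hX, map_sum]
        exact Finset.sum_eq_zero fun a _ => by rw [map_smul, hxG, smul_zero]
      rw [norm_trunc_apply_eq]
      refine Finset.sum_eq_zero fun k hk => ?_
      rw [norm_eq_zero]
      exact congrFun h1 ⟨k, Finset.mem_range.1 hk⟩
  · left
    push Not at h
    obtain ⟨r, m, h⟩ := h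
    choose N L hN hL hNL using h
    set T' := (1 - trunc 𝕜 E m) * T with hT'
    obtain ⟨R, -, hR, -⟩ := exists_clm_of_blocks (fun n => ((blockProj (L n)).comp
      (T' * blockProj N)).comp (lp.singleContinuousLinearMap 𝕜 E 1 n))
      (norm_nonneg (T' * blockProj N)) fun n x => by
        refine (norm_blockProj_apply_le _ _).trans ?_
        exact (ContinuousLinearMap.le_opNorm _ _).trans_eq
          (congrArg _ (lp_one_norm_single n x))
    have hN' : blockProj (fun n => (N n)ᗮ) = 1 - blockProj N := by
      refine ext_of_blocks fun n x => ?_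
      rw [blockProj_single, sub_apply, blockProj_single, Submodule.starProjection_orthogonal_val]
      exact lp.single_sub 1 n x _
    have hQ := map_trunc_eq_zero φ b hφ m
    have hK := map_blockProj_eq_zero φ b hφ _ hN
    have hRφ := map_eq_zero_of_finrank_le φ b hφ (T' * blockProj N) R L hL hR
    refine ⟨trunc 𝕜 E m * T + T' * blockProj (fun n => (N n)ᗮ) + R, ?_, ?_⟩
    · rw [map_add, map_add, map_mul, map_mul, hQ, hK, hRφ]
      simp
    · have h1 : T - (trunc 𝕜 E m * T + T' * blockProj (fun n => (N n)ᗮ) + R) =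
          T' * blockProj N - R := by
        rw [hN', hT']
        noncomm_ring
      rw [h1]
      refine opNorm_le_of_blocks _ hε.le fun n x => ?_
      rw [sub_apply, hR]
      change ‖T' (blockProj N (lp.single 1 n x)) -
        blockProj (L n) (T' (blockProj N (lp.single 1 n x)))‖ ≤ _
      rw [blockProj_single]
      refine (hNL n _ (Submodule.starProjection_apply_mem _ x)).trans ?_
      exact mul_le_mul_of_nonneg_left (Submodule.norm_starProjection_apply_le _ x) hε.le

theorem exists_lift_of_bound (b : ∀ n, OrthonormalBasis (Fin n) 𝕜 (E n)) (hM : 0 < M)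
    (hφ : ∀ T, ‖φ T‖ ≤ M * ‖T‖) :
    ∃ C : ℝ, 0 < C ∧ ∀ T, ∃ S, φ S = φ T ∧ ‖S‖ ≤ C * ‖φ T‖ := by
  by_cases h1 : ∃ (f : lp E 1 →L[𝕜] 𝕜) (x : lp E 1), φ (f.smulRight x) ≠ 0
  · obtain ⟨f, x, h1⟩ := h1
    obtain ⟨C, hC, h⟩ := exists_norm_le_of_rankOne_ne_zero hM hφ h1
    exact ⟨C, hC, fun T => ⟨T, rfl, h T⟩⟩
  push Not at h1
  by_cases h2 : φ (firstProj b) = 0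
  · by_cases h3 : φ 1 = 0
    · exact ⟨1, one_pos, fun T => ⟨0, by rw [← mul_one T, map_mul, h3, mul_zero, map_zero],
        by simp⟩⟩
    · refine exists_lift_of_factorization hM hφ (L := fun _ => ⊤) ?_ one_pos
        fun T ε hε => approx_or_uniformlyFactors_top b h2 T hε
      convert h3
      refine ext_of_blocks fun n x => ?_
      rw [blockProj_single, Submodule.starProjection_top]
      rfl
  · exact exists_lift_of_factorization hM hφ h2 three_pos
      fun T ε hε => approx_or_uniformlyFactors_firstVector b h1 T hε

theorem continuous_and_isClosed_range [CompleteSpace A]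
    (b : ∀ n, OrthonormalBasis (Fin n) 𝕜 (E n)) (φ : (lp E 1 →L[𝕜] lp E 1) →ₙₐ[𝕜] A) :
    Continuous φ ∧ IsClosed (Set.range φ) := by
  obtain ⟨M, hM, hφ⟩ := exists_bound_of_algHom b φ
  obtain ⟨C, hC, hlift⟩ := exists_lift_of_bound b hM hφ
  have hcont : Continuous φ := AddMonoidHomClass.continuous_of_bound φ M hφ
  refine ⟨hcont, ?_⟩
  let Φ : NormedAddGroupHom (lp E 1 →L[𝕜] lp E 1) A :=
    ⟨φ, map_add φ, ⟨M, hφ⟩⟩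
  have hsurj : Φ.SurjectiveOnWith Φ.range C := by
    rintro _ ⟨T, rfl⟩
    exact hlift T
  have hcl := controlled_closure_of_complete hC one_pos hsurj
  refine isClosed_of_closure_subset fun y hy => ?_
  have hy' : y ∈ Φ.range.topologicalClosure := hy
  obtain ⟨S, hS, -⟩ := hcl y hy'
  exact ⟨S, hS⟩

end Lifting

end BlockOperators

/-- Let `X = (⊕_{n∈ℕ} ℓ₂ⁿ)_{ℓ₁}` be the ℓ₁-direct sum of the
finite-dimensional Euclidean spaces `ℓ₂ⁿ`. Then every homomorphism (i.e. linear and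
multiplicative map) from the Banach algebra `B(X)` of bounded linear operators on `X`
into a Banach algebra is continuous and has closed range. -/
theorem statement0 {𝕜 : Type*} [RCLike 𝕜]
    (B : Type*) [NonUnitalNormedRing B] [NormedSpace 𝕜 B]
    [IsScalarTower 𝕜 B B] [SMulCommClass 𝕜 B B] [CompleteSpace B]
    (φ : (lp (fun n : ℕ => EuclideanSpace 𝕜 (Fin n)) 1 →L[𝕜]
          lp (fun n : ℕ => EuclideanSpace 𝕜 (Fin n)) 1) →ₙₐ[𝕜] B) :
    Continuous φ ∧ IsClosed (Set.range φ) := by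
  exact continuous_and_isClosed_range (fun n => EuclideanSpace.basisFun (Fin n) 𝕜) φ
end

section
/- Let Γ be an uncountable set and let X = (⊕_{n∈ℕ} ℓ₂ⁿ)_{ℓ₁} ⊕ ℓ₁(Γ), the direct sum of the ℓ₁-direct sum of the finite-dimensional Euclidean spaces ℓ₂ⁿ and the space ℓ₁(Γ), equipped with the norm ‖(x,y)‖ = ‖x‖ + ‖y‖. Then every homomorphism from the Banach algebra B(X) of bounded linear operators on X into a Banach algebra is continuous and has closed range. -/
open scoped ENNReal

namespace L1Sum

section Columns

variable {𝕜 : Type*} [RCLike 𝕜] {J : Type*} {H : J → Type*}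
  [∀ j, NormedAddCommGroup (H j)] [∀ j, NormedSpace 𝕜 (H j)]
  {Y : Type*} [NormedAddCommGroup Y] [NormedSpace 𝕜 Y]

variable (𝕜 H) in
/-- The inclusion of the `j`-th summand into an `ℓ₁`-direct sum. -/
noncomputable def inc (j : J) : H j →L[𝕜] lp H 1 := by
  classical exact lp.singleContinuousLinearMap 𝕜 H 1 j

omit [∀ j, NormedSpace 𝕜 (H j)] in
theorem summable_norm (z : lp H 1) : Summable fun j => ‖z j‖ := by
  simpa using (lp.hasSum_norm (p := 1) (by simp) z).summable

omit [∀ j, NormedSpace 𝕜 (H j)] in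
theorem norm_eq_tsum (z : lp H 1) : ‖z‖ = ∑' j, ‖z j‖ := by
  simpa using lp.norm_rpow_eq_tsum (p := 1) (by simp) z

@[simp] theorem inc_apply_self (j : J) (x : H j) : inc 𝕜 H j x j = x := by
  classical
  simp [inc]

theorem inc_apply_ne {i j : J} (h : i ≠ j) (x : H j) : inc 𝕜 H j x i = 0 := by
  classical
  simp [inc, h]

@[simp] theorem norm_inc_apply (j : J) (x : H j) : ‖inc 𝕜 H j x‖ = ‖x‖ := by
  classical
  simp [inc, lp.norm_single]

theorem norm_inc_le (j : J) : ‖inc 𝕜 H j‖ ≤ 1 :=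
  ContinuousLinearMap.opNorm_le_bound _ zero_le_one fun x => by simp

variable (𝕜) in
theorem hasSum_inc (z : lp H 1) : HasSum (fun j => inc 𝕜 H j (z j)) z := by
  classical
  simpa [inc] using lp.hasSum_single (p := 1) (by simp) z

theorem clm_ext {S T : lp H 1 →L[𝕜] Y}
    (h : ∀ j x, S (inc 𝕜 H j x) = T (inc 𝕜 H j x)) : S = T := by
  ext z
  have h1 := S.hasSum (hasSum_inc 𝕜 z)
  have h2 := T.hasSum (hasSum_inc 𝕜 z)
  simp only [h] at h1
  exact h1.unique h2

theorem norm_le_of_columns {S : lp H 1 →L[𝕜] Y} {C : ℝ} (hC : 0 ≤ C)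
    (h : ∀ j x, ‖S (inc 𝕜 H j x)‖ ≤ C * ‖x‖) : ‖S‖ ≤ C := by
  refine S.opNorm_le_bound hC fun z => ?_
  rw [norm_eq_tsum, ← tsum_mul_left]
  exact (S.hasSum (hasSum_inc 𝕜 z)).norm_le_of_bounded
    ((summable_norm z).mul_left C).hasSum fun j => h j (z j)

/-- A uniformly bounded family of operators on the summands extends to the `ℓ₁`-sum. -/
theorem exists_colMap [CompleteSpace Y] {C : ℝ} (hC : 0 ≤ C) (L : ∀ j, H j →L[𝕜] Y)
    (hL : ∀ j, ‖L j‖ ≤ C) :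
    ∃ S : lp H 1 →L[𝕜] Y, ‖S‖ ≤ C ∧ ∀ j x, S (inc 𝕜 H j x) = L j x := by
  have hle : ∀ (z : lp H 1) j, ‖L j (z j)‖ ≤ C * ‖z j‖ := fun z j =>
    (L j).le_of_opNorm_le (hL j) _
  have hs : ∀ z : lp H 1, Summable fun j => L j (z j) := fun z =>
    Summable.of_norm_bounded ((summable_norm z).mul_left C) (hle z)
  let S₀ : lp H 1 →ₗ[𝕜] Y :=
    { toFun := fun z => ∑' j, L j (z j)
      map_add' := fun z w => by
        simp only [lp.coeFn_add, Pi.add_apply, map_add]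
        exact (hs z).tsum_add (hs w)
      map_smul' := fun c z => by
        simp only [lp.coeFn_smul, Pi.smul_apply, map_smul, RingHom.id_apply]
        exact (hs z).tsum_const_smul c }
  have hb : ∀ z, ‖S₀ z‖ ≤ C * ‖z‖ := fun z => by
    rw [norm_eq_tsum, ← tsum_mul_left]
    exact (hs z).hasSum.norm_le_of_bounded ((summable_norm z).mul_left C).hasSum (hle z)
  refine ⟨S₀.mkContinuous C hb, S₀.mkContinuous_norm_le hC hb, fun j x => ?_⟩
  change ∑' i, L i (inc 𝕜 H j x i) = _
  rw [tsum_eq_single j fun i hi => by rw [inc_apply_ne hi, map_zero], inc_apply_self]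

/-- Operators can be glued along pairwise disjoint sets of columns. -/
theorem exists_glue [CompleteSpace Y] {K : Type*} {C : ℝ} (hC : 0 ≤ C) (F : K → Set J)
    (hF : ∀ k l j, j ∈ F k → j ∈ F l → k = l) (R : K → lp H 1 →L[𝕜] Y)
    (hR : ∀ k, ‖R k‖ ≤ C) :
    ∃ S : lp H 1 →L[𝕜] Y, ‖S‖ ≤ C ∧
      (∀ k, ∀ j ∈ F k, ∀ x, S (inc 𝕜 H j x) = R k (inc 𝕜 H j x)) ∧
      ∀ j, (∀ k, j ∉ F k) → ∀ x, S (inc 𝕜 H j x) = 0 := by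
  classical
  have hn : ∀ k j, ‖(R k).comp (inc 𝕜 H j)‖ ≤ C := fun k j =>
    ((R k).opNorm_comp_le _).trans
      ((mul_le_of_le_one_right (norm_nonneg _) (norm_inc_le j)).trans (hR k))
  obtain ⟨S, hS, hSj⟩ := exists_colMap (𝕜 := 𝕜) (H := H) (Y := Y) hC
    (fun j => if h : ∃ k, j ∈ F k then (R h.choose).comp (inc 𝕜 H j) else 0)
    (fun j => by split_ifs <;> simp [hC, hn])
  refine ⟨S, hS, fun k j hj x => ?_, fun j hj x => ?_⟩
  · have h : ∃ k, j ∈ F k := ⟨k, hj⟩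
    rw [hSj, dif_pos h, hF _ _ j h.choose_spec hj]
    rfl
  · rw [hSj, dif_neg (by simpa using hj)]
    rfl

/-- An operator prescribed on the columns indexed by an injective family. -/
theorem exists_inj [CompleteSpace Y] {K : Type*} {C : ℝ} (hC : 0 ≤ C) (a : K → J)
    (ha : Function.Injective a) (L : ∀ k, H (a k) →L[𝕜] Y) (hL : ∀ k, ‖L k‖ ≤ C) :
    ∃ S : lp H 1 →L[𝕜] Y, ‖S‖ ≤ C ∧ (∀ k x, S (inc 𝕜 H (a k) x) = L k x) ∧
      ∀ j, j ∉ Set.range a → ∀ x, S (inc 𝕜 H j x) = 0 := by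
  classical
  have hev : ∀ j, ‖lp.evalCLM 𝕜 H 1 j‖ ≤ 1 := fun j =>
    ContinuousLinearMap.opNorm_le_bound _ zero_le_one fun z =>
      (lp.norm_apply_le_norm one_ne_zero z j).trans_eq (one_mul _).symm
  obtain ⟨S, hS, h1, h2⟩ := exists_glue (𝕜 := 𝕜) (H := H) hC (fun k => {a k})
    (fun k l j hk hl => ha (hk.symm.trans hl)) (fun k => (L k).comp (lp.evalCLM 𝕜 H 1 (a k)))
    (fun k => ((L k).opNorm_comp_le _).trans
      ((mul_le_of_le_one_right (norm_nonneg _) (hev _)).trans (hL k)))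
  refine ⟨S, hS, fun k x => ?_, fun j hj x => h2 j (fun k hk => hj ⟨k, hk.symm⟩) x⟩
  rw [h1 k _ rfl]
  change L k (inc 𝕜 H (a k) x (a k)) = _
  rw [inc_apply_self]

end Columns

section Restriction

variable {𝕜 : Type*} [RCLike 𝕜] {J : Type*} {H : J → Type*}
  [∀ j, NormedAddCommGroup (H j)] [∀ j, NormedSpace 𝕜 (H j)]

open Classical in
variable (𝕜 H) in
/-- The canonical projection of an `ℓ₁`-sum onto the coordinates in `U`. -/
noncomputable def restr (U : Set J) : lp H 1 →L[𝕜] lp H 1 :=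
  LinearMap.mkContinuous
    { toFun := fun z => ⟨fun j => if j ∈ U then z j else 0, by
        refine (lp.memℓp z).mono' fun j => ?_
        split_ifs <;> simp⟩
      map_add' := fun z w => by
        ext j
        change (if j ∈ U then z j + w j else 0) =
          (if j ∈ U then z j else 0) + if j ∈ U then w j else 0
        by_cases h : j ∈ U <;> simp [h]
      map_smul' := fun c z => by
        ext j
        by_cases h : j ∈ U <;> simp [h] } 1 fun z => by
    rw [one_mul]
    refine lp.norm_mono one_ne_zero fun j => ?_
    by_cases h : j ∈ U <;> simp [h]

theorem restr_apply_mem {U : Set J} {j : J} (h : j ∈ U) (z : lp H 1) :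
    restr 𝕜 H U z j = z j := if_pos h

theorem restr_apply_notMem {U : Set J} {j : J} (h : j ∉ U) (z : lp H 1) :
    restr 𝕜 H U z j = 0 := if_neg h

theorem norm_restr_apply_le (U : Set J) (z : lp H 1) : ‖restr 𝕜 H U z‖ ≤ ‖z‖ := by
  refine lp.norm_mono one_ne_zero fun j => ?_
  by_cases h : j ∈ U
  · rw [restr_apply_mem h]
  · simp [restr_apply_notMem h]

theorem norm_restr_le (U : Set J) : ‖restr 𝕜 H U‖ ≤ 1 :=
  ContinuousLinearMap.opNorm_le_bound _ zero_le_one fun z => by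
    simpa using norm_restr_apply_le U z

theorem restr_inc_mem {U : Set J} {j : J} (h : j ∈ U) (x : H j) :
    restr 𝕜 H U (inc 𝕜 H j x) = inc 𝕜 H j x := by
  ext i
  by_cases hi : i ∈ U
  · rw [restr_apply_mem hi]
  · rw [restr_apply_notMem hi, inc_apply_ne]
    rintro rfl
    exact hi h

theorem restr_inc_notMem {U : Set J} {j : J} (h : j ∉ U) (x : H j) :
    restr 𝕜 H U (inc 𝕜 H j x) = 0 := by
  ext i
  by_cases hi : i ∈ U
  · rw [restr_apply_mem hi, inc_apply_ne]
    · rfl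
    · rintro rfl
      exact h hi
  · rw [restr_apply_notMem hi]
    rfl

theorem restr_restr (U V : Set J) (z : lp H 1) :
    restr 𝕜 H U (restr 𝕜 H V z) = restr 𝕜 H (U ∩ V) z := by
  ext j
  by_cases hU : j ∈ U <;> by_cases hV : j ∈ V <;>
    simp [restr_apply_mem, restr_apply_notMem, hU, hV]

theorem restr_union {U V : Set J} (h : Disjoint U V) (z : lp H 1) :
    restr 𝕜 H (U ∪ V) z = restr 𝕜 H U z + restr 𝕜 H V z := by
  ext j
  by_cases hU : j ∈ U
  · have hV := Set.disjoint_left.1 h hU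
    simp [restr_apply_mem, restr_apply_notMem, hU, hV]
  · by_cases hV : j ∈ V <;> simp [restr_apply_mem, restr_apply_notMem, hU, hV]

theorem norm_restr_union {U V : Set J} (h : Disjoint U V) (z : lp H 1) :
    ‖restr 𝕜 H (U ∪ V) z‖ = ‖restr 𝕜 H U z‖ + ‖restr 𝕜 H V z‖ := by
  rw [norm_eq_tsum, norm_eq_tsum, norm_eq_tsum, ← (summable_norm _).tsum_add (summable_norm _)]
  refine tsum_congr fun j => ?_
  by_cases hU : j ∈ U
  · have hV := Set.disjoint_left.1 h hU
    simp [restr_apply_mem, restr_apply_notMem, hU, hV]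
  · by_cases hV : j ∈ V <;> simp [restr_apply_mem, restr_apply_notMem, hU, hV]

theorem restr_univ (z : lp H 1) : restr 𝕜 H Set.univ z = z := by
  ext j
  rw [restr_apply_mem (Set.mem_univ j)]

theorem restr_add_compl (U : Set J) (z : lp H 1) :
    restr 𝕜 H U z + restr 𝕜 H Uᶜ z = z := by
  rw [← restr_union disjoint_compl_right, Set.union_compl_self, restr_univ]

theorem restr_comp_restr (U V : Set J) :
    restr 𝕜 H U * restr 𝕜 H V = restr 𝕜 H (U ∩ V) := by
  ext1 z
  exact restr_restr U V z

/-- Elements of an `ℓ₁`-sum are approximated by their restrictions to finite sets. -/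
theorem exists_finset_norm_restr_compl_lt (z : lp H 1) {δ : ℝ} (hδ : 0 < δ) :
    ∃ F : Finset J, ∀ F' : Finset J, F ⊆ F' → ‖restr 𝕜 H (F' : Set J)ᶜ z‖ < δ := by
  have hz := (summable_norm z).hasSum
  obtain ⟨F, hF⟩ := (tendsto_order.1 hz).1 (∑' j, ‖z j‖ - δ) (by linarith) |>.exists_forall_of_atTop
  refine ⟨F, fun F' h => ?_⟩
  have h1 := hF F' h
  have h2 : ‖restr 𝕜 H (F' : Set J) z‖ = ∑ j ∈ F', ‖z j‖ := by
    rw [norm_eq_tsum, tsum_eq_sum (s := F')]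
    · exact Finset.sum_congr rfl fun j hj => by rw [restr_apply_mem (by simpa using hj)]
    · intro j hj
      rw [restr_apply_notMem (by simpa using hj), norm_zero]
  have h3 := norm_restr_union (𝕜 := 𝕜) (disjoint_compl_right (a := (F' : Set J))) z
  rw [Set.union_compl_self, restr_univ, norm_eq_tsum z, h2] at h3
  linarith

/-- If all finite restrictions within `V` are small then so is the restriction to `V`. -/
theorem norm_restr_le_of_finset {V : Set J} (z : lp H 1) {δ : ℝ}
    (h : ∀ F : Finset J, (F : Set J) ⊆ V → ‖restr 𝕜 H (F : Set J) z‖ ≤ δ) :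
    ‖restr 𝕜 H V z‖ ≤ δ := by
  classical
  refine le_of_forall_pos_le_add fun η hη => ?_
  obtain ⟨F, hF⟩ := exists_finset_norm_restr_compl_lt (𝕜 := 𝕜) (restr 𝕜 H V z) hη
  have h1 := hF F subset_rfl
  rw [restr_restr] at h1
  have h2 := h (F.filter (· ∈ V)) (by intro j hj; simpa using (Finset.mem_filter.1 hj).2)
  have h3 : V = ((F.filter (· ∈ V) : Finset J) : Set J) ∪ ((F : Set J)ᶜ ∩ V) := by
    ext j
    by_cases hj : j ∈ F <;> simp [hj]
  rw [h3, norm_restr_union]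
  · linarith
  · rw [Set.disjoint_left]
    intro j hj hj'
    exact hj'.1 (by simpa using (Finset.mem_filter.1 hj).1)

end Restriction

/-- A small perturbation of the identity has an inverse of norm at most two. -/
theorem exists_inverse_of_norm_sub_one_le {A : Type*} [NormedRing A] [CompleteSpace A]
    (h1 : ‖(1 : A)‖ ≤ 1) {W : A} (hW : ‖W - 1‖ ≤ 1 / 2) : ∃ V : A, V * W = 1 ∧ ‖V‖ ≤ 2 := by
  obtain ⟨u, hu⟩ := isUnit_one_sub_of_norm_lt_one (x := 1 - W)
    (by rw [norm_sub_rev]; linarith)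
  rw [sub_sub_cancel] at hu
  refine ⟨↑u⁻¹, by rw [← hu, Units.inv_mul], ?_⟩
  have h : (↑u⁻¹ : A) = 1 - ↑u⁻¹ * (W - 1) := by
    rw [mul_sub, ← hu, Units.inv_mul, mul_one, sub_sub_cancel]
  have h2 : ‖(↑u⁻¹ : A)‖ ≤ 1 + ‖(↑u⁻¹ : A)‖ * (1 / 2) := by
    conv_lhs => rw [h]
    refine (norm_sub_le _ _).trans (add_le_add h1 ((norm_mul_le _ _).trans ?_))
    gcongr
  linarith

end L1Sum

namespace L1Sum

/-- Rosenthal's disjointification lemma, for a uniformly bounded family of superadditive set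
functions indexed by an infinite type. -/
theorem exists_injective_small_off_diagonal {K : Type*} [Infinite K] (μ : K → Set K → ℝ)
    (hμ₀ : ∀ k S, 0 ≤ μ k S)
    (hμ : ∀ k S S', Disjoint S S' → μ k S + μ k S' ≤ μ k (S ∪ S'))
    {M : ℝ} (hM : ∀ k S, μ k S ≤ M) {δ : ℝ} (hδ : 0 < δ) :
    ∃ g : K → K, Function.Injective g ∧ ∀ k, μ (g k) (g '' {k}ᶜ) ≤ δ := by
  by_contra hcon
  push Not at hcon
  have mono : ∀ k S S', S ⊆ S' → μ k S ≤ μ k S' := fun k S S' h => by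
    have := hμ k S (S' \ S) Set.disjoint_sdiff_right
    rw [Set.union_sdiff_cancel h] at this
    linarith [hμ₀ k (S' \ S)]
  have step : ∀ n : ℕ, ∃ g : K → K, Function.Injective g ∧
      ∀ k, μ (g k) (Set.range g) ≤ M - n * δ := by
    intro n
    induction n with
    | zero => exact ⟨id, Function.injective_id, fun k => by simpa using hM _ _⟩
    | succ n ih =>
      obtain ⟨g, hg, hgM⟩ := ih
      obtain ⟨e⟩ : Nonempty (K × K ≃ K) := by
        rw [← Cardinal.eq, Cardinal.mk_prod, Cardinal.lift_id]
        exact Cardinal.mul_eq_self (Cardinal.aleph0_le_mk K)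
      have hinj : ∀ α, Function.Injective fun β => g (e (α, β)) := fun α β β' h => by
        simpa using e.injective (hg h)
      choose b hb using fun α => hcon _ (hinj α)
      refine ⟨fun α => g (e (α, b α)), fun α α' h => ?_, fun α => ?_⟩
      · have := e.injective (hg h)
        simp only [Prod.mk.injEq] at this
        exact this.1
      · have hd : Disjoint (Set.range fun α => g (e (α, b α)))
            ((fun β => g (e (α, β))) '' {b α}ᶜ) := by
          rw [Set.disjoint_left]
          rintro _ ⟨α', rfl⟩ ⟨β, hβ, h⟩
          have := e.injective (hg h)
          simp only [Prod.mk.injEq] at this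
          obtain ⟨rfl, rfl⟩ := this
          exact hβ rfl
        have h1 := hμ (g (e (α, b α))) _ _ hd
        have h2 := mono (g (e (α, b α))) _ (Set.range g)
          (Set.union_subset (by rintro _ ⟨α', rfl⟩; exact ⟨_, rfl⟩ :
            (Set.range fun α => g (e (α, b α))) ⊆ Set.range g)
            (by rintro _ ⟨β, -, rfl⟩; exact ⟨_, rfl⟩ :
            ((fun β => g (e (α, β))) '' {b α}ᶜ) ⊆ Set.range g))
        have h3 := hgM (e (α, b α))
        have h4 := hb α
        push_cast
        linarith
  obtain ⟨n, hn⟩ := exists_nat_gt (M / δ)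
  obtain ⟨g, -, hg⟩ := step n
  have k : K := Classical.arbitrary K
  have h1 := hg k
  have h2 := hμ₀ (g k) (Set.range g)
  rw [div_lt_iff₀ hδ] at hn
  linarith

variable {𝕜 : Type*} [RCLike 𝕜] {J : Type*} {H : J → Type*}
  [∀ j, NormedAddCommGroup (H j)] [∀ j, NormedSpace 𝕜 (H j)]
  {Y : Type*} [NormedAddCommGroup Y] [NormedSpace 𝕜 Y]

/-- Gluing of operators along disjoint sets of coordinates, formulated with restrictions. -/
theorem exists_glue_restr [CompleteSpace Y] {K : Type*} {C : ℝ} (hC : 0 ≤ C) (F : K → Set J)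
    (hF : ∀ k l j, j ∈ F k → j ∈ F l → k = l) (R : K → lp H 1 →L[𝕜] Y)
    (hR : ∀ k, ‖R k‖ ≤ C) :
    ∃ S : lp H 1 →L[𝕜] Y, ‖S‖ ≤ C ∧
      (∀ k z, S (restr 𝕜 H (F k) z) = R k (restr 𝕜 H (F k) z)) ∧
      ∀ z, S (restr 𝕜 H (⋃ k, F k)ᶜ z) = 0 := by
  obtain ⟨S, hS, h1, h2⟩ := exists_glue hC F hF R hR
  refine ⟨S, hS, fun k z => ?_, fun z => ?_⟩
  · refine DFunLike.congr_fun (clm_ext (S := S.comp (restr 𝕜 H (F k)))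
      (T := (R k).comp (restr 𝕜 H (F k))) fun j x => ?_) z
    by_cases hj : j ∈ F k
    · simpa [restr_inc_mem hj] using h1 k j hj x
    · simp [restr_inc_notMem hj]
  · refine DFunLike.congr_fun (clm_ext (S := S.comp (restr 𝕜 H (⋃ k, F k)ᶜ))
      (T := 0) fun j x => ?_) z
    by_cases hj : j ∈ (⋃ k, F k)ᶜ
    · rw [ContinuousLinearMap.comp_apply, restr_inc_mem hj]
      exact h2 j (by simpa using hj) x
    · rw [ContinuousLinearMap.comp_apply, restr_inc_notMem hj, map_zero]
      rfl

/-- An operator which is far from its restrictions to sets of coordinates smaller than `A` has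
many large disjoint blocks. -/
theorem exists_disjoint_large_blocks {A J₀ : Set J} (hA : A.Infinite) {T : lp H 1 →L[𝕜] lp H 1}
    (hT : ∀ z, restr 𝕜 H J₀ (T z) = T z) {δ : ℝ} (hδ : 0 < δ)
    (hfar : ∀ U ⊆ J₀, Cardinal.mk U < Cardinal.mk A → δ < ‖T - restr 𝕜 H U * T‖) :
    ∃ F : A → Finset J, (∀ a b, a ≠ b → Disjoint (F a) (F b)) ∧
      ∀ a, ∃ j, ∃ x : H j, ‖x‖ ≤ 1 ∧ δ < ‖restr 𝕜 H (F a : Set J) (T (inc 𝕜 H j x))‖ := by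
  let P : Finset J → Prop := fun F => (F : Set J) ⊆ J₀ ∧ ∃ j, ∃ x : H j, ‖x‖ ≤ 1 ∧
    δ < ‖restr 𝕜 H (F : Set J) (T (inc 𝕜 H j x))‖
  obtain ⟨𝓜, h𝓜⟩ := zorn_subset
    {𝓜 : Set (Finset J) | (∀ F ∈ 𝓜, P F) ∧ 𝓜.Pairwise Disjoint} (by
      intro c hc hchain
      refine ⟨⋃₀ c, ⟨?_, ?_⟩, fun s hs => Set.subset_sUnion_of_mem hs⟩
      · rintro F ⟨s, hs, hF⟩
        exact (hc hs).1 F hF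
      · exact (Set.pairwise_sUnion hchain.directedOn).2 fun s hs => (hc hs).2)
  set U : Set J := ⋃ F ∈ 𝓜, (F : Set J) with hU
  have hUJ : U ⊆ J₀ := Set.iUnion₂_subset fun F hF => (h𝓜.prop.1 F hF).1
  have hcard : ¬ Cardinal.mk U < Cardinal.mk A := by
    intro hlt
    have h1 := hfar U hUJ hlt
    have h2 : ∃ j, ∃ x : H j, δ * ‖x‖ < ‖(T - restr 𝕜 H U * T) (inc 𝕜 H j x)‖ := by
      by_contra! h
      exact absurd (norm_le_of_columns hδ.le h) (not_le.2 h1)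
    obtain ⟨j, x, hx⟩ := h2
    have hx0 : 0 < ‖x‖ := by
      rcases (norm_nonneg x).eq_or_lt with h | h
      · rw [norm_eq_zero.1 h.symm] at hx
        simp at hx
      · exact h
    set y : H j := ((‖x‖⁻¹ : ℝ) : 𝕜) • x with hy
    have hynorm : ‖y‖ = 1 := by
      rw [hy, norm_smul, RCLike.norm_ofReal, abs_of_pos (inv_pos.2 hx0), inv_mul_cancel₀ hx0.ne']
    have hy1 : δ < ‖(T - restr 𝕜 H U * T) (inc 𝕜 H j y)‖ := by
      rw [hy, map_smul, map_smul, norm_smul, RCLike.norm_ofReal, abs_of_pos (inv_pos.2 hx0),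
        lt_inv_mul_iff₀ hx0, mul_comm]
      exact hx
    have hrw : (T - restr 𝕜 H U * T) (inc 𝕜 H j y) =
        restr 𝕜 H (Uᶜ ∩ J₀) (T (inc 𝕜 H j y)) := by
      rw [← restr_restr, hT]
      change T (inc 𝕜 H j y) - restr 𝕜 H U (T (inc 𝕜 H j y)) = _
      rw [sub_eq_iff_eq_add', restr_add_compl]
    rw [hrw] at hy1
    have h3 : ∃ F : Finset J, (F : Set J) ⊆ Uᶜ ∩ J₀ ∧
        δ < ‖restr 𝕜 H (F : Set J) (T (inc 𝕜 H j y))‖ := by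
      by_contra! h
      exact absurd (norm_restr_le_of_finset _ h) (not_le.2 hy1)
    obtain ⟨F, hFU, hF⟩ := h3
    have hdisj : ∀ G ∈ 𝓜, Disjoint F G := fun G hG => by
      rw [Finset.disjoint_left]
      intro i hiF hiG
      exact (hFU hiF).1 (Set.mem_biUnion hG hiG)
    have hmem : F ∈ 𝓜 := by
      refine h𝓜.mem_of_prop_insert ⟨?_, ?_⟩
      · rintro G (rfl | hG)
        · exact ⟨fun i hi => (hFU hi).2, j, y, hynorm.le, hF⟩
        · exact h𝓜.prop.1 G hG
      · refine h𝓜.prop.2.insert fun G hG _ => ⟨hdisj G hG, (hdisj G hG).symm⟩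
    have hFe : F = ∅ := Finset.disjoint_self_iff_empty F |>.1 (hdisj F hmem)
    have hz : restr 𝕜 H (F : Set J) (T (inc 𝕜 H j y)) = 0 := by
      ext i
      rw [restr_apply_notMem (by simp [hFe])]
      rfl
    rw [hz, norm_zero] at hF
    exact absurd hF (not_lt.2 hδ.le)
  rw [not_lt] at hcard
  have hAinf : Cardinal.aleph0 ≤ Cardinal.mk A := Cardinal.infinite_iff.1 hA.to_subtype
  have h𝓜inf : Cardinal.aleph0 ≤ Cardinal.mk 𝓜 := by
    by_contra! h
    have hfin : 𝓜.Finite := Cardinal.lt_aleph0_iff_set_finite.1 h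
    have : U.Finite := hfin.biUnion fun F _ => F.finite_toSet
    exact absurd (hAinf.trans hcard) (not_le.2 (Cardinal.lt_aleph0_iff_set_finite.2 this))
  have hUle : Cardinal.mk U ≤ Cardinal.mk 𝓜 := by
    refine (Cardinal.mk_biUnion_le (fun F : Finset J => (F : Set J)) 𝓜).trans ?_
    refine (mul_le_mul_right (ciSup_le' fun F => ?_ : _ ≤ Cardinal.aleph0) _).trans
      (Cardinal.mul_aleph0_eq h𝓜inf).le
    exact (Cardinal.lt_aleph0_of_finite _).le
  obtain ⟨f⟩ := Cardinal.le_def _ _ |>.1 (hcard.trans hUle)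
  refine ⟨fun a => (f a).1, fun a b hab => ?_, fun a => (h𝓜.prop.1 _ (f a).2).2⟩
  exact h𝓜.prop.2 (f a).2 (f b).2 fun h => hab (f.injective (Subtype.ext h))

/-- An operator which is far from its restrictions to sets of coordinates smaller than `A`
factors the projection onto `A`, provided that the summands indexed by `A` are lines. -/
theorem exists_factor_restr [∀ j, CompleteSpace (H j)] {A J₀ : Set J} (hA : A.Infinite)
    {T : lp H 1 →L[𝕜] lp H 1}
    (e : ∀ a : A, H a) (he : ∀ a, ‖e a‖ = 1) (hspan : ∀ (a : A) (x : H a), ∃ c : 𝕜, x = c • e a)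
    (hT : ∀ z, restr 𝕜 H J₀ (T z) = T z) {δ : ℝ} (hδ : 0 < δ)
    (hfar : ∀ U ⊆ J₀, Cardinal.mk U < Cardinal.mk A → δ < ‖T - restr 𝕜 H U * T‖) :
    ∃ R B : lp H 1 →L[𝕜] lp H 1, R * T * B = restr 𝕜 H A ∧ ‖R‖ ≤ 2 * δ⁻¹ ∧ ‖B‖ ≤ 1 := by
  have := hA.to_subtype
  obtain ⟨F, hFd, hF⟩ := exists_disjoint_large_blocks hA hT hδ hfar
  choose j x hx hFx using hF
  let μ : A → Set A → ℝ := fun a S => ‖restr 𝕜 H (⋃ b ∈ S, (F b : Set J)) (T (inc 𝕜 H (j a) (x a)))‖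
  have hTx : ∀ a, ‖T (inc 𝕜 H (j a) (x a))‖ ≤ ‖T‖ := fun a =>
    T.unit_le_opNorm _ (by simpa using hx a)
  obtain ⟨g, hg, hgδ⟩ := exists_injective_small_off_diagonal μ (fun _ _ => norm_nonneg _)
    (fun a S S' hS => by
      change _ ≤ ‖restr 𝕜 H (⋃ b ∈ S ∪ S', (F b : Set J)) _‖
      rw [Set.biUnion_union, norm_restr_union]
      rw [Set.disjoint_left]
      intro i hi hi'
      obtain ⟨b, hb, hib⟩ := Set.mem_iUnion₂.1 hi
      obtain ⟨b', hb', hib'⟩ := Set.mem_iUnion₂.1 hi'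
      have : b ≠ b' := fun h => Set.disjoint_left.1 hS hb (h ▸ hb')
      exact Finset.disjoint_left.1 (hFd b b' this) hib hib')
    (M := ‖T‖) (fun a S => (norm_restr_apply_le _ _).trans (hTx a)) (half_pos hδ)
  set y : A → lp H 1 := fun a => T (inc 𝕜 H (j (g a)) (x (g a))) with hy
  set G : A → Set J := fun a => (F (g a) : Set J) with hG
  have hGd : ∀ a b i, i ∈ G a → i ∈ G b → a = b := fun a b i ha hb => by
    by_contra hab
    exact Finset.disjoint_left.1 (hFd _ _ (hg.ne hab)) ha hb
  have hyG : ∀ a, δ < ‖restr 𝕜 H (G a) (y a)‖ := fun a => hFx (g a)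
  have hyoff : ∀ a, ‖restr 𝕜 H (⋃ b ∈ ({a}ᶜ : Set A), G b) (y a)‖ ≤ δ / 2 := fun a => by
    have h := hgδ a
    simp only [μ] at h
    rwa [Set.biUnion_image] at h
  choose f hf1 hf using fun a => exists_dual_vector'' 𝕜 (restr 𝕜 H (G a) (y a))
  choose c hc1 hc using fun a => exists_dual_vector 𝕜 (e a) (by
    intro h; simpa [h] using he a)
  have hcx : ∀ (a : A) (v : H a), v = c a v • e a := fun a v => by
    obtain ⟨t, rfl⟩ := hspan a v
    simp [hc, he]
  set t : A → ℝ := fun a => ‖restr 𝕜 H (G a) (y a)‖ with ht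
  have ht0 : ∀ a, 0 < t a := fun a => hδ.trans (hyG a)
  obtain ⟨R, hR, hRin, hRout⟩ := exists_glue_restr (𝕜 := 𝕜) (H := H) (Y := lp H 1)
    (inv_nonneg.2 hδ.le) G hGd
    (fun a => ((((t a)⁻¹ : ℝ) : 𝕜) • f a).smulRight (inc 𝕜 H a (e a))) (fun a => by
      rw [ContinuousLinearMap.norm_smulRight_apply, norm_inc_apply, he, mul_one, norm_smul,
        RCLike.norm_ofReal, abs_of_pos (inv_pos.2 (ht0 a))]
      exact (mul_le_of_le_one_right (inv_nonneg.2 (ht0 a).le) (hf1 a)).trans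
        (inv_anti₀ hδ (hyG a).le))
  obtain ⟨B, hB, hBin, hBout⟩ := exists_inj (𝕜 := 𝕜) (H := H) (Y := lp H 1) zero_le_one
    (Subtype.val : A → J) Subtype.val_injective
    (fun a => (c a).smulRight (inc 𝕜 H (j (g a)) (x (g a)))) (fun a => by
      rw [ContinuousLinearMap.norm_smulRight_apply, norm_inc_apply, hc1, one_mul]
      exact hx _)
  have hRy : ∀ a, ‖R (y a) - inc 𝕜 H a (e a)‖ ≤ 1 / 2 := fun a => by
    have hdec : y a = restr 𝕜 H (G a) (y a) + restr 𝕜 H (⋃ b ∈ ({a}ᶜ : Set A), G b) (y a) +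
        restr 𝕜 H (⋃ b, G b)ᶜ (y a) := by
      rw [← restr_union]
      · rw [show G a ∪ ⋃ b ∈ ({a}ᶜ : Set A), G b = ⋃ b, G b from ?_, restr_add_compl]
        ext i
        simp only [Set.mem_union, Set.mem_iUnion, Set.mem_compl_iff, Set.mem_singleton_iff,
          exists_prop]
        constructor
        · rintro (h | ⟨b, -, h⟩)
          exacts [⟨a, h⟩, ⟨b, h⟩]
        · rintro ⟨b, h⟩
          by_cases hb : b = a
          · exact Or.inl (hb ▸ h)
          · exact Or.inr ⟨b, hb, h⟩
      · rw [Set.disjoint_left]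
        intro i hi hi'
        obtain ⟨b, hb, hib⟩ := Set.mem_iUnion₂.1 hi'
        exact hb (hGd _ _ i hib hi)
    have h1 : R (restr 𝕜 H (G a) (y a)) = inc 𝕜 H a (e a) := by
      rw [hRin, ContinuousLinearMap.smulRight_apply, smul_apply, hf,
        smul_eq_mul, ← RCLike.ofReal_mul, inv_mul_cancel₀ (ht0 a).ne', RCLike.ofReal_one, one_smul]
    rw [hdec, map_add, map_add, h1, hRout, add_zero, add_sub_cancel_left]
    refine (R.le_of_opNorm_le hR _).trans ?_
    calc δ⁻¹ * _ ≤ δ⁻¹ * (δ / 2) := by gcongr; exact hyoff a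
      _ = 1 / 2 := by field_simp
  have hW : ‖(R * T * B + restr 𝕜 H Aᶜ) - 1‖ ≤ 1 / 2 := by
    refine norm_le_of_columns (by norm_num) fun i v => ?_
    by_cases hi : i ∈ A
    · have hBv := hBin ⟨i, hi⟩ v
      have h1 : ((R * T * B + restr 𝕜 H Aᶜ) - 1) (inc 𝕜 H i v) =
          c ⟨i, hi⟩ v • (R (y ⟨i, hi⟩) - inc 𝕜 H i (e ⟨i, hi⟩)) := by
        change R (T (B (inc 𝕜 H i v))) + restr 𝕜 H Aᶜ (inc 𝕜 H i v) - inc 𝕜 H i v = _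
        rw [restr_inc_notMem (by simpa using hi), hBv, add_zero, smul_sub]
        have hv : inc 𝕜 H i v = c ⟨i, hi⟩ v • inc 𝕜 H i (e ⟨i, hi⟩) :=
          (congrArg (inc 𝕜 H i) (hcx ⟨i, hi⟩ v)).trans (map_smul _ _ _)
        rw [← hv, ContinuousLinearMap.smulRight_apply, map_smul, map_smul]
      rw [h1, norm_smul, mul_comm]
      refine mul_le_mul (hRy ⟨i, hi⟩) ?_ (norm_nonneg _) (by norm_num)
      exact ((c ⟨i, hi⟩).le_opNorm v).trans (by rw [hc1, one_mul])
    · have h1 : ((R * T * B + restr 𝕜 H Aᶜ) - 1) (inc 𝕜 H i v) = 0 := by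
        change R (T (B (inc 𝕜 H i v))) + restr 𝕜 H Aᶜ (inc 𝕜 H i v) - inc 𝕜 H i v = _
        rw [restr_inc_mem (by simpa using hi), hBout i (by simpa using hi)]
        simp
      rw [h1, norm_zero]
      positivity
  obtain ⟨V, hV, hVn⟩ := exists_inverse_of_norm_sub_one_le ContinuousLinearMap.norm_id_le hW
  refine ⟨V * R, B, ?_, ?_, hB⟩
  · have h1 : (R * T * B + restr 𝕜 H Aᶜ) * restr 𝕜 H A = R * T * B := by
      refine clm_ext fun i v => ?_
      change R (T (B (restr 𝕜 H A (inc 𝕜 H i v)))) +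
        restr 𝕜 H Aᶜ (restr 𝕜 H A (inc 𝕜 H i v)) = R (T (B (inc 𝕜 H i v)))
      by_cases hi : i ∈ A
      · rw [restr_inc_mem hi, restr_inc_notMem (by simpa using hi), add_zero]
      · rw [restr_inc_notMem hi, hBout i (by simpa using hi)]
        simp
    calc V * R * T * B = V * (R * T * B) := by simp only [mul_assoc]
      _ = restr 𝕜 H A := by rw [← h1, ← mul_assoc, hV, one_mul]
  · exact (norm_mul_le _ _).trans (mul_le_mul hVn hR (norm_nonneg _) zero_le_two)

end L1Sum

namespace L1Sum

section Hilbert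

variable {𝕜 : Type*} [RCLike 𝕜] {F : Type*} [NormedAddCommGroup F] [InnerProductSpace 𝕜 F]

open scoped InnerProductSpace

theorem norm_sq_add_norm_inner_sq_le {G G' : Submodule 𝕜 F} [G.HasOrthogonalProjection]
    [G'.HasOrthogonalProjection] (hG : G ≤ G') {u : F} (hu : u ∈ Gᗮ) (hu' : u ∈ G')
    (hu1 : ‖u‖ ≤ 1) (y : F) :
    ‖G.starProjection y‖ ^ 2 + ‖⟪u, y⟫_𝕜‖ ^ 2 ≤ ‖G'.starProjection y‖ ^ 2 := by
  set p := G'.starProjection y with hp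
  have h1 : G.starProjection y = G.starProjection p := by
    rw [hp, ← ContinuousLinearMap.comp_apply,
      Submodule.starProjection_comp_starProjection_of_le hG]
  have h2 : ⟪u, y⟫_𝕜 = ⟪u, Gᗮ.starProjection p⟫_𝕜 := by
    rw [← Submodule.inner_starProjection_left_eq_right, Submodule.starProjection_eq_self_iff.2 hu,
      hp, ← Submodule.inner_starProjection_left_eq_right,
      Submodule.starProjection_eq_self_iff.2 hu']
  rw [Submodule.norm_sq_eq_add_norm_sq_starProjection p G, h1, h2]
  have h3 : ‖⟪u, Gᗮ.starProjection p⟫_𝕜‖ ≤ ‖Gᗮ.starProjection p‖ :=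
    (norm_inner_le_norm _ _).trans (mul_le_of_le_one_left (norm_nonneg _) hu1)
  gcongr

end Hilbert

section Trace

variable {𝕜 : Type*} [RCLike 𝕜] {J : Type*} {H : J → Type*}
  [∀ j, NormedAddCommGroup (H j)] [∀ j, InnerProductSpace 𝕜 (H j)]
  [∀ j, FiniteDimensional 𝕜 (H j)]
  {E : Type*} [NormedAddCommGroup E] [InnerProductSpace 𝕜 E] [FiniteDimensional 𝕜 E]

open scoped InnerProductSpace

/-- The space of `j`-th coordinates of the image of a subspace under an operator. -/
noncomputable def coord (K : E →L[𝕜] lp H 1) (V : Submodule 𝕜 E) (j : J) : Submodule 𝕜 (H j) :=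
  V.map ((lp.evalCLM 𝕜 H 1 j).comp K : E →ₗ[𝕜] H j)

omit [∀ j, FiniteDimensional 𝕜 (H j)] [FiniteDimensional 𝕜 E] in
theorem mem_coord (K : E →L[𝕜] lp H 1) {V : Submodule 𝕜 E} (j : J) {v : E} (hv : v ∈ V) :
    K v j ∈ coord K V j := ⟨v, hv, rfl⟩

theorem exists_unit_orthogonal (K : E →L[𝕜] lp H 1) {δ : ℝ} (hδ : 0 ≤ δ) {V : Submodule 𝕜 E}
    {x : E} (hx : ‖x‖ ≤ 1) (hxδ : δ < ∑' j, ‖(coord K V j)ᗮ.starProjection (K x j)‖) :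
    ∃ w ∈ Vᗮ, ‖w‖ = 1 ∧ δ < ∑' j, ‖(coord K V j)ᗮ.starProjection (K w j)‖ := by
  set w := Vᗮ.starProjection x with hw
  have hwx : ∀ j, (coord K V j)ᗮ.starProjection (K x j) =
      (coord K V j)ᗮ.starProjection (K w j) := fun j => by
    have h1 : K x j = K w j + K (V.starProjection x) j := by
      rw [← Pi.add_apply, ← lp.coeFn_add, ← map_add, hw, add_comm,
        Submodule.starProjection_add_starProjection_orthogonal]
    have h2 : (coord K V j)ᗮ.starProjection (K (V.starProjection x) j) = 0 := by
      rw [Submodule.starProjection_apply_eq_zero_iff, Submodule.orthogonal_orthogonal]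
      exact mem_coord K j (Submodule.starProjection_apply_mem _ _)
    rw [h1, map_add, h2, add_zero]
  simp only [hwx] at hxδ
  have hw1 : ‖w‖ ≤ 1 := (Submodule.norm_starProjection_apply_le _ _).trans hx
  have hw0 : w ≠ 0 := fun h => by
    simp [h] at hxδ
    linarith
  have hwn : 0 < ‖w‖ := norm_pos_iff.2 hw0
  refine ⟨((‖w‖⁻¹ : ℝ) : 𝕜) • w, Submodule.smul_mem _ _ (Submodule.starProjection_apply_mem _ _),
    by rw [norm_smul, RCLike.norm_ofReal, abs_of_pos (inv_pos.2 hwn), inv_mul_cancel₀ hwn.ne'],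
    hxδ.trans_le ?_⟩
  have : ∀ j, ‖(coord K V j)ᗮ.starProjection (K (((‖w‖⁻¹ : ℝ) : 𝕜) • w) j)‖ =
      ‖w‖⁻¹ * ‖(coord K V j)ᗮ.starProjection (K w j)‖ := fun j => by
    rw [map_smul, lp.coeFn_smul, Pi.smul_apply, map_smul, norm_smul, RCLike.norm_ofReal,
      abs_of_pos (inv_pos.2 hwn)]
  simp only [this]
  rw [tsum_mul_left]
  exact le_mul_of_one_le_left (tsum_nonneg fun _ => norm_nonneg _) ((one_le_inv₀ hwn).2 hw1)

theorem exists_functional (z : lp H 1) (G : ∀ j, Submodule 𝕜 (H j)) :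
    ∃ (u : ∀ j, H j) (g : lp H 1 →L[𝕜] 𝕜), (∀ j, ‖u j‖ ≤ 1) ∧ (∀ j, u j ∈ (G j)ᗮ) ∧
      (∀ j, ∃ c : 𝕜, u j = c • (G j)ᗮ.starProjection (z j)) ∧
      (∀ j y, g (inc 𝕜 H j y) = ⟪u j, y⟫_𝕜) ∧
      g z = ((∑' j, ‖(G j)ᗮ.starProjection (z j)‖ : ℝ) : 𝕜) := by
  set c : ∀ j, H j := fun j => (G j)ᗮ.starProjection (z j) with hc
  let u : ∀ j, H j := fun j => ((‖c j‖⁻¹ : ℝ) : 𝕜) • c j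
  have hu : ∀ j, ‖u j‖ ≤ 1 := fun j => by
    simp only [u]
    rw [norm_smul, RCLike.norm_ofReal, abs_of_nonneg (by positivity)]
    exact inv_mul_le_one
  have humem : ∀ j, u j ∈ (G j)ᗮ := fun j =>
    Submodule.smul_mem _ _ (Submodule.starProjection_apply_mem _ _)
  obtain ⟨g, -, hg⟩ := exists_colMap (𝕜 := 𝕜) (H := H) (Y := 𝕜) zero_le_one
    (fun j => innerSL 𝕜 (u j)) (fun j => by simpa using hu j)
  refine ⟨u, g, hu, humem, fun j => ⟨_, rfl⟩, fun j y => by simp [hg], ?_⟩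
  have h1 := g.hasSum (hasSum_inc 𝕜 z)
  have h2 : ∀ j, g (inc 𝕜 H j (z j)) = ((‖c j‖ : ℝ) : 𝕜) := fun j => by
    rw [hg, innerSL_apply_apply, ← Submodule.starProjection_eq_self_iff.2 (humem j),
      Submodule.inner_starProjection_left_eq_right]
    change ⟪((‖c j‖⁻¹ : ℝ) : 𝕜) • c j, c j⟫_𝕜 = _
    rw [inner_smul_left, inner_self_eq_norm_sq_to_K, RCLike.conj_ofReal]
    norm_cast
    rcases eq_or_ne ‖c j‖ 0 with h | h
    · simp [h]
    · field_simp
  simp only [h2] at h1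
  rw [RCLike.ofReal_tsum]
  exact h1.tsum_eq.symm

theorem exists_trace_large (K : E →L[𝕜] lp H 1) {δ : ℝ} (hδ : 0 ≤ δ) {k : ℕ}
    (hfar : ∀ V : Submodule 𝕜 E, Module.finrank 𝕜 V < k →
      ∃ x, ‖x‖ ≤ 1 ∧ δ < ∑' j, ‖(coord K V j)ᗮ.starProjection (K x j)‖) :
    ∀ l ≤ k, ∃ (V : Submodule 𝕜 E) (R : lp H 1 →L[𝕜] E), Module.finrank 𝕜 V ≤ l ∧
      (∀ z, R z ∈ V) ∧
      (∀ j y, ‖R (inc 𝕜 H j y)‖ ≤ ‖(coord K V j).starProjection y‖) ∧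
      δ * l ≤ RCLike.re (LinearMap.trace 𝕜 E (R.comp K : E →ₗ[𝕜] E)) := by
  intro l
  induction l with
  | zero => exact fun _ => ⟨⊥, 0, by simp, by simp, by simp, by simp⟩
  | succ l ih =>
    intro hl
    obtain ⟨V, R, hV, hRV, hRn, hRt⟩ := ih (by omega)
    obtain ⟨x, hx, hxδ⟩ := hfar V (by omega)
    obtain ⟨w, hwV, hw1, hwδ⟩ := exists_unit_orthogonal K hδ hx hxδ
    obtain ⟨u, g, hu1, huG, huc, hg, hgw⟩ := exists_functional (K w) (coord K V)
    have hVV : V ≤ V ⊔ Submodule.span 𝕜 {w} := le_sup_left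
    have hwV' : w ∈ V ⊔ Submodule.span 𝕜 {w} :=
      le_sup_right (a := V) (Submodule.mem_span_singleton_self w)
    refine ⟨V ⊔ Submodule.span 𝕜 {w}, R + g.smulRight w, ?_, fun z => ?_, fun j y => ?_, ?_⟩
    · exact (Submodule.finrank_add_le_finrank_add_finrank _ _).trans
        (add_le_add hV (finrank_span_singleton fun h => by simp [h] at hw1).le)
    · exact Submodule.add_mem _ (hVV (hRV z)) (Submodule.smul_mem _ _ hwV')
    · have hGG : coord K V j ≤ coord K (V ⊔ Submodule.span 𝕜 {w}) j := Submodule.map_mono hVV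
      have hu' : u j ∈ coord K (V ⊔ Submodule.span 𝕜 {w}) j := by
        obtain ⟨c, hc⟩ := huc j
        rw [hc, Submodule.starProjection_orthogonal_val]
        exact Submodule.smul_mem _ _ (Submodule.sub_mem _ (mem_coord K j hwV')
          (hGG (Submodule.starProjection_apply_mem _ _)))
      refine le_of_sq_le_sq ?_ (norm_nonneg _)
      refine le_trans ?_ (norm_sq_add_norm_inner_sq_le hGG (huG j) hu' (hu1 j) y)
      have horth : ⟪R (inc 𝕜 H j y), ⟪u j, y⟫_𝕜 • w⟫_𝕜 = 0 := by
        rw [inner_smul_right, (Submodule.mem_orthogonal V w).1 hwV _ (hRV _), mul_zero]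
      have h1 : (R + g.smulRight w) (inc 𝕜 H j y) = R (inc 𝕜 H j y) + ⟪u j, y⟫_𝕜 • w := by
        simp [hg]
      rw [h1, sq, norm_add_sq_eq_norm_sq_add_norm_sq_of_inner_eq_zero _ _ horth, norm_smul, hw1,
        mul_one, ← sq, ← sq]
      have := hRn j y
      gcongr
    · have h1 : ((R + g.smulRight w).comp K : E →ₗ[𝕜] E) =
          (R.comp K : E →ₗ[𝕜] E) + ((g.comp K : E →L[𝕜] 𝕜) : E →ₗ[𝕜] 𝕜).smulRight w := by
        ext x
        simp
      have h2 : ((g.comp K : E →L[𝕜] 𝕜) : E →ₗ[𝕜] 𝕜) w = _ := hgw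
      rw [h1, map_add, LinearMap.trace_smulRight, h2, map_add, RCLike.ofReal_re]
      rw [Nat.cast_succ, mul_add, mul_one]
      exact add_le_add hRt hwδ.le

end Trace

end L1Sum

namespace L1Sum

section FiniteDimensional

variable {𝕜 : Type*} [RCLike 𝕜]
  {E : Type*} [NormedAddCommGroup E] [InnerProductSpace 𝕜 E] [FiniteDimensional 𝕜 E]

open scoped InnerProductSpace

theorem exists_subspace_norm_ge {M : E →ₗ[𝕜] E} {t : ℝ} (hM : ∀ x, ‖M x‖ ≤ t * ‖x‖)
    {V : Submodule 𝕜 E} (hV : ∀ x, M x ∈ V) {k : ℕ} (hk : Module.finrank 𝕜 V ≤ k) {δ : ℝ}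
    (hδ : 0 < δ) (htr : δ * k ≤ RCLike.re (LinearMap.trace 𝕜 E M)) :
    ∃ W : Submodule 𝕜 E, δ * k ≤ 2 * t * Module.finrank 𝕜 W ∧
      ∀ w ∈ W, δ / 2 * ‖w‖ ≤ ‖M w‖ := by
  classical
  have hS := M.isSymmetric_adjoint_mul_self
  set b := hS.eigenvectorBasis rfl with hb
  set ev := hS.eigenvalues rfl with hev
  have hSb : ∀ i, (LinearMap.adjoint M * M) (b i) = (ev i : 𝕜) • b i := fun i =>
    hS.apply_eigenvectorBasis rfl i
  have hMM : ∀ i x, ⟪M (b i), M x⟫_𝕜 = (ev i : 𝕜) * ⟪b i, x⟫_𝕜 := fun i x => by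
    rw [← LinearMap.adjoint_inner_left, ← Module.End.mul_apply, hSb, inner_smul_left,
      RCLike.conj_ofReal]
  have hevn : ∀ i, ev i = ‖M (b i)‖ ^ 2 := fun i => by
    have h := hMM i (b i)
    rw [inner_self_eq_norm_sq_to_K, inner_self_eq_norm_sq_to_K, b.norm_eq_one] at h
    have h' : ((‖M (b i)‖ ^ 2 : ℝ) : 𝕜) = ((ev i : ℝ) : 𝕜) := by push_cast; simpa using h
    exact (RCLike.ofReal_injective h').symm
  let I : Finset (Fin (Module.finrank 𝕜 E)) := {i | δ / 2 < ‖M (b i)‖}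
  let N : Finset (Fin (Module.finrank 𝕜 E)) := {i | M (b i) ≠ 0}
  have hN : N.card ≤ k := by
    have hli : LinearIndependent 𝕜 fun i : N => M (b i) :=
      linearIndependent_of_ne_zero_of_inner_eq_zero (fun i => (Finset.mem_filter.1 i.2).2)
        fun i j hij => by
          change ⟪M (b i), M (b j)⟫_𝕜 = 0
          rw [hMM, b.inner_eq_zero (fun h => hij (Subtype.ext h)), mul_zero]
    have hli' : LinearIndependent 𝕜 fun i : N => (⟨M (b i), hV _⟩ : V) :=
      LinearIndependent.of_comp V.subtype hli
    simpa using hli'.fintype_card_le_finrank.trans hk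
  have hsum : δ * k ≤ ∑ i, ‖M (b i)‖ := by
    refine htr.trans ?_
    rw [LinearMap.trace_eq_sum_inner M b, map_sum]
    refine Finset.sum_le_sum fun i _ => (RCLike.re_le_norm _).trans ?_
    simpa using norm_inner_le_norm (𝕜 := 𝕜) (b i) (M (b i))
  have hsum2 : ∑ i, ‖M (b i)‖ ≤ t * I.card + δ / 2 * k := by
    calc ∑ i, ‖M (b i)‖ ≤ ∑ i, ((if i ∈ I then t else 0) + if i ∈ N then δ / 2 else 0) := by
          refine Finset.sum_le_sum fun i _ => ?_
          have h1 : ‖M (b i)‖ ≤ t := by simpa using hM (b i)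
          by_cases hi : i ∈ I
          · rw [if_pos hi]
            have : (0 : ℝ) ≤ if i ∈ N then δ / 2 else 0 := by split_ifs <;> positivity
            linarith
          · rw [if_neg hi, zero_add]
            by_cases hi' : i ∈ N
            · rw [if_pos hi']
              simpa [I] using hi
            · rw [if_neg hi']
              simp only [N, Finset.mem_filter, Finset.mem_univ, true_and, not_not] at hi'
              simp [hi']
      _ = t * I.card + δ / 2 * N.card := by
          rw [Finset.sum_add_distrib, Finset.sum_ite_mem, Finset.sum_ite_mem]
          simp [mul_comm]
      _ ≤ _ := by gcongr
  refine ⟨Submodule.span 𝕜 (Set.range fun i : I => b i), ?_, fun w hw => ?_⟩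
  · have : LinearIndependent 𝕜 fun i : I => b i :=
      b.orthonormal.linearIndependent.comp (Subtype.val : I → _) Subtype.val_injective
    rw [finrank_span_eq_card this, Fintype.card_coe]
    linarith
  · have hw0 : ∀ i ∉ I, ⟪b i, w⟫_𝕜 = 0 := fun i hi => by
      induction hw using Submodule.span_induction with
      | mem x hx =>
        obtain ⟨j, rfl⟩ := hx
        exact b.inner_eq_zero fun h => hi (h ▸ j.2)
      | zero => simp
      | add x y _ _ hx hy => rw [inner_add_right, hx, hy, add_zero]
      | smul c x _ hx => rw [inner_smul_right, hx, mul_zero]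
    have h1 : ‖M w‖ ^ 2 = ∑ i, ev i * ‖⟪b i, w⟫_𝕜‖ ^ 2 := by
      have h2 : ⟪M w, M w⟫_𝕜 = ∑ i, (ev i : 𝕜) * (⟪w, b i⟫_𝕜 * ⟪b i, w⟫_𝕜) := by
        have h4 : M w = ∑ i, ⟪b i, w⟫_𝕜 • M (b i) := by
          conv_lhs => rw [← b.sum_repr' w, map_sum]
          simp only [map_smul]
        conv_lhs => rw [h4, sum_inner, ← h4]
        refine Finset.sum_congr rfl fun i _ => ?_
        rw [inner_smul_left, hMM, inner_conj_symm]
        ring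
      have h3 : ((‖M w‖ ^ 2 : ℝ) : 𝕜) = ((∑ i, ev i * ‖⟪b i, w⟫_𝕜‖ ^ 2 : ℝ) : 𝕜) := by
        push_cast
        rw [← inner_self_eq_norm_sq_to_K, h2]
        refine Finset.sum_congr rfl fun i _ => ?_
        rw [← inner_conj_symm, RCLike.conj_mul]
      exact RCLike.ofReal_injective h3
    refine le_of_sq_le_sq ?_ (norm_nonneg _)
    rw [h1, mul_pow, ← b.sum_sq_norm_inner_right w, Finset.mul_sum]
    refine Finset.sum_le_sum fun i _ => ?_
    by_cases hi : i ∈ I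
    · rw [hevn]
      have : δ / 2 ≤ ‖M (b i)‖ := (Finset.mem_filter.1 hi).2.le
      gcongr
    · simp [hw0 i hi]

theorem exists_left_inverse {F : Type*} [NormedAddCommGroup F] [NormedSpace 𝕜 F]
    (f : F →ₗ[𝕜] E) {c : ℝ} (hc : 0 < c) (hf : ∀ x, c * ‖x‖ ≤ ‖f x‖) :
    ∃ A : E →L[𝕜] F, (∀ x, A (f x) = x) ∧ ‖A‖ ≤ c⁻¹ := by
  have hinj : Function.Injective f := by
    rw [injective_iff_map_eq_zero]
    intro x hx
    have := hf x
    rw [hx, norm_zero] at this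
    exact norm_le_zero_iff.1 (nonpos_of_mul_nonpos_right this hc)
  let e := LinearEquiv.ofInjective f hinj
  let A : E →ₗ[𝕜] F := e.symm.toLinearMap ∘ₗ (f.range.orthogonalProjectionOnto : E →ₗ[𝕜] f.range)
  have hA : ∀ y, ‖A y‖ ≤ c⁻¹ * ‖y‖ := fun y => by
    rw [le_inv_mul_iff₀ hc]
    refine (hf _).trans ?_
    have h1 : f (A y) = f.range.orthogonalProjectionOnto y :=
      congrArg Subtype.val (e.apply_symm_apply (f.range.orthogonalProjectionOnto y))
    rw [h1]
    exact Submodule.norm_orthogonalProjectionOnto_apply_le _ _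
  refine ⟨A.mkContinuous c⁻¹ hA, fun x => ?_,
    LinearMap.mkContinuous_norm_le _ (inv_nonneg.2 hc.le) _⟩
  change e.symm (f.range.orthogonalProjectionOnto (f x)) = x
  rw [LinearEquiv.symm_apply_eq]
  exact Submodule.orthogonalProjectionOnto_mem_subspace_eq_self (e x)

theorem exists_isometry_into {W : Submodule 𝕜 E} {i : ℕ} (hi : i ≤ Module.finrank 𝕜 W) :
    ∃ f : EuclideanSpace 𝕜 (Fin i) →ₗᵢ[𝕜] E, ∀ x, f x ∈ W := by
  let b := stdOrthonormalBasis 𝕜 W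
  have hv : Orthonormal 𝕜 fun l : Fin i => b (Fin.castLE hi l) :=
    b.orthonormal.comp _ (Fin.castLE_injective hi)
  let e := EuclideanSpace.basisFun (Fin i) 𝕜
  let g : EuclideanSpace 𝕜 (Fin i) →ₗ[𝕜] W :=
    e.toBasis.constr 𝕜 fun l : Fin i => b (Fin.castLE hi l)
  have hg : Orthonormal 𝕜 (g ∘ e.toBasis) := by
    have : g ∘ e.toBasis = fun l : Fin i => b (Fin.castLE hi l) := by
      ext1 l
      exact Module.Basis.constr_basis _ _ _ _
    rwa [this]
  exact ⟨W.subtypeₗᵢ.comp (g.isometryOfOrthonormal (by simp) hg),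
    fun x => (g x).2⟩

theorem exists_le_forall_eq_zero {F : Type*} [AddCommGroup F] [Module 𝕜 F]
    [FiniteDimensional 𝕜 F] (L : E →ₗ[𝕜] F) (W : Submodule 𝕜 E) :
    ∃ W' ≤ W, (∀ w ∈ W', L w = 0) ∧
      Module.finrank 𝕜 W ≤ Module.finrank 𝕜 W' + Module.finrank 𝕜 F := by
  refine ⟨(L.domRestrict W).ker.map W.subtype, Submodule.map_subtype_le _ _, ?_, ?_⟩
  · rintro _ ⟨w, hw, rfl⟩
    exact hw
  · rw [Submodule.finrank_map_subtype_eq, ← (L.domRestrict W).finrank_range_add_finrank_ker,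
      add_comm]
    gcongr
    exact Submodule.finrank_le _

end FiniteDimensional

section Local

variable {𝕜 : Type*} [RCLike 𝕜] {J : Type*} {H : J → Type*}
  [∀ j, NormedAddCommGroup (H j)] [∀ j, InnerProductSpace 𝕜 (H j)]
  [∀ j, FiniteDimensional 𝕜 (H j)]

theorem exists_local_factor {T : lp H 1 →L[𝕜] lp H 1} {δ : ℝ} (hδ : 0 < δ)
    (hfar : ∀ k : ℕ, ∃ j, ∀ V : Submodule 𝕜 (H j), Module.finrank 𝕜 V < k → ∃ x, ‖x‖ ≤ 1 ∧
      δ < ∑' m, ‖(coord (T.comp (inc 𝕜 H j)) V m)ᗮ.starProjection (T (inc 𝕜 H j x) m)‖)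
    (i : ℕ) (U : Finset J) :
    ∃ (A : lp H 1 →L[𝕜] EuclideanSpace 𝕜 (Fin i)) (B : EuclideanSpace 𝕜 (Fin i) →L[𝕜] lp H 1),
      ‖A‖ ≤ 2 / δ ∧ ‖B‖ ≤ 1 ∧ (∀ x, A (T (B x)) = x) ∧
      ∀ x, restr 𝕜 H (U : Set J) (T (B x)) = 0 := by
  set D := Module.finrank 𝕜 (∀ m : U, H m) with hD
  set t := ‖T‖ + 1 with ht
  have ht0 : 0 < t := by positivity
  obtain ⟨k, hk⟩ := exists_nat_ge (2 * t * ((i + D : ℕ) : ℝ) / δ)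
  rw [div_le_iff₀' hδ] at hk
  obtain ⟨j, hj⟩ := hfar k
  set K := T.comp (inc 𝕜 H j) with hK
  obtain ⟨V, R, hVk, hRV, hRn, htr⟩ := exists_trace_large K hδ.le hj k le_rfl
  have hR : ‖R‖ ≤ 1 := norm_le_of_columns zero_le_one fun m y => by
    rw [one_mul]
    exact (hRn m y).trans (Submodule.norm_starProjection_apply_le _ _)
  have hKn : ∀ x, ‖K x‖ ≤ t * ‖x‖ := fun x => by
    have h := T.le_opNorm (inc 𝕜 H j x)
    rw [norm_inc_apply] at h
    refine h.trans ?_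
    gcongr
    simp [ht]
  obtain ⟨W, hWf, hW⟩ := exists_subspace_norm_ge (M := (R.comp K : H j →ₗ[𝕜] H j)) (t := t)
    (fun x => (R.le_of_opNorm_le hR (K x)).trans (by rw [one_mul]; exact hKn x))
    (fun x => hRV (K x)) hVk hδ htr
  obtain ⟨W', hW'W, hW'0, hW'f⟩ := exists_le_forall_eq_zero
    (LinearMap.pi fun m : U => ((lp.evalCLM 𝕜 H 1 m).comp K : H j →ₗ[𝕜] H m)) W
  have hiW : i ≤ Module.finrank 𝕜 W' := by
    have h := le_of_mul_le_mul_left (hk.trans hWf) (by positivity)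
    have h' : i + D ≤ Module.finrank 𝕜 W := by exact_mod_cast h
    omega
  obtain ⟨f, hf⟩ := exists_isometry_into hiW
  obtain ⟨A, hA, hAn⟩ := exists_left_inverse
    ((R.comp K : H j →ₗ[𝕜] H j).comp f.toLinearMap) (c := δ / 2) (by positivity) fun x => by
      simpa using hW (f x) (hW'W (hf x))
  refine ⟨A.comp R, (inc 𝕜 H j).comp f.toContinuousLinearMap, ?_, ?_, fun x => hA x, fun x => ?_⟩
  · rw [inv_div] at hAn
    exact (A.opNorm_comp_le R).trans ((mul_le_of_le_one_right (norm_nonneg _) hR).trans hAn)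
  · exact ContinuousLinearMap.opNorm_le_bound _ zero_le_one fun x => by simp
  · ext m
    by_cases hm : m ∈ (U : Set J)
    · rw [restr_apply_mem hm]
      exact congrFun (hW'0 (f x) (hf x)) ⟨m, hm⟩
    · rw [restr_apply_notMem hm]
      rfl

omit [∀ j, FiniteDimensional 𝕜 (H j)] in
theorem exists_finset_tail_le {i : ℕ} (f : EuclideanSpace 𝕜 (Fin i) →L[𝕜] lp H 1) {η : ℝ}
    (hη : 0 < η) : ∃ F : Finset J, ∀ F' : Finset J, F ⊆ F' →
      ∀ x, ‖restr 𝕜 H (F' : Set J)ᶜ (f x)‖ ≤ η * ‖x‖ := by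
  classical
  have hη' : 0 < η / (i + 1) := by positivity
  choose F hF using fun l : Fin i =>
    exists_finset_norm_restr_compl_lt (𝕜 := 𝕜) (f (EuclideanSpace.basisFun (Fin i) 𝕜 l)) hη'
  refine ⟨Finset.univ.biUnion F, fun F' hF' x => ?_⟩
  have hx : restr 𝕜 H (F' : Set J)ᶜ (f x) = ∑ l, x l •
      restr 𝕜 H (F' : Set J)ᶜ (f (EuclideanSpace.basisFun (Fin i) 𝕜 l)) := by
    conv_lhs => rw [← (EuclideanSpace.basisFun (Fin i) 𝕜).sum_repr x]
    simp only [map_sum, map_smul, EuclideanSpace.basisFun_repr]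
  calc _ ≤ ∑ l : Fin i, ‖x‖ * (η / (i + 1)) := by
        rw [hx]
        refine norm_sum_le_of_le _ fun l _ => ?_
        rw [norm_smul]
        gcongr
        · exact EuclideanSpace.norm_eq x ▸ PiLp.norm_apply_le x l
        · exact (hF l F' ((Finset.subset_biUnion_of_mem F (Finset.mem_univ l)).trans hF')).le
    _ ≤ _ := by
        rw [Finset.sum_const, Finset.card_univ, Fintype.card_fin, nsmul_eq_mul]
        have : (i : ℝ) * (η / (i + 1)) ≤ η := by
          rw [mul_div_assoc', div_le_iff₀ (by positivity)]
          nlinarith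
        calc (i : ℝ) * (‖x‖ * (η / (i + 1))) = (i : ℝ) * (η / (i + 1)) * ‖x‖ := by ring
          _ ≤ _ := by gcongr

theorem exists_factor_of_far {T : lp H 1 →L[𝕜] lp H 1} {δ : ℝ} (hδ : 0 < δ)
    (hfar : ∀ k : ℕ, ∃ j, ∀ V : Submodule 𝕜 (H j), Module.finrank 𝕜 V < k → ∃ x, ‖x‖ ≤ 1 ∧
      δ < ∑' m, ‖(coord (T.comp (inc 𝕜 H j)) V m)ᗮ.starProjection (T (inc 𝕜 H j x) m)‖)
    {ι : ℕ → J} (hι : Function.Injective ι)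
    (e : ∀ i, H (ι i) ≃ₗᵢ[𝕜] EuclideanSpace 𝕜 (Fin i)) :
    ∃ R B : lp H 1 →L[𝕜] lp H 1, R * T * B = restr 𝕜 H (Set.range ι) ∧
      ‖R‖ ≤ 2 * (2 / δ) ∧ ‖B‖ ≤ 1 := by
  classical
  have : ∀ j, CompleteSpace (H j) := fun j => FiniteDimensional.complete 𝕜 (H j)
  choose A B hA hB hAB hBU using fun i U => exists_local_factor hδ hfar i U
  choose nxt hnxt using fun i U =>
    exists_finset_tail_le (η := δ / 8) (T.comp (B i U)) (by positivity)
  obtain ⟨U, hUs⟩ : ∃ U : ℕ → Finset J, ∀ i, U (i + 1) = U i ∪ nxt i (U i) :=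
    ⟨fun i => i.rec ∅ fun i S => S ∪ nxt i S, fun i => rfl⟩
  have hUmono : Monotone U := monotone_nat_of_le_succ fun i => by
    rw [hUs]
    exact Finset.subset_union_left
  let G : ℕ → Set J := fun i => (U (i + 1) : Set J) \ (U i : Set J)
  have hG : ∀ i l j, j ∈ G i → j ∈ G l → i = l := fun i l j hi hl => by
    by_contra hne
    rcases Nat.lt_or_gt_of_ne hne with h | h
    · exact hl.2 (hUmono h hi.1)
    · exact hi.2 (hUmono h hl.1)
  obtain ⟨R, hR, hRG, -⟩ := exists_glue_restr (𝕜 := 𝕜) (H := H) (Y := lp H 1)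
    (C := 2 / δ) (by positivity) G hG
    (fun i => ((inc 𝕜 H (ι i)).comp
      ((e i).symm.toContinuousLinearEquiv : EuclideanSpace 𝕜 (Fin i) →L[𝕜] H (ι i))).comp
        (A i (U i))) fun i => by
      refine ContinuousLinearMap.opNorm_le_bound _ (by positivity) fun z => ?_
      simpa using (A i (U i)).le_of_opNorm_le (hA i (U i)) z
  obtain ⟨Q, hQ, hQι, hQ0⟩ := exists_inj (𝕜 := 𝕜) (H := H) (Y := lp H 1) zero_le_one ι hι
    (fun i => (B i (U i)).comp
      ((e i).toContinuousLinearEquiv : H (ι i) →L[𝕜] EuclideanSpace 𝕜 (Fin i))) fun i => by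
      refine ContinuousLinearMap.opNorm_le_bound _ zero_le_one fun x => ?_
      simpa using (B i (U i)).le_of_opNorm_le (hB i (U i)) (e i x)
  have key : ∀ i x, ‖R (T (Q (inc 𝕜 H (ι i) x))) - inc 𝕜 H (ι i) x‖ ≤ 1 / 2 * ‖x‖ := fun i x => by
    set y := T (B i (U i) (e i x)) with hy
    have h0 : restr 𝕜 H (U i : Set J) y = 0 := hBU i (U i) (e i x)
    have ht : ‖restr 𝕜 H (U (i + 1) : Set J)ᶜ y‖ ≤ δ / 8 * ‖x‖ := by
      simpa using hnxt i (U i) (U (i + 1)) (by rw [hUs]; exact Finset.subset_union_right) (e i x)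
    set z := restr 𝕜 H (U (i + 1) : Set J)ᶜ y with hz
    have hyz : restr 𝕜 H (G i) y = y - z := by
      have h1 := restr_add_compl (𝕜 := 𝕜) (U (i + 1) : Set J) y
      have h2 : restr 𝕜 H (U (i + 1) : Set J) y =
          restr 𝕜 H (U i : Set J) y + restr 𝕜 H (G i) y := by
        rw [← restr_union Set.disjoint_sdiff_right,
          Set.union_sdiff_cancel (Finset.coe_subset.2 (hUmono (Nat.le_succ i)))]
      rw [eq_sub_iff_add_eq]
      conv_rhs => rw [← h1, h2, h0, zero_add]
    have hQx : T (Q (inc 𝕜 H (ι i) x)) = restr 𝕜 H (G i) y + z := by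
      rw [hQι, hyz, sub_add_cancel]
      rfl
    have hAy : A i (U i) y = e i x := hAB i (U i) (e i x)
    have hRy : R (T (Q (inc 𝕜 H (ι i) x))) - inc 𝕜 H (ι i) x =
        R z - inc 𝕜 H (ι i) ((e i).symm (A i (U i) z)) := by
      rw [hQx, map_add, hRG, hyz]
      simp [hAy]
      abel
    rw [hRy]
    have h1 := R.le_of_opNorm_le hR z
    have h2 : ‖inc 𝕜 H (ι i) ((e i).symm (A i (U i) z))‖ ≤ 2 / δ * ‖z‖ := by
      simpa using (A i (U i)).le_of_opNorm_le (hA i (U i)) z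
    calc _ ≤ 2 / δ * ‖z‖ + 2 / δ * ‖z‖ := (norm_sub_le _ _).trans (add_le_add h1 h2)
      _ ≤ 2 / δ * (δ / 8 * ‖x‖) + 2 / δ * (δ / 8 * ‖x‖) := by gcongr
      _ = 1 / 2 * ‖x‖ := by field_simp; ring
  obtain ⟨V, hV, hVn⟩ := exists_inverse_of_norm_sub_one_le (A := lp H 1 →L[𝕜] lp H 1)
    ContinuousLinearMap.norm_id_le (W := R * T * Q + restr 𝕜 H (Set.range ι)ᶜ) <|
    norm_le_of_columns (by norm_num) fun j x => by
      by_cases hj : j ∈ Set.range ι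
      · obtain ⟨i, rfl⟩ := hj
        simpa [restr_inc_notMem (𝕜 := 𝕜) (H := H) (U := (Set.range ι)ᶜ) (j := ι i) (by simp)]
          using key i x
      · have h1 := restr_inc_mem (𝕜 := 𝕜) (U := (Set.range ι)ᶜ) hj x
        simp [h1, hQ0 j hj]
  refine ⟨V * R, Q * restr 𝕜 H (Set.range ι), ?_, ?_, ?_⟩
  · have h1 : V * R * T * (Q * restr 𝕜 H (Set.range ι)) =
        V * (R * T * Q + restr 𝕜 H (Set.range ι)ᶜ) * restr 𝕜 H (Set.range ι) := by
      have h2 : restr 𝕜 H (Set.range ι)ᶜ * restr 𝕜 H (Set.range ι) = 0 := by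
        rw [restr_comp_restr, Set.compl_inter_self]
        ext z j
        rw [restr_apply_notMem (Set.notMem_empty j)]
        rfl
      rw [mul_add, add_mul, mul_assoc V (restr _ _ _), h2, mul_zero, add_zero]
      simp only [mul_assoc]
    rw [h1, hV, one_mul]
  · exact (norm_mul_le _ _).trans (mul_le_mul hVn hR (norm_nonneg _) zero_le_two)
  · exact (norm_mul_le _ _).trans (mul_le_one₀ hQ (norm_nonneg _) (norm_restr_le _))

end Local

end L1Sum

namespace L1Sum

open scoped InnerProductSpace

theorem exists_frame {𝕜 F : Type*} [RCLike 𝕜] [NormedAddCommGroup F] [InnerProductSpace 𝕜 F]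
    (G : Submodule 𝕜 F) [FiniteDimensional 𝕜 G] {k : ℕ} (hk : Module.finrank 𝕜 G ≤ k) :
    ∃ u : Fin k → F, (∀ l, ‖u l‖ ≤ 1) ∧ ∀ y, ∑ l, ⟪u l, y⟫_𝕜 • u l = G.starProjection y := by
  let b := stdOrthonormalBasis 𝕜 G
  let v : ℕ → F := fun l => if h : l < Module.finrank 𝕜 G then b ⟨l, h⟩ else 0
  refine ⟨fun l => v l, fun l => ?_, fun y => ?_⟩
  · simp only [v]
    split_ifs with h
    · exact (b.norm_eq_one _).le
    · rw [norm_zero]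
      exact zero_le_one
  · rw [Fin.sum_univ_eq_sum_range (fun l => ⟪v l, y⟫_𝕜 • v l) k,
      ← Finset.sum_subset (Finset.range_mono hk) (fun l _ hl => by
        simp only [Finset.mem_range] at hl
        simp [v, hl]),
      ← Fin.sum_univ_eq_sum_range (fun l => ⟪v l, y⟫_𝕜 • v l), Submodule.starProjection_apply,
      b.orthogonalProjectionOnto_apply_eq_sum, Submodule.coe_sum]
    refine Finset.sum_congr rfl fun l _ => ?_
    simp [v]

variable {𝕜 : Type*} [RCLike 𝕜] {J : Type*} {H : J → Type*}
  [∀ j, NormedAddCommGroup (H j)] [∀ j, InnerProductSpace 𝕜 (H j)]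
  [∀ j, FiniteDimensional 𝕜 (H j)]
  {B : Type*} [NonUnitalNormedRing B] [NormedSpace 𝕜 B]
  (φ : (lp H 1 →L[𝕜] lp H 1) →ₙₐ[𝕜] B)

omit [∀ j, FiniteDimensional 𝕜 (H j)] in
theorem map_sandwich_eq_zero {P : lp H 1 →L[𝕜] lp H 1} (hP : φ P = 0)
    (R S : lp H 1 →L[𝕜] lp H 1) : φ (R * P * S) = 0 := by
  rw [map_mul, map_mul, hP, mul_zero, zero_mul]

theorem exists_kernel_approx_of_near {T : lp H 1 →L[𝕜] lp H 1} {N : Set J}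
    (hTl : ∀ z, restr 𝕜 H N (T z) = T z) (hTr : ∀ z, T (restr 𝕜 H N z) = T z)
    {a : N × N → J} (ha : Function.Injective a) (e : ∀ p, H (a p)) (he : ∀ p, ‖e p‖ = 1)
    (hφ : φ (restr 𝕜 H (Set.range a)) = 0) {δ : ℝ} (hδ : 0 ≤ δ) {k : ℕ}
    (hnear : ∀ j, ∃ V : Submodule 𝕜 (H j), Module.finrank 𝕜 V < k ∧ ∀ x, ‖x‖ ≤ 1 →
      ∑' m, ‖(coord (T.comp (inc 𝕜 H j)) V m)ᗮ.starProjection (T (inc 𝕜 H j x) m)‖ ≤ δ) :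
    ∃ S, φ S = 0 ∧ ‖T - S‖ ≤ δ := by
  have : ∀ j, CompleteSpace (H j) := fun j => FiniteDimensional.complete 𝕜 (H j)
  choose V hV hVδ using hnear
  choose u hu1 hu using fun n m =>
    exists_frame (coord (T.comp (inc 𝕜 H n)) (V n) m) (k := k)
      ((Submodule.finrank_map_le _ _).trans (hV n).le)
  choose A hA hAin hAout using fun (l : Fin k) (n : N) =>
    exists_inj (𝕜 := 𝕜) (H := H) (Y := lp H 1) zero_le_one (Subtype.val : N → J)
      Subtype.val_injective
      (fun m => (innerSL 𝕜 (u n m l)).smulRight (inc 𝕜 H (a (n, m)) (e (n, m)))) fun m => by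
        rw [ContinuousLinearMap.norm_smulRight_apply, norm_inc_apply, he, mul_one,
          innerSL_apply_norm]
        exact hu1 _ _ _
  choose α hα hαin hαout using fun l : Fin k =>
    exists_inj (𝕜 := 𝕜) (H := H) (Y := lp H 1) (norm_nonneg T) (Subtype.val : N → J)
      Subtype.val_injective (fun n => (A l n).comp (T.comp (inc 𝕜 H n))) fun n => by
        refine ((A l n).opNorm_comp_le _).trans ((mul_le_of_le_one_left (norm_nonneg _)
          (hA l n)).trans ?_)
        exact (T.opNorm_comp_le _).trans (mul_le_of_le_one_right (norm_nonneg _) (norm_inc_le _))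
  choose β hβ hβin hβout using fun l : Fin k =>
    exists_inj (𝕜 := 𝕜) (H := H) (Y := lp H 1) zero_le_one a ha
      (fun p => (innerSL 𝕜 (e p)).smulRight (inc 𝕜 H p.2 (u p.1 p.2 l))) fun p => by
        rw [ContinuousLinearMap.norm_smulRight_apply, norm_inc_apply, innerSL_apply_norm, he,
          one_mul]
        exact hu1 _ _ _
  have hβA : ∀ l n (m : N) y, β l (restr 𝕜 H (Set.range a) (A l n (inc 𝕜 H (m : J) y))) =
      ⟪u n m l, y⟫_𝕜 • inc 𝕜 H (m : J) (u n m l) := fun l n m y => by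
    rw [hAin, ContinuousLinearMap.smulRight_apply, map_smul, map_smul,
      restr_inc_mem (Set.mem_range_self _), hβin]
    simp [he, inner_self_eq_norm_sq_to_K]
  let D : N → lp H 1 →L[𝕜] lp H 1 := fun n => ∑ l, β l * restr 𝕜 H (Set.range a) * A l n
  have hDsum : ∀ n z, D n z = ∑ l, β l (restr 𝕜 H (Set.range a) (A l n z)) := fun n z => by
    simp [D]
  have hDin : ∀ n (j : N) y, D n (inc 𝕜 H (j : J) y) =
      inc 𝕜 H (j : J) ((coord (T.comp (inc 𝕜 H n)) (V n) j).starProjection y) := fun n j y => by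
    rw [hDsum, ← hu, map_sum]
    exact Finset.sum_congr rfl fun l _ => by rw [hβA l n j, map_smul]
  have hDout : ∀ n, ∀ j ∉ N, ∀ y, D n (inc 𝕜 H j y) = 0 := fun n j hj y => by
    rw [hDsum]
    refine Finset.sum_eq_zero fun l _ => ?_
    rw [hAout l n j (by simpa using hj), map_zero, map_zero]
  have hD : ∀ n z m, D n z m =
      (coord (T.comp (inc 𝕜 H n)) (V n) m).starProjection (restr 𝕜 H N z m) := fun n z m => by
    refine DFunLike.congr_fun (clm_ext (S := (lp.evalCLM 𝕜 H 1 m).comp (D n))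
      (T := ((coord (T.comp (inc 𝕜 H n)) (V n) m).starProjection).comp
        ((lp.evalCLM 𝕜 H 1 m).comp (restr 𝕜 H N))) fun j y => ?_) z
    change D n (inc 𝕜 H j y) m = Submodule.starProjection _ (restr 𝕜 H N (inc 𝕜 H j y) m)
    by_cases hj : j ∈ N
    · rw [hDin n ⟨j, hj⟩, restr_inc_mem hj]
      rcases eq_or_ne m j with rfl | hmj
      · simp
      · simp [inc_apply_ne hmj]
    · rw [hDout n j hj, restr_inc_notMem hj]
      simp
  refine ⟨∑ l, β l * restr 𝕜 H (Set.range a) * α l, ?_, ?_⟩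
  · rw [map_sum]
    exact Finset.sum_eq_zero fun l _ => map_sandwich_eq_zero φ hφ _ _
  · have hcol : ∀ j, ‖(T - ∑ l, β l * restr 𝕜 H (Set.range a) * α l).comp (inc 𝕜 H j)‖ ≤ δ := by
      intro j
      by_cases hj : j ∈ N
      · refine ContinuousLinearMap.opNorm_le_of_unit_norm hδ fun x hx => ?_
        have h1 : ((T - ∑ l, β l * restr 𝕜 H (Set.range a) * α l).comp (inc 𝕜 H j)) x =
            T (inc 𝕜 H j x) - D ⟨j, hj⟩ (T (inc 𝕜 H j x)) := by
          have := fun l => hαin l ⟨j, hj⟩ x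
          simp only at this
          simp [D, this]
        refine le_trans (le_of_eq ?_) (hVδ j x hx.le)
        rw [h1, norm_eq_tsum]
        refine tsum_congr fun m => ?_
        rw [lp.coeFn_sub, Pi.sub_apply]
        rw [hD, hTl, Submodule.starProjection_orthogonal_val]
      · have h1 : (T - ∑ l, β l * restr 𝕜 H (Set.range a) * α l).comp (inc 𝕜 H j) = 0 := by
          ext1 x
          have h2 := fun l => hαout l j (by simpa using hj) x
          have h3 : T (inc 𝕜 H j x) = 0 := by
            rw [← hTr, restr_inc_notMem hj, map_zero]
          simp [h2, h3]
        rw [h1, norm_zero]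
        exact hδ
    exact norm_le_of_columns hδ fun j x =>
      ContinuousLinearMap.le_of_opNorm_le _ (hcol j) x

omit [∀ j, FiniteDimensional 𝕜 (H j)] in
theorem range_restr_subset (N : Set J) : Set.range (restr 𝕜 H N) ⊆
    closure (Submodule.span 𝕜 (⋃ j ∈ N, Set.range (inc 𝕜 H j)) : Set (lp H 1)) := by
  rintro _ ⟨z, rfl⟩
  have h := (restr 𝕜 H N).hasSum (hasSum_inc 𝕜 z)
  refine mem_closure_of_tendsto h (Filter.Eventually.of_forall fun s =>
    Submodule.sum_mem _ fun j _ => ?_)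
  by_cases hj : j ∈ N
  · rw [restr_inc_mem hj]
    exact Submodule.subset_span (Set.mem_biUnion hj ⟨_, rfl⟩)
  · rw [restr_inc_notMem hj]
    exact Submodule.zero_mem _

theorem isSeparable_range_restr {N : Set J} (hN : N.Countable) :
    TopologicalSpace.IsSeparable (Set.range (restr 𝕜 H N)) := by
  refine TopologicalSpace.IsSeparable.mono ?_ (range_restr_subset N)
  refine (TopologicalSpace.IsSeparable.span ?_).closure
  have := hN.to_subtype
  rw [Set.biUnion_eq_iUnion]
  refine TopologicalSpace.IsSeparable.iUnion fun j => ?_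
  have := FiniteDimensional.proper 𝕜 (H j)
  exact TopologicalSpace.isSeparable_range (inc 𝕜 H (j : J)).continuous

theorem exists_kernel_approx_of_separable {T : lp H 1 →L[𝕜] lp H 1} {N M : Set J}
    (hN : N.Countable) (hTl : ∀ z, restr 𝕜 H N (T z) = T z)
    (hTr : ∀ z, T (restr 𝕜 H M z) = T z)
    (e : ∀ j : M, H j) (he : ∀ j, ‖e j‖ = 1) (hspan : ∀ (j : M) (x : H j), ∃ c : 𝕜, x = c • e j)
    {a : ℕ → M} (ha : Function.Injective a)
    (hφ : φ (restr 𝕜 H (Set.range fun s => (a s : J))) = 0) {δ : ℝ} (hδ : 0 < δ) :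
    ∃ S, φ S = 0 ∧ ‖T - S‖ ≤ δ := by
  have : ∀ j, CompleteSpace (H j) := fun j => FiniteDimensional.complete 𝕜 (H j)
  obtain ⟨c, hc, hNc⟩ := isSeparable_range_restr (𝕜 := 𝕜) (H := H) hN
  have hcne : c.Nonempty := closure_nonempty_iff.1 ⟨_, hNc ⟨0, rfl⟩⟩
  obtain ⟨z, rfl⟩ := hc.exists_eq_range hcne
  have hs : ∀ j : M, ∃ s, ‖T (inc 𝕜 H j (e j)) - z s‖ < δ := fun j => by
    have h := hNc ⟨T (inc 𝕜 H j (e j)), hTl _⟩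
    obtain ⟨_, ⟨s, rfl⟩, hs⟩ := Metric.mem_closure_iff.1 h δ hδ
    exact ⟨s, by rwa [← dist_eq_norm]⟩
  choose s hs using hs
  obtain ⟨α, -, hαin, hαout⟩ := exists_inj (𝕜 := 𝕜) (H := H) (Y := lp H 1) zero_le_one
    (Subtype.val : M → J) Subtype.val_injective
    (fun j => (innerSL 𝕜 (e j)).smulRight (inc 𝕜 H (a (s j)) (e (a (s j))))) fun j => by
      rw [ContinuousLinearMap.norm_smulRight_apply, norm_inc_apply, innerSL_apply_norm, he, he,
        one_mul]
  classical
  obtain ⟨β, -, hβin, -⟩ := exists_inj (𝕜 := 𝕜) (H := H) (Y := lp H 1)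
    (C := ‖T‖ + δ) (by positivity) (fun s => (a s : J)) (Subtype.val_injective.comp ha)
    (fun i => (innerSL 𝕜 (e (a i))).smulRight (if ‖z i‖ ≤ ‖T‖ + δ then z i else 0)) fun i => by
      rw [ContinuousLinearMap.norm_smulRight_apply, innerSL_apply_norm, he, one_mul]
      split_ifs with h
      · exact h
      · rw [norm_zero]
        positivity
  have hzs : ∀ j : M, ‖z (s j)‖ ≤ ‖T‖ + δ := fun j => by
    have h1 : ‖T (inc 𝕜 H j (e j))‖ ≤ ‖T‖ := T.unit_le_opNorm _ (by simp [he])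
    have h2 := norm_sub_norm_le (z (s j)) (T (inc 𝕜 H j (e j)))
    rw [norm_sub_rev] at h2
    linarith [hs j]
  refine ⟨_, map_sandwich_eq_zero φ hφ β α, norm_le_of_columns hδ.le fun j x => ?_⟩
  by_cases hj : j ∈ M
  · obtain ⟨c, hc⟩ := hspan ⟨j, hj⟩ x
    simp only at hc
    have h1 : α (inc 𝕜 H j (e ⟨j, hj⟩)) =
        inc 𝕜 H (a (s ⟨j, hj⟩)) (e (a (s ⟨j, hj⟩))) := by
      have := hαin ⟨j, hj⟩ (e ⟨j, hj⟩)
      simpa [inner_self_eq_norm_sq_to_K, he] using this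
    have h2 : β (inc 𝕜 H (a (s ⟨j, hj⟩)) (e (a (s ⟨j, hj⟩)))) = z (s ⟨j, hj⟩) := by
      rw [hβin, if_pos (hzs _)]
      simp [inner_self_eq_norm_sq_to_K, he]
    have h3 : (T - β * restr 𝕜 H (Set.range fun s => (a s : J)) * α) (inc 𝕜 H j x) =
        c • (T (inc 𝕜 H j (e ⟨j, hj⟩)) - z (s ⟨j, hj⟩)) := by
      rw [hc, map_smul, map_smul]
      congr 1
      change _ - β (restr 𝕜 H _ (α _)) = _
      rw [h1, restr_inc_mem (Set.mem_range_self (s ⟨j, hj⟩)), h2]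
      rfl
    have h4 : ‖x‖ = ‖c‖ := by
      have : ‖e ⟨j, hj⟩‖ = 1 := he _
      rw [hc, norm_smul, this, mul_one]
    rw [h3, norm_smul, h4, mul_comm]
    have := (hs ⟨j, hj⟩).le
    gcongr
  · have h1 : T (inc 𝕜 H j x) = 0 := by rw [← hTr, restr_inc_notMem hj, map_zero]
    have h2 := hαout j (by simpa using hj) x
    simp [h1, h2]
    positivity

end L1Sum

namespace L1Sum

open scoped InnerProductSpace

variable {𝕜 : Type*} [RCLike 𝕜] {J : Type*} {H : J → Type*}
  [∀ j, NormedAddCommGroup (H j)] [∀ j, InnerProductSpace 𝕜 (H j)]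

theorem exists_factor_singleton {T : lp H 1 →L[𝕜] lp H 1} {δ : ℝ} (hδ : 0 < δ) (hT : δ < ‖T‖)
    {i : J} {e : H i} (he : ‖e‖ = 1) (hspan : ∀ x : H i, ∃ c : 𝕜, x = c • e) :
    ∃ R S : lp H 1 →L[𝕜] lp H 1, R * T * S = restr 𝕜 H {i} ∧ ‖R‖ ≤ δ⁻¹ ∧ ‖S‖ ≤ 1 := by
  obtain ⟨j, x, hx⟩ : ∃ j x, δ * ‖x‖ < ‖T (inc 𝕜 H j x)‖ := by
    by_contra! h
    exact hT.not_ge (norm_le_of_columns hδ.le h)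
  have hx0 : 0 < ‖x‖ := norm_pos_iff.2 fun h => by simp [h] at hx
  set t := ‖T (inc 𝕜 H j x)‖ with ht
  have ht0 : 0 < t := (by positivity : 0 ≤ δ * ‖x‖).trans_lt hx
  obtain ⟨f, hf, hfx⟩ := exists_dual_vector'' 𝕜 (T (inc 𝕜 H j x))
  refine ⟨(((t⁻¹ * ‖x‖ : ℝ) : 𝕜) • f).smulRight (inc 𝕜 H i e),
    ((innerSL 𝕜 e).comp (lp.evalCLM 𝕜 H 1 i)).smulRight (((‖x‖⁻¹ : ℝ) : 𝕜) • inc 𝕜 H j x),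
    clm_ext fun l y => ?_, ?_, ?_⟩
  · change (((t⁻¹ * ‖x‖ : ℝ) : 𝕜) • f) (T (⟪e, inc 𝕜 H l y i⟫_𝕜 •
      (((‖x‖⁻¹ : ℝ) : 𝕜) • inc 𝕜 H j x))) • inc 𝕜 H i e = _
    rcases eq_or_ne i l with rfl | hil
    · obtain ⟨c, rfl⟩ := hspan y
      rw [restr_inc_mem (Set.mem_singleton _), inc_apply_self, inner_smul_right,
        inner_self_eq_norm_sq_to_K, he, map_smul, map_smul, map_smul, map_smul, map_smul,
        smul_apply, hfx, ← ht]
      simp only [smul_eq_mul]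
      congr 1
      have h1 : ((t : ℝ) : 𝕜) ≠ 0 := RCLike.ofReal_ne_zero.2 ht0.ne'
      have h2 : ((‖x‖ : ℝ) : 𝕜) ≠ 0 := RCLike.ofReal_ne_zero.2 hx0.ne'
      push_cast
      field_simp
    · rw [restr_inc_notMem (by simpa using hil.symm), inc_apply_ne hil]
      simp
  · rw [ContinuousLinearMap.norm_smulRight_apply, norm_inc_apply, he, mul_one, norm_smul,
      RCLike.norm_ofReal, abs_of_nonneg (by positivity)]
    refine (mul_le_of_le_one_right (by positivity) hf).trans ?_
    rw [inv_mul_le_iff₀ ht0, ← div_eq_mul_inv, le_div_iff₀ hδ]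
    linarith
  · rw [ContinuousLinearMap.norm_smulRight_apply, norm_smul, norm_inc_apply, RCLike.norm_ofReal,
      abs_of_nonneg (by positivity), inv_mul_cancel₀ hx0.ne', mul_one]
    refine ContinuousLinearMap.opNorm_le_bound _ zero_le_one fun z => ?_
    refine (norm_inner_le_norm _ _).trans ?_
    rw [he]
    gcongr
    exact lp.norm_apply_le_norm one_ne_zero z i

variable {B : Type*} [NonUnitalNormedRing B] [NormedSpace 𝕜 B]
  (φ : (lp H 1 →L[𝕜] lp H 1) →ₙₐ[𝕜] B)

theorem norm_map_le_of_factor {C : ℝ} (hC : ∀ T, ‖φ T‖ ≤ C * ‖T‖) {T P R S : lp H 1 →L[𝕜] lp H 1}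
    (h : R * T * S = P) {δ : ℝ} (hδ : 0 < δ) (hR : ‖R‖ ≤ 4 * δ⁻¹) (hS : ‖S‖ ≤ 1) :
    ‖φ P‖ * δ ≤ 4 * C ^ 2 * ‖φ T‖ := by
  rcases lt_or_ge C 0 with hC0 | hC0
  · have h1 : φ P = 0 := norm_le_zero_iff.1
      ((hC P).trans (mul_nonpos_of_nonpos_of_nonneg hC0.le (norm_nonneg _)))
    rw [h1, norm_zero, zero_mul]
    positivity
  have h1 : ‖φ P‖ ≤ C * (4 * δ⁻¹) * ‖φ T‖ * (C * 1) := by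
    rw [← h, map_mul, map_mul]
    refine (norm_mul_le _ _).trans (mul_le_mul ((norm_mul_le _ _).trans ?_) ?_ (norm_nonneg _)
      (by positivity))
    · have := (hC R).trans (mul_le_mul_of_nonneg_left hR hC0)
      gcongr
    · exact (hC S).trans (mul_le_mul_of_nonneg_left hS hC0)
  calc ‖φ P‖ * δ ≤ C * (4 * δ⁻¹) * ‖φ T‖ * (C * 1) * δ := by gcongr
    _ = 4 * C ^ 2 * ‖φ T‖ := by field_simp

/-- A lower bound for `φ` on the operators satisfying `Q`, in terms of the distance to the
kernel. -/
def BoundedBelowOn (Q : (lp H 1 →L[𝕜] lp H 1) → Prop) : Prop :=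
  ∃ c > 0, ∀ T, Q T → ∀ δ > 0, (∀ S, φ S = 0 → δ < ‖T - S‖) → c * δ ≤ ‖φ T‖

variable {φ}

theorem boundedBelowOn_of_factor {C : ℝ} (hC : ∀ T, ‖φ T‖ ≤ C * ‖T‖)
    {P : lp H 1 →L[𝕜] lp H 1} (hP : φ P ≠ 0) {Q : (lp H 1 →L[𝕜] lp H 1) → Prop}
    (h : ∀ T, Q T → ∀ δ > 0, (∀ S, φ S = 0 → δ < ‖T - S‖) →
      ∃ R S, R * T * S = P ∧ ‖R‖ ≤ 4 * δ⁻¹ ∧ ‖S‖ ≤ 1) : BoundedBelowOn φ Q := by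
  have hP0 : 0 < ‖φ P‖ := norm_pos_iff.2 hP
  refine ⟨‖φ P‖ / (4 * C ^ 2 + 1), by positivity, fun T hT δ hδ hfar => ?_⟩
  obtain ⟨R, S, hRS, hR, hS⟩ := h T hT δ hδ hfar
  rw [div_mul_eq_mul_div, div_le_iff₀ (by positivity)]
  have := norm_map_le_of_factor φ hC hRS hδ hR hS
  nlinarith [norm_nonneg (φ T)]

theorem boundedBelowOn_of_forall_eq_zero {Q : (lp H 1 →L[𝕜] lp H 1) → Prop}
    (h : ∀ T, Q T → φ T = 0) : BoundedBelowOn φ Q := by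
  refine ⟨1, one_pos, fun T hT δ hδ hfar => ?_⟩
  have := hfar T (h T hT)
  rw [sub_self, norm_zero] at this
  exact absurd this hδ.not_gt

theorem BoundedBelowOn.glue {C : ℝ} (hC : ∀ T, ‖φ T‖ ≤ C * ‖T‖) (M : Set J)
    (h1 : BoundedBelowOn φ fun T => (∀ z, restr 𝕜 H Mᶜ (T z) = T z) ∧
      ∀ z, T (restr 𝕜 H Mᶜ z) = T z)
    (h2 : BoundedBelowOn φ fun T => ∀ z, restr 𝕜 H M (T z) = T z)
    (h3 : ∀ T : lp H 1 →L[𝕜] lp H 1, (∀ z, restr 𝕜 H Mᶜ (T z) = T z) →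
      (∀ z, T (restr 𝕜 H M z) = T z) → ∀ δ > 0, ∃ S, φ S = 0 ∧ ‖T - S‖ ≤ δ) :
    BoundedBelowOn φ fun _ => True := by
  obtain ⟨c₁, hc₁, h1⟩ := h1
  obtain ⟨c₂, hc₂, h2⟩ := h2
  have hid : ∀ U V : Set J, U ⊆ V → ∀ z, restr 𝕜 H V (restr 𝕜 H U z) = restr 𝕜 H U z :=
    fun U V h z => by rw [restr_restr, Set.inter_eq_right.2 h]
  set c := min c₁ c₂ / 3 with hc
  have hc0 : 0 < c := by positivity
  have hQ : ∀ U : Set J, ‖φ (restr 𝕜 H U)‖ ≤ max C 1 := fun U => by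
    refine (hC _).trans ((mul_le_mul_of_nonneg_right (le_max_left C 1) (norm_nonneg _)).trans ?_)
    exact mul_le_of_le_one_right (by positivity) (norm_restr_le U)
  set D := max C 1 with hD
  have hD1 : 1 ≤ D := le_max_right _ _
  refine ⟨c / D ^ 2, by positivity, fun T _ δ hδ hfar => ?_⟩
  rw [div_mul_eq_mul_div, div_le_iff₀ (by positivity)]
  by_contra! hlt
  set P := restr 𝕜 H Mᶜ with hP
  set P' := restr 𝕜 H M with hP'
  have hPT : ‖φ (P * T * P)‖ ≤ ‖φ T‖ * D ^ 2 := by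
    rw [map_mul, map_mul]
    calc _ ≤ D * ‖φ T‖ * D := by
          refine (norm_mul_le _ _).trans (mul_le_mul ((norm_mul_le _ _).trans ?_) (hQ _)
            (norm_nonneg _) (by positivity))
          gcongr
          exact hQ _
      _ = _ := by ring
  have hPT' : ‖φ (P' * T)‖ ≤ ‖φ T‖ * D ^ 2 := by
    rw [map_mul]
    calc _ ≤ D * ‖φ T‖ := by
          refine (norm_mul_le _ _).trans ?_
          gcongr
          exact hQ _
      _ = ‖φ T‖ * D * 1 := by ring
      _ ≤ ‖φ T‖ * D * D := by gcongr
      _ = _ := by ring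
  have hc₁' : c * δ ≤ c₁ * (δ / 3) := by
    have := mul_le_mul_of_nonneg_right (min_le_left c₁ c₂) hδ.le
    rw [hc]; linarith
  have hc₂' : c * δ ≤ c₂ * (δ / 3) := by
    have := mul_le_mul_of_nonneg_right (min_le_right c₁ c₂) hδ.le
    rw [hc]; linarith
  obtain ⟨S₁, hS₁, hS₁'⟩ : ∃ S, φ S = 0 ∧ ‖P * T * P - S‖ ≤ δ / 3 := by
    by_contra! h
    have := h1 (P * T * P) ⟨fun z => hid _ _ subset_rfl _,
      fun z => congrArg (fun w => P (T w)) (hid _ _ subset_rfl z)⟩ (δ / 3) (by positivity) h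
    linarith
  obtain ⟨S₂, hS₂, hS₂'⟩ : ∃ S, φ S = 0 ∧ ‖P' * T - S‖ ≤ δ / 3 := by
    by_contra! h
    have := h2 (P' * T) (fun z => hid _ _ subset_rfl _) (δ / 3) (by positivity) h
    linarith
  obtain ⟨S₃, hS₃, hS₃'⟩ := h3 (P * T * P') (fun z => hid _ _ subset_rfl _)
    (fun z => congrArg (fun w => P (T w)) (hid _ _ subset_rfl z)) (δ / 3) (by positivity)
  have hsum : P' + P = 1 := by
    ext1 z
    exact restr_add_compl M z
  have hT : T = P * T * P + P * T * P' + P' * T := by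
    calc T = (P' + P) * T := by rw [hsum, one_mul]
      _ = P * T + P' * T := by rw [add_mul, add_comm]
      _ = P * T * (P' + P) + P' * T := by rw [hsum, mul_one]
      _ = _ := by rw [mul_add, add_comm (P * T * P')]
  have := hfar (S₁ + S₃ + S₂) (by rw [map_add, map_add, hS₁, hS₂, hS₃, add_zero, add_zero])
  have h4 : T - (S₁ + S₃ + S₂) = (P * T * P - S₁) + (P * T * P' - S₃) + (P' * T - S₂) := by
    conv_lhs => rw [hT]
    abel
  rw [h4] at this
  have h5 := (norm_add₃_le (a := P * T * P - S₁) (b := P * T * P' - S₃) (c := P' * T - S₂))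
  linarith

end L1Sum

namespace L1Sum

open scoped InnerProductSpace

variable {𝕜 : Type*} [RCLike 𝕜] {J : Type*} {H : J → Type*}
  [∀ j, NormedAddCommGroup (H j)] [∀ j, InnerProductSpace 𝕜 (H j)]

theorem restr_singleton (j : J) (z : lp H 1) : restr 𝕜 H {j} z = inc 𝕜 H j (z j) := by
  ext i
  rcases eq_or_ne i j with rfl | h
  · rw [restr_apply_mem (Set.mem_singleton _), inc_apply_self]
  · rw [restr_apply_notMem (by simpa using h), inc_apply_ne h]

variable {B : Type*} [NonUnitalNormedRing B] [NormedSpace 𝕜 B]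
  {φ : (lp H 1 →L[𝕜] lp H 1) →ₙₐ[𝕜] B}

theorem map_restr_singleton_eq_zero {i : J} {e : H i} (he : ‖e‖ = 1)
    (hφ : φ (restr 𝕜 H {i}) = 0) (j : J) [FiniteDimensional 𝕜 (H j)] :
    φ (restr 𝕜 H {j}) = 0 := by
  let b := stdOrthonormalBasis 𝕜 (H j)
  have h : restr 𝕜 H {j} = ∑ l,
      (((innerSL 𝕜 e).comp (lp.evalCLM 𝕜 H 1 i)).smulRight (inc 𝕜 H j (b l))) *
        restr 𝕜 H {i} *
        ((innerSL 𝕜 (b l)).comp (lp.evalCLM 𝕜 H 1 j)).smulRight (inc 𝕜 H i e) := by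
    ext1 z
    rw [sum_apply, restr_singleton]
    conv_lhs => rw [← b.sum_repr' (z j), map_sum]
    refine Finset.sum_congr rfl fun l _ => ?_
    change _ = ⟪e, restr 𝕜 H {i} (⟪b l, z j⟫_𝕜 • inc 𝕜 H i e) i⟫_𝕜 • inc 𝕜 H j (b l)
    rw [map_smul, map_smul, restr_inc_mem (Set.mem_singleton _), lp.coeFn_smul, Pi.smul_apply,
      inc_apply_self, inner_smul_right, inner_self_eq_norm_sq_to_K, he]
    simp
  rw [h, map_sum]
  exact Finset.sum_eq_zero fun l _ => map_sandwich_eq_zero φ hφ _ _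

theorem map_restr_eq_zero_of_finite (h : ∀ j, φ (restr 𝕜 H {j}) = 0) {U : Set J}
    (hU : U.Finite) : φ (restr 𝕜 H U) = 0 := by
  induction U, hU using Set.Finite.induction_on with
  | empty =>
    have : restr 𝕜 H (∅ : Set J) = 0 := by
      ext z j
      rw [restr_apply_notMem (Set.notMem_empty j)]
      rfl
    rw [this, map_zero]
  | @insert j U hj _ ih =>
    have : restr 𝕜 H (insert j U) = restr 𝕜 H {j} + restr 𝕜 H U := by
      ext1 z
      exact restr_union (Set.disjoint_singleton_left.2 hj) z
    rw [this, map_add, h, ih, add_zero]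

variable [∀ j, FiniteDimensional 𝕜 (H j)]

/-- If `φ` is nonzero at a coordinate projection onto an infinite family of one-dimensional
summands, but vanishes at all those of smaller cardinality inside `J₀`, then it is bounded below
on the operators with range supported in `J₀`. -/
theorem boundedBelowOn_of_minimal {C : ℝ} (hC : ∀ T, ‖φ T‖ ≤ C * ‖T‖) {A J₀ : Set J}
    (hA : A.Infinite) (e : ∀ a : A, H a) (he : ∀ a, ‖e a‖ = 1)
    (hspan : ∀ (a : A) (x : H a), ∃ c : 𝕜, x = c • e a) (hφA : φ (restr 𝕜 H A) ≠ 0)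
    (hmin : ∀ U ⊆ J₀, Cardinal.mk U < Cardinal.mk A → φ (restr 𝕜 H U) = 0) :
    BoundedBelowOn φ fun T => ∀ z, restr 𝕜 H J₀ (T z) = T z := by
  have : ∀ j, CompleteSpace (H j) := fun j => FiniteDimensional.complete 𝕜 (H j)
  refine boundedBelowOn_of_factor hC hφA fun T hT δ hδ hfar => ?_
  obtain ⟨R, S, h, hR, hS⟩ := exists_factor_restr hA e he hspan hT hδ fun U hU hUA =>
    hfar _ (by rw [map_mul, hmin U hU hUA, zero_mul])
  refine ⟨R, S, h, hR.trans ?_, hS⟩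
  have : 0 < δ⁻¹ := inv_pos.2 hδ
  linarith

theorem boundedBelowOn_range {C : ℝ} (hC : ∀ T, ‖φ T‖ ≤ C * ‖T‖) {M : Set J}
    (hM : M.Infinite) (e : ∀ j : M, H j) (he : ∀ j, ‖e j‖ = 1)
    {ι : ℕ → J} (hι : Function.Injective ι) (g : ∀ i, H (ι i) ≃ₗᵢ[𝕜] EuclideanSpace 𝕜 (Fin i))
    (h0 : ∀ U ⊆ M, U.Countable → φ (restr 𝕜 H U) = 0) :
    BoundedBelowOn φ fun T => (∀ z, restr 𝕜 H (Set.range ι) (T z) = T z) ∧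
      ∀ z, T (restr 𝕜 H (Set.range ι) z) = T z := by
  by_cases hφ : φ (restr 𝕜 H (Set.range ι)) = 0
  · refine boundedBelowOn_of_forall_eq_zero fun T hT => ?_
    have : T = restr 𝕜 H (Set.range ι) * T := by
      ext1 z
      exact (hT.1 z).symm
    rw [this, map_mul, hφ, zero_mul]
  refine boundedBelowOn_of_factor hC hφ fun T hT δ hδ hfar => ?_
  by_cases hfar' : ∀ k : ℕ, ∃ j, ∀ V : Submodule 𝕜 (H j), Module.finrank 𝕜 V < k →
      ∃ x, ‖x‖ ≤ 1 ∧
        δ < ∑' m, ‖(coord (T.comp (inc 𝕜 H j)) V m)ᗮ.starProjection (T (inc 𝕜 H j x) m)‖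
  · obtain ⟨R, S, h, hR, hS⟩ := exists_factor_of_far hδ hfar' hι g
    exact ⟨R, S, h, hR.trans_eq (by ring), hS⟩
  · push Not at hfar'
    obtain ⟨k, hk⟩ := hfar'
    have : Infinite M := hM.to_subtype
    have : Countable (Set.range ι) := (Set.countable_range ι).to_subtype
    obtain ⟨f, hf⟩ := exists_injective_nat (Set.range ι × Set.range ι)
    let a : Set.range ι × Set.range ι → M := Infinite.natEmbedding M ∘ f
    have ha : Function.Injective a := (Infinite.natEmbedding M).injective.comp hf
    obtain ⟨S, hS, hTS⟩ := exists_kernel_approx_of_near φ hT.1 hT.2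
      (a := fun p => (a p : J)) (Subtype.val_injective.comp ha) (fun p => e (a p))
      (fun p => he (a p)) (h0 _ (Set.range_subset_iff.2 fun p => (a p).2)
        (Set.countable_range _)) hδ.le hk
    exact absurd hTS (hfar S hS).not_ge

theorem boundedBelowOn_true {C : ℝ} (hC : ∀ T, ‖φ T‖ ≤ C * ‖T‖) {M : Set J}
    (hM : M.Infinite) (e : ∀ j : M, H j) (he : ∀ j, ‖e j‖ = 1)
    (hspan : ∀ (j : M) (x : H j), ∃ c : 𝕜, x = c • e j)
    {ι : ℕ → J} (hι : Function.Injective ι) (hιM : Set.range ι = Mᶜ)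
    (g : ∀ i, H (ι i) ≃ₗᵢ[𝕜] EuclideanSpace 𝕜 (Fin i)) :
    BoundedBelowOn φ fun _ => True := by
  by_cases hsing : ∃ i : M, φ (restr 𝕜 H {(i : J)}) ≠ 0
  · obtain ⟨i, hi⟩ := hsing
    refine boundedBelowOn_of_factor hC hi fun T _ δ hδ hfar => ?_
    have hT : δ < ‖T‖ := by simpa using hfar 0 (map_zero φ)
    obtain ⟨R, S, h, hR, hS⟩ := exists_factor_singleton hδ hT (he i) (hspan i)
    refine ⟨R, S, h, hR.trans ?_, hS⟩
    have : 0 < δ⁻¹ := inv_pos.2 hδ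
    linarith
  push Not at hsing
  have : Infinite M := hM.to_subtype
  have hfin : ∀ U : Set J, U.Finite → φ (restr 𝕜 H U) = 0 := fun U hU =>
    let i := Classical.arbitrary M
    map_restr_eq_zero_of_finite (fun j => map_restr_singleton_eq_zero (he i) (hsing i) j) hU
  by_cases hct : ∃ U ⊆ M, U.Countable ∧ φ (restr 𝕜 H U) ≠ 0
  · obtain ⟨U, hUM, hU, hφU⟩ := hct
    obtain ⟨c, hc, h⟩ := boundedBelowOn_of_minimal hC (A := U) (J₀ := Set.univ)
      (fun hf => hφU (hfin U hf)) (fun a => e ⟨a, hUM a.2⟩) (fun a => he _)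
      (fun a => hspan ⟨a, hUM a.2⟩) hφU fun V _ hV => hfin V
        (Cardinal.lt_aleph0_iff_set_finite.1 (hV.trans_le hU.le_aleph0))
    exact ⟨c, hc, fun T _ => h T fun z => restr_univ _⟩
  push Not at hct
  refine BoundedBelowOn.glue hC M ?_ ?_ ?_
  · rw [← hιM]
    exact boundedBelowOn_range hC hM e he hι g hct
  · by_cases hφM : φ (restr 𝕜 H M) = 0
    · refine boundedBelowOn_of_forall_eq_zero fun T hT => ?_
      have : T = restr 𝕜 H M * T := by
        ext1 z
        exact (hT z).symm
      rw [this, map_mul, hφM, zero_mul]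
    obtain ⟨A, ⟨hAM, hφA⟩, hmin⟩ := (InvImage.wf (fun A : Set J => Cardinal.mk A)
      Cardinal.lt_wf).has_min {A | A ⊆ M ∧ φ (restr 𝕜 H A) ≠ 0} ⟨M, subset_rfl, hφM⟩
    refine boundedBelowOn_of_minimal hC (A := A) (fun hf => hφA (hfin A hf))
      (fun a => e ⟨a, hAM a.2⟩) (fun a => he _) (fun a => hspan ⟨a, hAM a.2⟩) hφA
      fun V hV hVA => ?_
    by_contra h
    exact hmin V ⟨hV, h⟩ hVA
  · intro T hTl hTr δ hδ
    have hN : (Mᶜ).Countable := hιM ▸ Set.countable_range ι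
    let a := Infinite.natEmbedding M
    exact exists_kernel_approx_of_separable φ hN hTl hTr e he hspan a.injective
      (hct _ (Set.range_subset_iff.2 fun s => (a s).2) (Set.countable_range _)) hδ

end L1Sum

namespace L1Sum

theorem isClosed_range_of_bound {𝕜 A B : Type*} [RCLike 𝕜] [NormedAddCommGroup A]
    [NormedSpace 𝕜 A] [CompleteSpace A] [NormedAddCommGroup B] [NormedSpace 𝕜 B]
    (f : A →L[𝕜] B) {c : ℝ} (hc : 0 < c)
    (h : ∀ T, ∀ δ > 0, (∀ S, f S = 0 → δ < ‖T - S‖) → c * δ ≤ ‖f T‖) :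
    IsClosed (Set.range f) := by
  let K : Submodule 𝕜 A := LinearMap.ker (f : A →ₗ[𝕜] B)
  let ψ : (A ⧸ K) →ₗ[𝕜] B := K.liftQ (f : A →ₗ[𝕜] B) le_rfl
  have hψ : ∀ T, ψ (Submodule.Quotient.mk T) = f T := fun T => rfl
  have hup : ∀ q, ‖ψ q‖ ≤ ‖f‖ * ‖q‖ := fun q => by
    refine le_of_forall_pos_le_add fun ε hε => ?_
    obtain ⟨T, rfl, hT⟩ := Submodule.Quotient.norm_mk_lt q
      (show 0 < ε / (‖f‖ + 1) by positivity)
    rw [hψ]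
    refine (f.le_opNorm T).trans
      ((mul_le_mul_of_nonneg_left hT.le (norm_nonneg f)).trans ?_)
    rw [mul_add]
    gcongr
    rw [← mul_div_assoc, div_le_iff₀ (by positivity)]
    nlinarith [norm_nonneg f]
  have hlow : ∀ q, c * ‖q‖ ≤ ‖ψ q‖ := fun q => by
    obtain ⟨T, rfl⟩ := Submodule.Quotient.mk_surjective K q
    rw [hψ, mul_comm, ← le_div_iff₀ hc]
    refine le_of_forall_lt_imp_le_of_dense fun δ hδ => ?_
    rcases le_or_gt δ 0 with h0 | h0
    · exact h0.trans (by positivity)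
    rw [le_div_iff₀ hc, mul_comm]
    refine h T δ h0 fun S hS => hδ.trans_le ?_
    have h1 : (Submodule.Quotient.mk T : A ⧸ K) = Submodule.Quotient.mk (T - S) :=
      (Submodule.Quotient.eq K).2 (by simpa [K] using hS)
    rw [h1]
    exact Submodule.Quotient.norm_mk_le K _
  have hrange : Set.range f = Set.range ψ := by
    ext y
    constructor
    · rintro ⟨T, rfl⟩
      exact ⟨Submodule.Quotient.mk T, hψ T⟩
    · rintro ⟨q, rfl⟩
      obtain ⟨T, rfl⟩ := Submodule.Quotient.mk_surjective K q
      exact ⟨T, (hψ T).symm⟩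
  rw [hrange]
  refine AntilipschitzWith.isClosed_range (K := Real.toNNReal c⁻¹)
    (AddMonoidHomClass.antilipschitz_of_bound ψ fun q => ?_)
    (AddMonoidHomClass.uniformContinuous_of_bound ψ ‖f‖ hup)
  rw [Real.coe_toNNReal _ (inv_pos.2 hc).le, le_inv_mul_iff₀ hc]
  exact hlow q

theorem norm_comp_le_one {𝕜 F G K : Type*} [RCLike 𝕜] [NormedAddCommGroup F] [NormedSpace 𝕜 F]
    [NormedAddCommGroup G] [NormedSpace 𝕜 G] [NormedAddCommGroup K] [NormedSpace 𝕜 K]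
    (f : G →L[𝕜] K) (g : F →L[𝕜] G) (hf : ‖f‖ ≤ 1) (hg : ‖g‖ ≤ 1) : ‖f.comp g‖ ≤ 1 :=
  (f.opNorm_comp_le g).trans (mul_le_one₀ hf (norm_nonneg _) hg)

section Continuity

variable {𝕜 : Type*} [RCLike 𝕜] {J : Type*} {H : J → Type*}
  [∀ j, NormedAddCommGroup (H j)] [∀ j, NormedSpace 𝕜 (H j)] [∀ j, CompleteSpace (H j)]
  {B : Type*} [NonUnitalNormedRing B] [NormedSpace 𝕜 B]

/-- A homomorphism from the bounded operators on an `ℓ¹`-sum containing sufficiently many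
complemented copies of itself is bounded. -/
theorem exists_bound (φ : (lp H 1 →L[𝕜] lp H 1) →ₙₐ[𝕜] B) {σ : ℕ × J → J}
    (hσ : Function.Injective σ) (s : ∀ n j, H j →L[𝕜] H (σ (n, j)))
    (r : ∀ n j, H (σ (n, j)) →L[𝕜] H j) (hs : ∀ n j, ‖s n j‖ ≤ 1) (hr : ∀ n j, ‖r n j‖ ≤ 1)
    (hrs : ∀ n j x, r n j (s n j x) = x) : ∃ C, ∀ T, ‖φ T‖ ≤ C * ‖T‖ := by
  choose S hS1 hS using fun n : ℕ => exists_colMap (𝕜 := 𝕜) (H := H) (Y := lp H 1) zero_le_one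
    (fun j => (inc 𝕜 H (σ (n, j))).comp (s n j))
    fun j => norm_comp_le_one _ _ (norm_inc_le _) (hs n j)
  choose R hR1 hR _ using fun n : ℕ => exists_inj (𝕜 := 𝕜) (H := H) (Y := lp H 1) zero_le_one
    (fun j => σ (n, j)) (fun i j h => (Prod.mk.inj (hσ h)).2)
    (fun j => (inc 𝕜 H j).comp (r n j))
    fun j => norm_comp_le_one _ _ (norm_inc_le _) (hr n j)
  have hRS : ∀ n, R n * S n = 1 := fun n => clm_ext fun j x => by
    change R n (S n (inc 𝕜 H j x)) = inc 𝕜 H j x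
    rw [hS, ContinuousLinearMap.comp_apply, hR, ContinuousLinearMap.comp_apply, hrs]
  by_contra! hunb
  have hT : ∀ n : ℕ, ∃ T : lp H 1 →L[𝕜] lp H 1, ‖T‖ ≤ 1 ∧
      n * (1 + ‖φ (R n)‖ * ‖φ (S n)‖) < ‖φ T‖ := fun n => by
    obtain ⟨T, hT⟩ := hunb (n * (1 + ‖φ (R n)‖ * ‖φ (S n)‖))
    have hT0 : 0 < ‖T‖ := norm_pos_iff.2 fun h => by simp [h] at hT
    refine ⟨((‖T‖⁻¹ : ℝ) : 𝕜) • T, ?_, ?_⟩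
    · rw [norm_smul, RCLike.norm_ofReal, abs_of_pos (inv_pos.2 hT0), inv_mul_cancel₀ hT0.ne']
    · rw [map_smul, norm_smul, RCLike.norm_ofReal, abs_of_pos (inv_pos.2 hT0),
        lt_inv_mul_iff₀ hT0, mul_comm]
      exact hT
  choose T hT1 hT using hT
  obtain ⟨D, -, hD, -⟩ := exists_glue (𝕜 := 𝕜) (H := H) (Y := lp H 1) zero_le_one
    (fun n : ℕ => Set.range fun j => σ (n, j))
    (by
      rintro k l _ ⟨i, rfl⟩ ⟨j, h⟩
      exact (Prod.mk.inj (hσ h)).1.symm)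
    (fun n => (S n).comp ((T n).comp (R n)))
    fun n => norm_comp_le_one _ _ (hS1 n) (norm_comp_le_one _ _ (hT1 n) (hR1 n))
  have hRDS : ∀ n, R n * D * S n = T n := fun n => clm_ext fun j x => by
    change R n (D (S n (inc 𝕜 H j x))) = _
    rw [hS, ContinuousLinearMap.comp_apply, hD n _ ⟨j, rfl⟩, ContinuousLinearMap.comp_apply,
      ContinuousLinearMap.comp_apply, hR, ContinuousLinearMap.comp_apply, hrs]
    exact DFunLike.congr_fun (hRS n) _
  obtain ⟨n, hn⟩ := exists_nat_ge ‖φ D‖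
  have h1 := hT n
  rw [← hRDS n, map_mul, map_mul] at h1
  have h2 : ‖φ (R n) * φ D * φ (S n)‖ ≤ ‖φ (R n)‖ * n * ‖φ (S n)‖ :=
    (norm_mul_le _ _).trans (mul_le_mul_of_nonneg_right
      ((norm_mul_le _ _).trans (mul_le_mul_of_nonneg_left hn (norm_nonneg _))) (norm_nonneg _))
  have h3 : (0 : ℝ) ≤ n := n.cast_nonneg
  have h4 : n * (1 + ‖φ (R n)‖ * ‖φ (S n)‖) = n + ‖φ (R n)‖ * n * ‖φ (S n)‖ := by ring
  linarith

end Continuity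

theorem exists_contraction_pair (𝕜 : Type*) [RCLike 𝕜] {m n : ℕ} (h : m ≤ n) :
    ∃ (s : EuclideanSpace 𝕜 (Fin m) →L[𝕜] EuclideanSpace 𝕜 (Fin n))
      (r : EuclideanSpace 𝕜 (Fin n) →L[𝕜] EuclideanSpace 𝕜 (Fin m)),
      ‖s‖ ≤ 1 ∧ ‖r‖ ≤ 1 ∧ ∀ x, r (s x) = x := by
  obtain ⟨f, -⟩ := exists_isometry_into (𝕜 := 𝕜) (E := EuclideanSpace 𝕜 (Fin n)) (W := ⊤) (i := m)
    (by simpa using h)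
  obtain ⟨r, hr, hr1⟩ := exists_left_inverse f.toLinearMap one_pos fun x => by simp
  exact ⟨f.toContinuousLinearMap, r, f.norm_toContinuousLinearMap_le, by simpa using hr1, hr⟩

/-- The dimensions of the summands of `(⊕ ℓ₂ⁿ)_{ℓ₁} ⊕ ℓ₁(Γ)`. -/
abbrev dim (Γ : Type*) : ℕ ⊕ Γ → ℕ := Sum.elim id fun _ => 1

theorem exists_injective_dim_le (Γ : Type*) [Infinite Γ] :
    ∃ σ : ℕ × (ℕ ⊕ Γ) → ℕ ⊕ Γ, Function.Injective σ ∧ ∀ p, dim Γ p.2 ≤ dim Γ (σ p) := by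
  obtain ⟨f⟩ : Nonempty (ℕ × Γ ≃ Γ) := by
    rw [← Cardinal.eq, Cardinal.mk_prod, Cardinal.lift_uzero, Cardinal.mk_nat,
      Cardinal.lift_aleph0, Cardinal.mul_eq_right (Cardinal.aleph0_le_mk Γ)
        (Cardinal.aleph0_le_mk Γ) Cardinal.aleph0_ne_zero]
  refine ⟨fun p => Sum.rec (fun m => Sum.inl (Nat.pair p.1 m)) (fun γ => Sum.inr (f (p.1, γ))) p.2,
    ?_, ?_⟩
  · rintro ⟨n, m | γ⟩ ⟨n', m' | γ'⟩ h
    · obtain ⟨rfl, rfl⟩ := Nat.pair_eq_pair.1 (Sum.inl.inj h)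
      rfl
    · cases h
    · cases h
    · obtain ⟨rfl, rfl⟩ := Prod.mk.inj (f.injective (Sum.inr.inj h))
      rfl
  · rintro ⟨n, m | γ⟩
    · exact Nat.right_le_pair n m
    · exact le_rfl

theorem nonempty_prod_continuousLinearEquiv {𝕜 I K : Type*} [RCLike 𝕜] {E₁ : I → Type*}
    {E₂ : K → Type*} {H : I ⊕ K → Type*}
    [∀ i, NormedAddCommGroup (E₁ i)] [∀ i, NormedSpace 𝕜 (E₁ i)] [∀ i, CompleteSpace (E₁ i)]
    [∀ k, NormedAddCommGroup (E₂ k)] [∀ k, NormedSpace 𝕜 (E₂ k)] [∀ k, CompleteSpace (E₂ k)]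
    [∀ j, NormedAddCommGroup (H j)] [∀ j, NormedSpace 𝕜 (H j)] [∀ j, CompleteSpace (H j)]
    (g₁ : ∀ i, E₁ i ≃ₗᵢ[𝕜] H (Sum.inl i)) (g₂ : ∀ k, E₂ k ≃ₗᵢ[𝕜] H (Sum.inr k)) :
    Nonempty ((lp E₁ 1 × lp E₂ 1) ≃L[𝕜] lp H 1) := by
  obtain ⟨S₁, -, hS₁⟩ := exists_colMap (𝕜 := 𝕜) (H := E₁) (Y := lp H 1) zero_le_one
    (fun i => (inc 𝕜 H (Sum.inl i)).comp (g₁ i).toLinearIsometry.toContinuousLinearMap)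
    fun i => norm_comp_le_one _ _ (norm_inc_le _) (LinearIsometry.norm_toContinuousLinearMap_le _)
  obtain ⟨S₂, -, hS₂⟩ := exists_colMap (𝕜 := 𝕜) (H := E₂) (Y := lp H 1) zero_le_one
    (fun k => (inc 𝕜 H (Sum.inr k)).comp (g₂ k).toLinearIsometry.toContinuousLinearMap)
    fun k => norm_comp_le_one _ _ (norm_inc_le _) (LinearIsometry.norm_toContinuousLinearMap_le _)
  obtain ⟨T₁, -, hT₁, hT₁'⟩ := exists_inj (𝕜 := 𝕜) (H := H) (Y := lp E₁ 1) zero_le_one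
    Sum.inl Sum.inl_injective
    (fun i => (inc 𝕜 E₁ i).comp (g₁ i).symm.toLinearIsometry.toContinuousLinearMap)
    fun i => norm_comp_le_one _ _ (norm_inc_le _) (LinearIsometry.norm_toContinuousLinearMap_le _)
  obtain ⟨T₂, -, hT₂, hT₂'⟩ := exists_inj (𝕜 := 𝕜) (H := H) (Y := lp E₂ 1) zero_le_one
    Sum.inr Sum.inr_injective
    (fun k => (inc 𝕜 E₂ k).comp (g₂ k).symm.toLinearIsometry.toContinuousLinearMap)
    fun k => norm_comp_le_one _ _ (norm_inc_le _) (LinearIsometry.norm_toContinuousLinearMap_le _)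
  replace hT₁' : ∀ k x, T₁ (inc 𝕜 H (Sum.inr k) x) = 0 := fun k x => hT₁' _ (by simp) x
  replace hT₂' : ∀ i x, T₂ (inc 𝕜 H (Sum.inl i) x) = 0 := fun i x => hT₂' _ (by simp) x
  have h₁₁ : T₁.comp S₁ = .id 𝕜 _ := clm_ext fun i x => by simp [hS₁, hT₁]
  have h₁₂ : T₁.comp S₂ = 0 := clm_ext fun k x => by simp [hS₂, hT₁']
  have h₂₁ : T₂.comp S₁ = 0 := clm_ext fun i x => by simp [hS₁, hT₂']
  have h₂₂ : T₂.comp S₂ = .id 𝕜 _ := clm_ext fun k x => by simp [hS₂, hT₂]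
  have hST : S₁.comp T₁ + S₂.comp T₂ = .id 𝕜 _ := clm_ext fun j x => by
    rcases j with i | k
    · simp [hT₁, hT₂', hS₁]
    · simp [hT₁', hT₂, hS₂]
  refine ⟨ContinuousLinearEquiv.equivOfInverse (S₁.coprod S₂) (T₁.prod T₂) (fun p => ?_)
    fun z => DFunLike.congr_fun hST z⟩
  have e₁₁ := DFunLike.congr_fun h₁₁ p.1
  have e₁₂ := DFunLike.congr_fun h₁₂ p.2
  have e₂₁ := DFunLike.congr_fun h₂₁ p.1
  have e₂₂ := DFunLike.congr_fun h₂₂ p.2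
  refine Prod.ext ?_ ?_
  · change T₁ (S₁ p.1 + S₂ p.2) = p.1
    rw [map_add]
    exact (congrArg₂ (· + ·) e₁₁ e₁₂).trans (add_zero _)
  · change T₂ (S₁ p.1 + S₂ p.2) = p.2
    rw [map_add]
    exact (congrArg₂ (· + ·) e₂₁ e₂₂).trans (zero_add _)

theorem nonempty_continuousLinearEquiv (𝕜 Γ : Type*) [RCLike 𝕜] :
    Nonempty (WithLp 1 (lp (fun n : ℕ => EuclideanSpace 𝕜 (Fin n)) 1 × lp (fun _ : Γ => 𝕜) 1)
      ≃L[𝕜] lp (fun j : ℕ ⊕ Γ => EuclideanSpace 𝕜 (Fin (dim Γ j))) 1) :=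
  (nonempty_prod_continuousLinearEquiv (H := fun j : ℕ ⊕ Γ => EuclideanSpace 𝕜 (Fin (dim Γ j)))
    (fun i => LinearIsometryEquiv.refl 𝕜 (EuclideanSpace 𝕜 (Fin i)))
    fun _ => (OrthonormalBasis.singleton (Fin 1) 𝕜).repr).map
      (WithLp.prodContinuousLinearEquiv 1 𝕜 _ _).trans

theorem continuous_and_isClosed_range {𝕜 : Type*} [RCLike 𝕜] (Γ : Type*) [Infinite Γ]
    {B : Type*} [NonUnitalNormedRing B] [NormedSpace 𝕜 B]
    (φ : (lp (fun j : ℕ ⊕ Γ => EuclideanSpace 𝕜 (Fin (dim Γ j))) 1 →L[𝕜]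
      lp (fun j : ℕ ⊕ Γ => EuclideanSpace 𝕜 (Fin (dim Γ j))) 1) →ₙₐ[𝕜] B) :
    Continuous φ ∧ IsClosed (Set.range φ) := by
  obtain ⟨σ, hσ, hdim⟩ := exists_injective_dim_le Γ
  choose s r hs hr hrs using fun (n : ℕ) (j : ℕ ⊕ Γ) =>
    exists_contraction_pair 𝕜 (hdim (n, j))
  obtain ⟨C, hC⟩ := exists_bound φ hσ s r hs hr hrs
  have hcont : Continuous φ := AddMonoidHomClass.continuous_of_bound φ C hC
  let u : EuclideanSpace 𝕜 (Fin 1) := EuclideanSpace.single 0 1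
  have hspan : ∀ x : EuclideanSpace 𝕜 (Fin 1), ∃ c : 𝕜, x = c • u := fun x => by
    refine ⟨x 0, ?_⟩
    ext i
    rw [Subsingleton.elim i 0]
    simp [u]
  have hM : (Set.range (Sum.inr : Γ → ℕ ⊕ Γ)).Infinite :=
    Set.infinite_range_of_injective Sum.inr_injective
  have hdim1 : ∀ j : Set.range (Sum.inr : Γ → ℕ ⊕ Γ), ∃ e : EuclideanSpace 𝕜 (Fin (dim Γ j)),
      ‖e‖ = 1 ∧ ∀ x : EuclideanSpace 𝕜 (Fin (dim Γ j)), ∃ c : 𝕜, x = c • e := by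
    rintro ⟨_, γ, rfl⟩
    exact ⟨u, (PiLp.norm_single 2 (fun _ : Fin 1 => 𝕜) _ _).trans norm_one, hspan⟩
  choose e he hspan' using hdim1
  obtain ⟨c, hc, h⟩ := boundedBelowOn_true hC hM e he hspan' Sum.inl_injective
    Set.isCompl_range_inl_range_inr.eq_compl fun i => LinearIsometryEquiv.refl 𝕜 _
  exact ⟨hcont, isClosed_range_of_bound (𝕜 := 𝕜)
    { toFun := φ, map_add' := map_add φ, map_smul' := map_smul φ, cont := hcont } hc
    fun T => h T trivial⟩

end L1Sum

/-- Let `Γ` be an uncountable set and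
`X = (⊕_{n∈ℕ} ℓ₂ⁿ)_{ℓ₁} ⊕ ℓ₁(Γ)`, equipped with the norm `‖(x,y)‖ = ‖x‖ + ‖y‖`.
Then every homomorphism from `B(X)` into a Banach algebra is continuous and has
closed range. -/
theorem statement1 {𝕜 : Type*} [RCLike 𝕜] (Γ : Type*) [Uncountable Γ]
    (B : Type*) [NonUnitalNormedRing B] [NormedSpace 𝕜 B]
    [IsScalarTower 𝕜 B B] [SMulCommClass 𝕜 B B] [CompleteSpace B]
    (φ : (WithLp 1 (lp (fun n : ℕ => EuclideanSpace 𝕜 (Fin n)) 1 × lp (fun _ : Γ => 𝕜) 1) →L[𝕜]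
          WithLp 1 (lp (fun n : ℕ => EuclideanSpace 𝕜 (Fin n)) 1 × lp (fun _ : Γ => 𝕜) 1))
        →ₙₐ[𝕜] B) :
    Continuous φ ∧ IsClosed (Set.range φ) := by
  obtain ⟨E⟩ := L1Sum.nonempty_continuousLinearEquiv 𝕜 Γ
  let Φ := E.conjContinuousAlgEquiv
  let ψ := φ.comp Φ.symm.toAlgEquiv.toAlgHom.toNonUnitalAlgHom
  have hψ : ∀ T, ψ (Φ T) = φ T := fun T => congrArg φ (Φ.symm_apply_apply T)
  obtain ⟨hcont, hclosed⟩ := L1Sum.continuous_and_isClosed_range Γ ψ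
  have heq : (φ : _ → B) = ψ ∘ Φ := funext fun T => (hψ T).symm
  rw [heq, Φ.surjective.range_comp]
  exact ⟨hcont.comp Φ.continuous, hclosed⟩
end
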